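/- Let W be irreducible and let g ∈ W be a regular element of order d. Let m be any function assigning a nonnegative integer m(C) to each W-orbit C of reflecting hyperplanes, such that d does not divide m(C₀) for at least one orbit C₀. Then Σ_χ χ(1)·χ(g⁻¹) = 0, where the sum is over all irreducible complex characters χ of W satisfying c_{χ,C} = m(C) for every orbit C. -/

import Mathlib

open scoped BigOperators

noncomputable section

/-- `χ` is an irreducible complex character of the group `G`. -/
def IsIrredChar (G : Type*) [Group G] (χ : G → ℂ) : Prop :=
  ∃ (n : ℕ) (ρ : Representation ℂ G (Fin n → ℂ)),
    0 < n ∧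
    (∀ U : Submodule ℂ (Fin n → ℂ), (∀ g : G, U.map (ρ g) ≤ U) → U = ⊥ ∨ U = ⊤) ∧
    ∀ g : G, χ g = LinearMap.trace ℂ (Fin n → ℂ) (ρ g)

variable {V : Type*} [AddCommGroup V] [Module ℂ V]

/-- The fixed space `ker (w - id)` of an invertible linear map `w`. -/
def fixedSpace (w : (V →ₗ[ℂ] V)ˣ) : Submodule ℂ V :=
  LinearMap.ker ((w : V →ₗ[ℂ] V) - LinearMap.id)

/-- `w` is a reflection: its fixed space is a hyperplane (codimension 1). -/
def IsReflection (w : (V →ₗ[ℂ] V)ˣ) : Prop :=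
  Module.finrank ℂ V = Module.finrank ℂ (fixedSpace w) + 1

/-- The linear map underlying an element of `W`. -/
def toLin (W : Subgroup (V →ₗ[ℂ] V)ˣ) (w : W) : V →ₗ[ℂ] V :=
  ((w : (V →ₗ[ℂ] V)ˣ) : V →ₗ[ℂ] V)

/-- The set of reflections of `W`. -/
def refls (W : Subgroup (V →ₗ[ℂ] V)ˣ) : Set W :=
  {t | IsReflection (t : (V →ₗ[ℂ] V)ˣ)}

/-- The arrangement of reflecting hyperplanes of `W`. -/
def arrangement (W : Subgroup (V →ₗ[ℂ] V)ˣ) : Set (Submodule ℂ V) :=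
  {H | ∃ t : W, t ∈ refls W ∧ H = fixedSpace (t : (V →ₗ[ℂ] V)ˣ)}

/-- The pointwise stabilizer of a subspace `H` in `W`. -/
def ptStab (W : Subgroup (V →ₗ[ℂ] V)ˣ) (H : Submodule ℂ V) : Set W :=
  {w | ∀ v ∈ H, toLin W w v = v}

/-- The `W`-orbit of a hyperplane `H`. -/
def orbitOf (W : Subgroup (V →ₗ[ℂ] V)ˣ) (H : Submodule ℂ V) : Set (Submodule ℂ V) :=
  {H' | ∃ w : W, H' = H.map (toLin W w)}

/-- The reflections of `W` whose hyperplane lies in the orbit of `H`. -/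
def Cref (W : Subgroup (V →ₗ[ℂ] V)ˣ) (H : Submodule ℂ V) : Set W :=
  {t | t ∈ refls W ∧ fixedSpace (t : (V →ₗ[ℂ] V)ˣ) ∈ orbitOf W H}

/-- `g ∈ W` is a regular element of order `d`: it has a nonzero eigenvector,
with eigenvalue a primitive `d`-th root of unity, lying on no reflecting hyperplane. -/
def IsRegularElt (W : Subgroup (V →ₗ[ℂ] V)ˣ) (g : W) (d : ℕ) : Prop :=
  orderOf g = d ∧ ∃ (ζ : ℂ) (v : V), v ≠ 0 ∧ IsPrimitiveRoot ζ d ∧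
    toLin W g v = ζ • v ∧ ∀ H ∈ arrangement W, v ∉ H

/-- The action of `W` on `V` is irreducible. -/
def IsIrredAction (W : Subgroup (V →ₗ[ℂ] V)ˣ) : Prop :=
  ∀ U : Submodule ℂ V, (∀ w : W, U.map (toLin W w) ≤ U) → U = ⊥ ∨ U = ⊤

/-- `f` is a length-`l` reflection factorization of `g`. -/
def IsReflFac (W : Subgroup (V →ₗ[ℂ] V)ˣ) (g : W) (l : ℕ) (f : Fin l → W) : Prop :=
  (∀ i, f i ∈ refls W) ∧ (List.ofFn f).prod = g

/-- `l` is the reflection length of `g`: the minimal length of a reflection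
factorization of `g`. -/
def IsReflLength (W : Subgroup (V →ₗ[ℂ] V)ˣ) (g : W) (l : ℕ) : Prop :=
  (∃ f : Fin l → W, IsReflFac W g l f) ∧
    ∀ (k : ℕ) (f : Fin k → W), IsReflFac W g k f → l ≤ k

open Classical in
/-- `n` is the minimal number of factors whose hyperplane lies in the orbit `C`,
over all reflection factorizations of `g` (of any length). -/
def IsMinOrbitCount (W : Subgroup (V →ₗ[ℂ] V)ˣ) (g : W)
    (C : Set (Submodule ℂ V)) (n : ℕ) : Prop :=
  (∃ (N : ℕ) (f : Fin N → W), IsReflFac W g N f ∧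
      (Finset.univ.filter fun i => fixedSpace (f i : (V →ₗ[ℂ] V)ˣ) ∈ C).card = n) ∧
  ∀ (N : ℕ) (f : Fin N → W), IsReflFac W g N f →
      n ≤ (Finset.univ.filter fun i => fixedSpace (f i : (V →ₗ[ℂ] V)ˣ) ∈ C).card

/-- Rational functions on `V` with their differential calculus, together with reflection data. -/
structure Setup {G V : Type*} [Group G] [AddCommGroup V] [Module ℂ V]
    (π : Representation ℂ G V) (K : Type) [Field K] [Algebra ℂ K] where
  act : G →* (K →ₐ[ℂ] K)
  X : Module.Dual ℂ V →ₗ[ℂ] K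
  der : V →ₗ[ℂ] Derivation ℂ K K
  X_inj : Function.Injective X
  act_X : ∀ w ξ, act w (X ξ) = X (ξ ∘ₗ π w⁻¹)
  der_X : ∀ v ξ, der v (X ξ) = algebraMap ℂ K (ξ v)
  der_ext : ∀ D : Derivation ℂ K K, (∀ ξ, D (X ξ) = 0) → D = 0
  frac : ∀ f : K, ∃ p ∈ Algebra.adjoin ℂ (Set.range X), ∃ q ∈ Algebra.adjoin ℂ (Set.range X),
    q ≠ 0 ∧ f = p / q
  prime : ∀ ξ : Module.Dual ℂ V, ξ ≠ 0 → ∀ p ∈ Algebra.adjoin ℂ (Set.range X),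
    ∀ q ∈ Algebra.adjoin ℂ (Set.range X),
    (∃ r ∈ Algebra.adjoin ℂ (Set.range X), p * q = X ξ * r) →
    (∃ r ∈ Algebra.adjoin ℂ (Set.range X), p = X ξ * r) ∨
      (∃ r ∈ Algebra.adjoin ℂ (Set.range X), q = X ξ * r)
  nonunit : ∀ ξ : Module.Dual ℂ V, ∀ r ∈ Algebra.adjoin ℂ (Set.range X), X ξ * r ≠ 1
  ev : V → (Algebra.adjoin ℂ (Set.range X) →ₐ[ℂ] ℂ)
  ev_X : ∀ v ξ, ev v ⟨X ξ, Algebra.subset_adjoin ⟨ξ, rfl⟩⟩ = ξ v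
  R : Set G
  α : G → Module.Dual ℂ V
  π_inj : Function.Injective π
  α_ne : ∀ w ∈ R, α w ≠ 0
  α_ker : ∀ w ∈ R, ∀ v, α w v = 0 ↔ π w v = v
  mem_R : ∀ w, w ≠ 1 → (∃ ξ : Module.Dual ℂ V, ξ ≠ 0 ∧ ∀ v, ξ v = 0 → π w v = v) → w ∈ R
  one_R : (1 : G) ∉ R

namespace Setup

variable {G V : Type*} [Group G] [AddCommGroup V] [Module ℂ V]
    {π : Representation ℂ G V} {K : Type} [Field K] [Algebra ℂ K] (S : Setup π K)

abbrev A : Subalgebra ℂ K := Algebra.adjoin ℂ (Set.range S.X)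

lemma X_mem (ξ) : S.X ξ ∈ S.A := Algebra.subset_adjoin ⟨ξ, rfl⟩

lemma X_ne {ξ : Module.Dual ℂ V} (h : ξ ≠ 0) : S.X ξ ≠ 0 := fun h0 =>
  h (S.X_inj (by rw [h0, map_zero]))

lemma act_mul (g h : G) (f : K) : S.act (g * h) f = S.act g (S.act h f) := by
  rw [map_mul]; rfl

lemma act_one (f : K) : S.act 1 f = f := by rw [map_one]; rfl

lemma act_inv_act (g : G) (f : K) : S.act g⁻¹ (S.act g f) = f := by
  rw [← S.act_mul, inv_mul_cancel, S.act_one]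

lemma act_act_inv (g : G) (f : K) : S.act g (S.act g⁻¹ f) = f := by
  rw [← S.act_mul, mul_inv_cancel, S.act_one]

lemma act_A (w : G) {p : K} (hp : p ∈ S.A) : S.act w p ∈ S.A := by
  induction hp using Algebra.adjoin_induction with
  | mem x hx => obtain ⟨ξ, rfl⟩ := hx; rw [S.act_X]; exact S.X_mem _
  | algebraMap r => rw [AlgHom.commutes]; exact Subalgebra.algebraMap_mem _ _
  | add x y _ _ hx hy => rw [map_add]; exact add_mem hx hy
  | mul x y _ _ hx hy => rw [map_mul]; exact mul_mem hx hy

lemma der_A (v : V) {p : K} (hp : p ∈ S.A) : S.der v p ∈ S.A := by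
  induction hp using Algebra.adjoin_induction with
  | mem x hx => obtain ⟨ξ, rfl⟩ := hx; rw [S.der_X]; exact Subalgebra.algebraMap_mem _ _
  | algebraMap r => simp
  | add x y _ _ hx hy => rw [map_add]; exact add_mem hx hy
  | mul x y hx' hy' hx hy =>
    rw [Derivation.leibniz]; exact add_mem (mul_mem hx' hy) (mul_mem hy' hx)

lemma der_ext' (D₁ D₂ : Derivation ℂ K K) (h : ∀ ξ, D₁ (S.X ξ) = D₂ (S.X ξ)) : D₁ = D₂ := by
  have := S.der_ext (D₁ - D₂) (fun ξ => by rw [Derivation.sub_apply, h, sub_self])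
  exact sub_eq_zero.1 this

lemma der_comm (u v : V) (f : K) : S.der u (S.der v f) = S.der v (S.der u f) := by
  have := S.der_ext ⁅S.der u, S.der v⁆ (fun ξ => by
    rw [Derivation.commutator_apply]; simp [S.der_X])
  have h2 := congrArg (fun D : Derivation ℂ K K => D f) this
  simp only [Derivation.commutator_apply, Derivation.zero_apply] at h2
  exact sub_eq_zero.1 h2

/-- conjugate of a derivation by the action -/
def conjDer (w : G) (D : Derivation ℂ K K) : Derivation ℂ K K :=
  Derivation.mk' ((S.act w).toLinearMap ∘ₗ (D : K →ₗ[ℂ] K) ∘ₗ (S.act w⁻¹).toLinearMap) (by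
    intro a b
    simp only [LinearMap.comp_apply, AlgHom.toLinearMap_apply, map_mul, Derivation.coeFn_coe,
      Derivation.leibniz, map_add, smul_eq_mul, S.act_act_inv])

lemma conjDer_apply (w : G) (D : Derivation ℂ K K) (f : K) :
    S.conjDer w D f = S.act w (D (S.act w⁻¹ f)) := rfl

lemma der_act (w : G) (v : V) (f : K) : S.act w (S.der v f) = S.der (π w v) (S.act w f) := by
  have : S.conjDer w (S.der v) = S.der (π w v) := S.der_ext' _ _ (fun ξ => by
    rw [conjDer_apply, S.act_X, S.der_X, S.der_X]; simp)
  rw [← this, conjDer_apply, S.act_inv_act]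

variable [FiniteDimensional ℂ V]

/-- Euler derivation -/
def Eu : Derivation ℂ K K :=
  ∑ i, S.X ((Module.finBasis ℂ V).coord i) • S.der (Module.finBasis ℂ V i)

lemma Eu_apply (f : K) : S.Eu f =
    ∑ i, S.X ((Module.finBasis ℂ V).coord i) * S.der (Module.finBasis ℂ V i) f := by
  unfold Eu
  induction (Finset.univ : Finset (Fin (Module.finrank ℂ V))) using Finset.induction_on with
  | empty => simp
  | insert a s ha ih => rw [Finset.sum_insert ha, Finset.sum_insert ha, ← ih]; simp

lemma sum_coord (ξ : Module.Dual ℂ V) :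
    ∑ i, S.X ((Module.finBasis ℂ V).coord i) * algebraMap ℂ K (ξ (Module.finBasis ℂ V i))
      = S.X ξ := by
  have : ξ = ∑ i, ξ (Module.finBasis ℂ V i) • (Module.finBasis ℂ V).coord i := by
    apply (Module.finBasis ℂ V).ext
    intro j
    simp [LinearMap.sum_apply, Finsupp.single_apply]
  conv_rhs => rw [this]
  rw [map_sum]
  refine Finset.sum_congr rfl fun i _ => ?_
  rw [map_smul, Algebra.smul_def, mul_comm]

lemma Eu_X (ξ) : S.Eu (S.X ξ) = S.X ξ := by
  rw [Eu_apply]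
  simp_rw [S.der_X]
  exact S.sum_coord ξ

lemma Eu_act (w : G) (f : K) : S.Eu (S.act w f) = S.act w (S.Eu f) := by
  have : S.conjDer w S.Eu = S.Eu := S.der_ext' _ _ (fun ξ => by
    rw [conjDer_apply, S.act_X, S.Eu_X, S.Eu_X, S.act_X]; congr 1; ext v; simp)
  rw [← this, conjDer_apply, S.act_inv_act, this]

lemma Eu_der (v : V) (f : K) : S.Eu (S.der v f) = S.der v (S.Eu f) - S.der v f := by
  have := S.der_ext' ⁅S.Eu, S.der v⁆ (-S.der v) (fun ξ => by
    rw [Derivation.commutator_apply, S.der_X, S.Eu_X, Derivation.neg_apply, S.der_X]; simp)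
  have h2 := congrArg (fun D : Derivation ℂ K K => D f) this
  simp only [Derivation.commutator_apply, Derivation.neg_apply] at h2
  rw [← sub_eq_zero] at h2 ⊢
  rw [← h2]; ring

omit [FiniteDimensional ℂ V] in
/-- `α_w(v)/α_w` -/
def ell (w : G) (v : V) : K := algebraMap ℂ K (S.α w v) / S.X (S.α w)

omit [FiniteDimensional ℂ V]

lemma ell_add (w : G) (u v : V) : S.ell w (u + v) = S.ell w u + S.ell w v := by
  simp [ell, add_div]

lemma ell_smul (w : G) (c : ℂ) (v : V) : S.ell w (c • v) = c • S.ell w v := by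
  simp [ell, Algebra.smul_def, mul_div_assoc]

lemma prop_of_ker {ξ η : Module.Dual ℂ V} (hη : η ≠ 0) (hξ : ξ ≠ 0)
    (h : ∀ v, ξ v = 0 → η v = 0) : ∃ c : ℂ, c ≠ 0 ∧ η = c • ξ := by
  obtain ⟨v0, hv0⟩ : ∃ v, ξ v ≠ 0 := by
    by_contra hc; push Not at hc; exact hξ (LinearMap.ext hc)
  have key : η = (η v0 / ξ v0) • ξ := by
    ext v
    have := h (v - (ξ v / ξ v0) • v0) (by simp [hv0])
    rw [map_sub, map_smul, sub_eq_zero] at this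
    rw [this]; simp; field_simp
  refine ⟨_, ?_, key⟩
  intro h0
  rw [h0, zero_smul] at key
  exact hη key

lemma ell_eq {w : G} (hw : w ∈ S.R) {ξ : Module.Dual ℂ V} (hξ : ξ ≠ 0)
    (h : ∀ v, ξ v = 0 → S.α w v = 0) (v : V) : S.ell w v = algebraMap ℂ K (ξ v) / S.X ξ := by
  obtain ⟨c, hc, hh⟩ := prop_of_ker (S.α_ne w hw) hξ h
  rw [ell, hh, LinearMap.smul_apply, smul_eq_mul, map_mul, map_smul, Algebra.smul_def]
  have : algebraMap ℂ K c ≠ 0 := by simpa using hc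
  have := S.X_ne hξ
  field_simp

lemma R_conj {h w : G} (hw : w ∈ S.R) : h * w * h⁻¹ ∈ S.R := by
  apply S.mem_R
  · intro h1
    apply S.one_R
    have : w = 1 := by
      have := congrArg (fun x => h⁻¹ * x * h) h1
      simpa [mul_assoc] using this
    rwa [this] at hw
  · refine ⟨S.α w ∘ₗ π h⁻¹, ?_, ?_⟩
    · intro h0
      apply S.α_ne w hw
      ext v
      have := LinearMap.congr_fun h0 (π h v)
      simpa using this
    · intro v hv
      have := (S.α_ker w hw _).1 hv
      simp [map_mul, this]

lemma act_ell {w : G} (hw : w ∈ S.R) (h : G) (v : V) :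
    S.act h (S.ell w v) = S.ell (h * w * h⁻¹) (π h v) := by
  have hc := S.R_conj (h := h) hw
  have hne : S.α w ∘ₗ π h⁻¹ ≠ 0 := by
    intro h0
    apply S.α_ne w hw
    ext v
    have := LinearMap.congr_fun h0 (π h v)
    simpa using this
  rw [S.ell_eq hc hne, ell, map_div₀, AlgHom.commutes, S.act_X]
  · simp
  · intro v hv
    rw [S.α_ker _ hc]
    have := (S.α_ker w hw _).1 hv
    simp [map_mul, this]

lemma deriv_inv (D : Derivation ℂ K K) {x : K} (hx : x ≠ 0) (c : ℂ) :
    D (algebraMap ℂ K c / x) = -(D x / x) * (algebraMap ℂ K c / x) := by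
  have h := D.leibniz (algebraMap ℂ K c / x) x
  rw [div_mul_cancel₀ _ hx, Derivation.map_algebraMap, smul_eq_mul, smul_eq_mul] at h
  field_simp
  field_simp at h
  linear_combination -h

lemma der_ell {w : G} (hw : w ∈ S.R) (u v : V) :
    S.der u (S.ell w v) = - S.ell w u * S.ell w v := by
  rw [ell, deriv_inv _ (S.X_ne (S.α_ne w hw)), S.der_X]; rfl

lemma Eu_ell [FiniteDimensional ℂ V] {w : G} (hw : w ∈ S.R) (v : V) :
    S.Eu (S.ell w v) = - S.ell w v := by
  have := (S.X_ne (S.α_ne w hw))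
  rw [ell, deriv_inv _ this, S.Eu_X]; field_simp

lemma sum_ell [FiniteDimensional ℂ V] {w : G} (hw : w ∈ S.R) :
    ∑ i, S.X ((Module.finBasis ℂ V).coord i) * S.ell w (Module.finBasis ℂ V i) = 1 := by
  have h := (S.X_ne (S.α_ne w hw))
  simp_rw [ell, ← mul_div_assoc]
  rw [← Finset.sum_div, S.sum_coord, div_self h]

/-- Parameters: functions on reflections depending only on the orbit of the hyperplane. -/
structure Param (a : G → ℂ) : Prop where
  supp : ∀ w, w ∉ S.R → a w = 0
  conj : ∀ h w, a (h * w * h⁻¹) = a w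
  same : ∀ w ∈ S.R, ∀ w' ∈ S.R, (∀ v, S.α w v = 0 → S.α w' v = 0) → a w = a w'

end Setup

namespace Setup

variable {G V : Type*} [Group G] [AddCommGroup V] [Module ℂ V]
    {π : Representation ℂ G V} {K : Type} [Field K] [Algebra ℂ K] (S : Setup π K)
    {Y : Type*} [AddCommGroup Y] [Module ℂ Y] (σ : Representation ℂ G Y)

lemma alpha_inv {w : G} (hw : w ∈ S.R) : w⁻¹ ∈ S.R ∧ ∀ v, S.α w v = 0 → S.α w⁻¹ v = 0 := by
  have h1 : ∀ v, S.α w v = 0 → π w⁻¹ v = v := by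
    intro v hv
    have := (S.α_ker w hw v).1 hv
    conv_lhs => rw [← this]
    simp
  have h2 : w⁻¹ ∈ S.R := by
    apply S.mem_R
    · intro h; apply S.one_R; rw [inv_eq_one] at h; rwa [h] at hw
    · exact ⟨_, S.α_ne w hw, h1⟩
  exact ⟨h2, fun v hv => (S.α_ker _ h2 v).2 (h1 v hv)⟩

lemma ell_inv {w : G} (hw : w ∈ S.R) (v : V) : S.ell w⁻¹ v = S.ell w v :=
  S.ell_eq (S.alpha_inv hw).1 (S.α_ne w hw) (S.alpha_inv hw).2 v

lemma Param.inv {S : Setup π K} {a : G → ℂ} (ha : S.Param a) (w : G) : a w⁻¹ = a w := by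
  by_cases hw : w ∈ S.R
  · exact (ha.same w hw _ (S.alpha_inv hw).1 (S.alpha_inv hw).2).symm
  · rw [ha.supp w hw, ha.supp]
    intro h; apply hw; simpa using (S.alpha_inv h).1

lemma Param.neg {S : Setup π K} {a : G → ℂ} (ha : S.Param a) : S.Param (fun w => - a w) :=
  ⟨fun w hw => by simp [ha.supp w hw], fun h w => by simp [ha.conj h w],
    fun w hw w' hw' h => by simp [ha.same w hw w' hw' h]⟩

/-- composition with a `ℂ`-linear endomorphism of `K`. -/
def post (D : K →ₗ[ℂ] K) : Module.End ℂ (Y →ₗ[ℂ] K) where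
  toFun F := D ∘ₗ F
  map_add' F F' := by ext; simp
  map_smul' c F := by ext; simp

@[simp] lemma post_apply (D : K →ₗ[ℂ] K) (F : Y →ₗ[ℂ] K) (y : Y) :
    post D F y = D (F y) := rfl

/-- the action on values trivial, on arguments -/
def Rr (w : G) : Module.End ℂ (Y →ₗ[ℂ] K) where
  toFun F := F ∘ₗ σ w⁻¹
  map_add' F F' := by ext; simp
  map_smul' c F := by ext; simp

@[simp] lemma Rr_apply (w : G) (F : Y →ₗ[ℂ] K) (y : Y) : Rr σ w F y = F (σ w⁻¹ y) := rfl

/-- the diagonal action -/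
def Dg : Representation ℂ G (Y →ₗ[ℂ] K) where
  toFun w := 
    { toFun := fun F => (S.act w).toLinearMap ∘ₗ F ∘ₗ σ w⁻¹
      map_add' := fun F F' => by ext; simp
      map_smul' := fun c F => by ext; simp }
  map_one' := by ext F y; simp
  map_mul' g h := by ext F y; simp

@[simp] lemma Dg_apply (w : G) (F : Y →ₗ[ℂ] K) (y : Y) :
    S.Dg σ w F y = S.act w (F (σ w⁻¹ y)) := rfl

lemma Dg_smulK (w : G) (k : K) (F : Y →ₗ[ℂ] K) :
    S.Dg σ w (k • F) = S.act w k • S.Dg σ w F := by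
  ext y; simp

variable [Fintype G]

/-- the KZ connection -/
def nab (a : G → ℂ) (v : V) : Module.End ℂ (Y →ₗ[ℂ] K) :=
  post (S.der v : K →ₗ[ℂ] K) +
    ∑ w, a w • (post (LinearMap.mulLeft ℂ (S.ell w v)) ∘ₗ (LinearMap.id - Rr σ w))

lemma nab_apply (a : G → ℂ) (v : V) (F : Y →ₗ[ℂ] K) (y : Y) :
    S.nab σ a v F y = S.der v (F y) + ∑ w, a w • (S.ell w v * (F y - F (σ w⁻¹ y))) := by
  simp [nab, LinearMap.add_apply, LinearMap.sum_apply, mul_sub]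

/-- the Dunkl part -/
def Bd (b : G → ℂ) (v : V) : Module.End ℂ (Y →ₗ[ℂ] K) :=
  ∑ w, b w • (post (LinearMap.mulLeft ℂ (S.ell w v)) ∘ₗ (LinearMap.id - S.Dg σ w))

lemma Bd_apply' (b : G → ℂ) (v : V) (F : Y →ₗ[ℂ] K) :
    S.Bd σ b v F = ∑ w, b w • (S.ell w v • (F - S.Dg σ w F)) := by
  ext y
  simp [Bd, LinearMap.sum_apply, mul_sub]

lemma Bd_apply (b : G → ℂ) (v : V) (F : Y →ₗ[ℂ] K) (y : Y) :
    S.Bd σ b v F y = ∑ w, b w • (S.ell w v * (F y - S.act w (F (σ w⁻¹ y)))) := by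
  simp [Bd_apply', LinearMap.sum_apply, mul_sub]

/-- the Dunkl operator -/
def T (a b : G → ℂ) (v : V) : Module.End ℂ (Y →ₗ[ℂ] K) := S.nab σ a v - S.Bd σ b v

lemma T_apply (a b : G → ℂ) (v : V) (F : Y →ₗ[ℂ] K) :
    S.T σ a b v F = S.nab σ a v F - S.Bd σ b v F := rfl

lemma nab_smulK (a : G → ℂ) (v : V) (k : K) (F : Y →ₗ[ℂ] K) :
    S.nab σ a v (k • F) = S.der v k • F + k • S.nab σ a v F := by
  ext y
  simp only [nab_apply, LinearMap.smul_apply, LinearMap.add_apply, smul_eq_mul,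
    Derivation.leibniz, mul_add, Finset.mul_sum, Algebra.smul_def]
  rw [add_assoc, add_left_comm, mul_comm (S.der v k)]
  congr 2
  exact Finset.sum_congr rfl fun w _ => by ring

lemma nab_add (a : G → ℂ) (u v : V) : S.nab σ a (u + v) = S.nab σ a u + S.nab σ a v := by
  ext F y
  simp only [nab_apply, LinearMap.add_apply, map_add, Derivation.add_apply, ell_add, add_mul,
    smul_add, Finset.sum_add_distrib]
  abel

lemma nab_smul (a : G → ℂ) (c : ℂ) (v : V) : S.nab σ a (c • v) = c • S.nab σ a v := by
  ext F y
  simp only [nab_apply, LinearMap.smul_apply, map_smul, Derivation.smul_apply, ell_smul, smul_add,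
    Finset.smul_sum]
  congr 1
  exact Finset.sum_congr rfl fun w _ => by rw [smul_mul_assoc, smul_comm]

lemma Bd_add (a : G → ℂ) (u v : V) : S.Bd σ a (u + v) = S.Bd σ a u + S.Bd σ a v := by
  ext F y
  simp only [Bd_apply, LinearMap.add_apply, ell_add, add_mul,
    smul_add, Finset.sum_add_distrib]

lemma Bd_smul (a : G → ℂ) (c : ℂ) (v : V) : S.Bd σ a (c • v) = c • S.Bd σ a v := by
  ext F y
  simp only [Bd_apply, LinearMap.smul_apply, ell_smul, 
    Finset.smul_sum]
  exact Finset.sum_congr rfl fun w _ => by rw [smul_mul_assoc, smul_comm]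

lemma T_add (a b : G → ℂ) (u v : V) : S.T σ a b (u + v) = S.T σ a b u + S.T σ a b v := by
  rw [T, T, T, nab_add, Bd_add]; abel

lemma T_smul (a b : G → ℂ) (c : ℂ) (v : V) : S.T σ a b (c • v) = c • S.T σ a b v := by
  ext F y; simp [T_apply, nab_smul, Bd_smul, smul_sub]

lemma sum_conj {M : Type*} [AddCommMonoid M] (h : G) (f : G → M) :
    ∑ w, f (h * w * h⁻¹) = ∑ w, f w :=
  (MulAut.conj h).toEquiv.sum_comp f

lemma Dg_nab {a : G → ℂ} (ha : S.Param a) (h : G) (v : V) (F : Y →ₗ[ℂ] K) :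
    S.Dg σ h (S.nab σ a v F) = S.nab σ a (π h v) (S.Dg σ h F) := by
  ext y
  rw [Dg_apply, nab_apply, nab_apply, map_add, Dg_apply, S.der_act, map_sum,
    ← sum_conj h (fun w => a w • (S.ell w (π h v) *
      (S.act h (F (σ h⁻¹ y)) - S.Dg σ h F (σ w⁻¹ y))))]
  congr 1
  refine Finset.sum_congr rfl fun w _ => ?_
  rw [ha.conj]
  by_cases hw : w ∈ S.R
  · rw [map_smul, map_mul, S.act_ell hw, map_sub, Dg_apply]
    have : σ w⁻¹ (σ h⁻¹ y) = σ h⁻¹ (σ (h * w * h⁻¹)⁻¹ y) := by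
      simp only [← LinearMap.comp_apply, ← Module.End.mul_eq_comp, ← map_mul]
      congr 2
      group
    rw [this]
  · simp [ha.supp w hw]

lemma Dg_Bd {b : G → ℂ} (hb : S.Param b) (h : G) (v : V) (F : Y →ₗ[ℂ] K) :
    S.Dg σ h (S.Bd σ b v F) = S.Bd σ b (π h v) (S.Dg σ h F) := by
  rw [Bd_apply', Bd_apply', map_sum, ← sum_conj h (fun w => b w • (S.ell w (π h v) •
    (S.Dg σ h F - S.Dg σ w (S.Dg σ h F))))]
  refine Finset.sum_congr rfl fun w _ => ?_
  rw [hb.conj]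
  by_cases hw : w ∈ S.R
  · rw [map_smul, Dg_smulK, S.act_ell hw, map_sub]
    congr 3
    simp only [← LinearMap.comp_apply, ← Module.End.mul_eq_comp, ← map_mul]
    congr 2
    group
  · simp [hb.supp w hw]

lemma Dg_T {a b : G → ℂ} (ha : S.Param a) (hb : S.Param b) (h : G) (v : V) (F : Y →ₗ[ℂ] K) :
    S.Dg σ h (S.T σ a b v F) = S.T σ a b (π h v) (S.Dg σ h F) := by
  rw [T_apply, T_apply, map_sub, S.Dg_nab σ ha, S.Dg_Bd σ hb]

lemma Bd_smulK (b : G → ℂ) (v : V) (k : K) (F : Y →ₗ[ℂ] K) :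
    S.Bd σ b v (k • F) = k • S.Bd σ b v F +
      ∑ w, b w • ((S.ell w v * (k - S.act w k)) • S.Dg σ w F) := by
  rw [Bd_apply', Bd_apply', Finset.smul_sum, ← Finset.sum_add_distrib]
  refine Finset.sum_congr rfl fun w _ => ?_
  rw [Dg_smulK]
  ext y
  simp only [LinearMap.add_apply, LinearMap.smul_apply, LinearMap.sub_apply, smul_eq_mul,
    Algebra.smul_def]
  ring

section Eu
variable [FiniteDimensional ℂ V]

/-- Euler operator on vector valued functions -/
def EuE : Module.End ℂ (Y →ₗ[ℂ] K) := post (S.Eu : K →ₗ[ℂ] K)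

omit [Fintype G] in
@[simp] lemma EuE_apply (F : Y →ₗ[ℂ] K) (y : Y) : S.EuE F y = S.Eu (F y) := rfl

omit [Fintype G] in
lemma EuE_smulK (k : K) (F : Y →ₗ[ℂ] K) : S.EuE (k • F) = S.Eu k • F + k • S.EuE F := by
  ext y; simp [Derivation.leibniz]; ring

omit [Fintype G] in
lemma EuE_Dg (w : G) (F : Y →ₗ[ℂ] K) : S.EuE (S.Dg σ w F) = S.Dg σ w (S.EuE F) := by
  ext y; simp [S.Eu_act]

lemma EuE_T {a b : G → ℂ} (ha : S.Param a) (hb : S.Param b) (v : V) (F : Y →ₗ[ℂ] K) :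
    S.EuE (S.T σ a b v F) = S.T σ a b v (S.EuE F) - S.T σ a b v F := by
  have h1 : S.EuE (S.nab σ a v F) = S.nab σ a v (S.EuE F) - S.nab σ a v F := by
    ext y
    rw [EuE_apply, nab_apply, LinearMap.sub_apply, nab_apply, nab_apply, map_add, EuE_apply,
      S.Eu_der, map_sum]
    rw [add_sub_add_comm]
    congr 1
    rw [← Finset.sum_sub_distrib]
    refine Finset.sum_congr rfl fun w _ => ?_
    by_cases hw : w ∈ S.R
    · rw [Derivation.map_smul, Derivation.leibniz, S.Eu_ell hw]
      simp [Algebra.smul_def]; ring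
    · simp [ha.supp w hw]
  have h2 : S.EuE (S.Bd σ b v F) = S.Bd σ b v (S.EuE F) - S.Bd σ b v F := by
    rw [Bd_apply', Bd_apply', map_sum, ← Finset.sum_sub_distrib]
    refine Finset.sum_congr rfl fun w _ => ?_
    by_cases hw : w ∈ S.R
    · rw [map_smul, EuE_smulK, S.Eu_ell hw, map_sub, EuE_Dg]
      ext y
      simp [Algebra.smul_def]; ring
    · simp [hb.supp w hw]
  rw [T_apply, T_apply, map_sub, h1, h2]; abel

lemma sum_T {a b : G → ℂ} (ha : S.Param a) (hb : S.Param b) (F : Y →ₗ[ℂ] K) :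
    ∑ i, S.X ((Module.finBasis ℂ V).coord i) • S.T σ a b (Module.finBasis ℂ V i) F =
      S.EuE F + ∑ w, a w • (F - Rr σ w F) - ∑ w, b w • (F - S.Dg σ w F) := by
  have key : ∀ (c : G → ℂ) (_ : S.Param c) (H : G → (Y →ₗ[ℂ] K)),
      ∑ i, S.X ((Module.finBasis ℂ V).coord i) •
        ∑ w, c w • (S.ell w (Module.finBasis ℂ V i) • H w) = ∑ w, c w • H w := by
    intro c hc H
    simp_rw [Finset.smul_sum]
    rw [Finset.sum_comm]
    refine Finset.sum_congr rfl fun w _ => ?_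
    by_cases hw : w ∈ S.R
    · conv_rhs => rw [← one_smul K (H w), ← S.sum_ell hw, Finset.sum_smul, Finset.smul_sum]
      refine Finset.sum_congr rfl fun i _ => ?_
      rw [smul_comm, smul_smul]
    · simp [hc.supp w hw]
  have hn : ∀ v, S.nab σ a v F = post (S.der v : K →ₗ[ℂ] K) F +
      ∑ w, a w • (S.ell w v • (F - Rr σ w F)) := by
    intro v; ext y; simp [nab_apply, LinearMap.sum_apply]
  have hs : ∀ (k : K) (x y z : Y →ₗ[ℂ] K), k • (x + y - z) = k • x + k • y - k • z := by
    intro k x y z; rw [smul_sub, smul_add]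
  simp_rw [T_apply, hn, Bd_apply', hs]
  rw [Finset.sum_sub_distrib, Finset.sum_add_distrib, key a ha, key b hb]
  congr 2
  ext y
  simp [LinearMap.sum_apply, S.Eu_apply]

end Eu

end Setup

namespace Setup

lemma comp_of_eig {M : Type*} [AddCommGroup M] [Module ℂ M] (f : Module.End ℂ M)
    (P : ℕ → Submodule ℂ M) (hP : ∀ k, P k ≤ f.eigenspace (k : ℂ)) {x : M}
    (hx : x ∈ ⨆ k, P k) {j : ℂ} (hj : f x = j • x) :
    (∀ k : ℕ, (k : ℂ) = j → x ∈ P k) ∧ ((∀ k : ℕ, (k : ℂ) ≠ j) → x = 0) := by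
  have ind := f.eigenspaces_iSupIndep
  have hxj : x ∈ f.eigenspace j := Module.End.mem_eigenspace_iff.2 hj
  constructor
  · intro k hk
    subst hk
    rw [iSup_split_single _ k] at hx
    obtain ⟨p, hp, q, hq, rfl⟩ := Submodule.mem_sup.1 hx
    have hq1 : q ∈ f.eigenspace (k : ℂ) := by
      have := Submodule.sub_mem _ hxj (hP k hp)
      simpa using this
    have hq2 : q ∈ ⨆ (μ : ℂ) (_ : μ ≠ k), f.eigenspace μ := by
      refine (iSup₂_le fun i hi => ?_ : (⨆ (i) (_ : i ≠ k), P i) ≤ _) hq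
      refine (hP i).trans ?_
      exact le_iSup₂_of_le (i : ℂ) (by exact_mod_cast hi) le_rfl
    have := (Submodule.disjoint_def.1 (ind (k : ℂ))) q hq1 hq2
    rw [this, add_zero]; exact hp
  · intro h
    refine (Submodule.disjoint_def.1 (ind j)) x hxj ?_
    refine (iSup_le fun i => ?_ : (⨆ i, P i) ≤ _) hx
    exact (hP i).trans (le_iSup₂_of_le (i : ℂ) (h i) le_rfl)

lemma comps_mem {M : Type*} [AddCommGroup M] [Module ℂ M] (f : Module.End ℂ M)
    (N : Submodule ℂ M) (hN : ∀ x ∈ N, f x ∈ N) (s : Finset ℕ) (x : ℕ → M)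
    (hx : ∀ k ∈ s, f (x k) = (k : ℂ) • x k) (hs : ∑ k ∈ s, x k ∈ N) : ∀ k ∈ s, x k ∈ N := by
  induction s using Finset.induction_on generalizing x with
  | empty => simp
  | insert k0 s hk0 ih =>
    have h1 : ∑ k ∈ s, ((k : ℂ) - k0) • x k ∈ N := by
      have h2 := sub_mem (hN _ hs) (N.smul_mem (k0 : ℂ) hs)
      convert h2 using 1
      rw [map_sum, Finset.smul_sum, ← Finset.sum_sub_distrib, Finset.sum_insert hk0,
        hx k0 (Finset.mem_insert_self _ _), sub_self, zero_add]
      refine Finset.sum_congr rfl fun k hk => ?_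
      rw [hx k (Finset.mem_insert_of_mem hk), sub_smul]
    have h3 := ih (fun k => ((k : ℂ) - k0) • x k) (fun k hk => by
      rw [map_smul, hx k (Finset.mem_insert_of_mem hk), smul_comm]) h1
    have h4 : ∀ k ∈ s, x k ∈ N := by
      intro k hk
      have h5 : ((k : ℂ) - k0) ≠ 0 := by
        rw [sub_ne_zero]; intro h; apply hk0
        have : k = k0 := by exact_mod_cast h
        rwa [← this]
      exact (Submodule.smul_mem_iff N h5).1 (h3 k hk)
    intro k hk
    rcases Finset.mem_insert.1 hk with rfl | hk
    · rw [Finset.sum_insert hk0] at hs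
      have := sub_mem hs (Submodule.sum_mem N h4)
      simpa using this
    · exact h4 k hk

lemma graded_of_stable {M : Type*} [AddCommGroup M] [Module ℂ M] (f : Module.End ℂ M)
    (N : Submodule ℂ M) (hN : ∀ x ∈ N, f x ∈ N) (hd : N ≤ ⨆ k : ℕ, f.eigenspace (k : ℂ)) :
    N ≤ ⨆ k : ℕ, N ⊓ f.eigenspace (k : ℂ) := by
  intro x hx
  obtain ⟨y, hy, hxy⟩ := (Submodule.mem_iSup_iff_exists_finsupp _ _).1 (hd hx)
  have h1 := comps_mem f N hN y.support y
    (fun k _ => Module.End.mem_eigenspace_iff.1 (hy k)) (by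
      have : ∑ k ∈ y.support, y k = x := hxy
      rw [this]; exact hx)
  rw [← hxy]
  exact Submodule.sum_mem _ fun k hk =>
    (le_iSup (fun k : ℕ => N ⊓ f.eigenspace (k : ℂ)) k) ⟨h1 k hk, hy k⟩

variable {G V : Type*} [Group G] [AddCommGroup V] [Module ℂ V]
    {π : Representation ℂ G V} {K : Type} [Field K] [Algebra ℂ K] (S : Setup π K)
    {Y : Type*} [AddCommGroup Y] [Module ℂ Y] (σ : Representation ℂ G Y)

/-- homogeneous polynomials -/
def Ak (k : ℕ) : Submodule ℂ K := (LinearMap.range S.X) ^ k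

lemma Ak_A (k : ℕ) : S.Ak k ≤ Subalgebra.toSubmodule S.A := by
  unfold Ak
  induction k with
  | zero => 
    rw [pow_zero, Submodule.one_le]
    exact one_mem S.A
  | succ k ih =>
    rw [pow_succ, Submodule.mul_le]
    rintro m hm _ ⟨ξ, rfl⟩
    exact mul_mem (S := Subalgebra ℂ K) (s := S.A) (ih hm) (S.X_mem ξ)

lemma A_le : Subalgebra.toSubmodule S.A ≤ ⨆ k, S.Ak k := by
  rw [Algebra.adjoin_eq_span, Submodule.span_le]
  intro x hx
  have : ∃ k, x ∈ S.Ak k := by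
    induction hx using Submonoid.closure_induction with
    | mem x hx => exact ⟨1, by rw [Ak, pow_one]; exact hx⟩
    | one => exact ⟨0, by rw [Ak, pow_zero]; exact Submodule.one_le.1 le_rfl⟩
    | mul x y _ _ hx hy =>
      obtain ⟨k, hk⟩ := hx
      obtain ⟨l, hl⟩ := hy
      exact ⟨k + l, by rw [Ak, pow_add]; exact Submodule.mul_mem_mul hk hl⟩
  obtain ⟨k, hk⟩ := this
  exact (le_iSup S.Ak k) hk

section
variable [FiniteDimensional ℂ V]

lemma Eu_Ak (k : ℕ) {p : K} (hp : p ∈ S.Ak k) : S.Eu p = (k : ℂ) • p := by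
  induction k generalizing p with
  | zero => 
    rw [Ak, pow_zero] at hp
    obtain ⟨c, rfl⟩ := Submodule.mem_one.1 hp
    simp
  | succ k ih =>
    rw [Ak, pow_succ] at hp
    induction hp using Submodule.mul_induction_on' with
    | mem_mul_mem m hm n hn =>
      obtain ⟨ξ, rfl⟩ := hn
      rw [Derivation.leibniz, ih hm, S.Eu_X]
      simp only [smul_eq_mul, Algebra.smul_def (A := K) (_ : ℂ), map_natCast, Nat.cast_add, Nat.cast_one, map_add, map_one]; ring
    | add x _ y _ hx hy => rw [map_add, hx, hy, smul_add]

lemma mem_Ak {p : K} (hp : p ∈ S.A) (k : ℕ) (h : S.Eu p = (k : ℂ) • p) : p ∈ S.Ak k :=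
  (comp_of_eig (S.Eu : K →ₗ[ℂ] K) S.Ak
    (fun k p hp => Module.End.mem_eigenspace_iff.2 (S.Eu_Ak k hp)) (S.A_le hp) h).1 k rfl

lemma ev_Ak (v : V) (c : ℂ) (k : ℕ) {p : K} (hp : p ∈ S.Ak k) (hA : p ∈ S.A) :
    S.ev (c • v) ⟨p, hA⟩ = c ^ k * S.ev v ⟨p, hA⟩ := by
  induction k generalizing p with
  | zero => 
    rw [Ak, pow_zero] at hp
    obtain ⟨d, rfl⟩ := Submodule.mem_one.1 hp
    have : (⟨algebraMap ℂ K d, hA⟩ : S.A) = algebraMap ℂ S.A d := rfl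
    rw [this, AlgHom.commutes, AlgHom.commutes]; simp
  | succ k ih =>
    rw [Ak, pow_succ] at hp
    induction hp using Submodule.mul_induction_on' with
    | mem_mul_mem m hm n hn =>
      obtain ⟨ξ, rfl⟩ := hn
      have hm' := S.Ak_A k hm
      have : (⟨m * S.X ξ, hA⟩ : S.A) = ⟨m, hm'⟩ * ⟨S.X ξ, S.X_mem ξ⟩ := rfl
      rw [this, map_mul, map_mul, ih hm hm', S.ev_X, S.ev_X]
      simp; ring
    | add x hx' y hy' hx hy =>
      have hxA := S.Ak_A (k + 1) (by rw [Ak, pow_succ]; exact hx')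
      have hyA := S.Ak_A (k + 1) (by rw [Ak, pow_succ]; exact hy')
      have : (⟨x + y, hA⟩ : S.A) = ⟨x, hxA⟩ + ⟨y, hyA⟩ := rfl
      rw [this, map_add, map_add, hx hxA, hy hyA]; ring

/-- polynomial valued functions -/
def HA (Y : Type*) [AddCommGroup Y] [Module ℂ Y] : Submodule ℂ (Y →ₗ[ℂ] K) where
  carrier := {F | ∀ y, F y ∈ S.A}
  add_mem' := fun ha hb y => add_mem (ha y) (hb y)
  zero_mem' := fun y => zero_mem _
  smul_mem' := fun c F hF y => Subalgebra.smul_mem _ (hF y) c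

/-- constant functions -/
def cst (c : Module.Dual ℂ Y) : Y →ₗ[ℂ] K := Algebra.linearMap ℂ K ∘ₗ c

omit [FiniteDimensional ℂ V] in
lemma mem_HA {F : Y →ₗ[ℂ] K} : F ∈ S.HA Y ↔ ∀ y, F y ∈ S.A := Iff.rfl

@[simp] lemma cst_apply (c : Module.Dual ℂ Y) (y : Y) : cst (K := K) c y = algebraMap ℂ K (c y) :=
  rfl

lemma expand [FiniteDimensional ℂ Y] (F : Y →ₗ[ℂ] K) :
    F = ∑ i, F (Module.finBasis ℂ Y i) • cst ((Module.finBasis ℂ Y).coord i) := by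
  apply (Module.finBasis ℂ Y).ext
  intro j
  simp only [LinearMap.sum_apply, LinearMap.smul_apply, cst_apply, smul_eq_mul,
    Module.Basis.coord_apply, Module.Basis.repr_self]
  rw [Finset.sum_eq_single j]
  · simp
  · intro b _ hb; rw [Finsupp.single_eq_of_ne (by tauto)]; simp
  · simp

lemma HA_le [FiniteDimensional ℂ Y] :
    S.HA Y ≤ ⨆ k : ℕ, (S.EuE (Y := Y)).eigenspace (k : ℂ) := by
  intro F hF
  rw [expand F]
  refine Submodule.sum_mem _ fun i _ => ?_
  have h : ∀ p ∈ ⨆ k, S.Ak k, ∀ c : Module.Dual ℂ Y,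
      p • cst c ∈ ⨆ k : ℕ, (S.EuE (Y := Y)).eigenspace (k : ℂ) := by
    intro p hp c
    induction hp using Submodule.iSup_induction' with
    | mem k x hx =>
      refine (le_iSup (fun k : ℕ => (S.EuE (Y := Y)).eigenspace (k : ℂ)) k) ?_
      rw [Module.End.mem_eigenspace_iff, EuE_smulK, S.Eu_Ak k hx]
      ext y; simp
    | zero => rw [zero_smul]; exact zero_mem _
    | add x y _ _ hx hy => rw [add_smul]; exact add_mem hx hy
  exact h _ (S.A_le (hF _)) _

end

variable [Fintype G]

/-- The element `∑ b_w (1 - w)` of the group algebra. -/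
def Bel (b : G → ℂ) : MonoidAlgebra ℂ G := ∑ w, b w • (1 - MonoidAlgebra.of ℂ G w)

/-- genericity -/
def Gen (b : G → ℂ) (l : ℂ) : Prop :=
  ∀ j : ℤ, j ≠ 0 → IsUnit (algebraMap ℂ (MonoidAlgebra ℂ G) (l + j) - Bel b)

lemma Bel_neg (b : G → ℂ) : Bel (fun w => - b w) = - Bel b := by
  simp [Bel]

lemma Gen.neg {b : G → ℂ} {l : ℂ} (h : Gen b l) : Gen (fun w => - b w) (-l) := by
  intro j hj
  have := (h (-j) (by simpa using hj)).neg
  rw [Bel_neg]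
  convert this using 1
  rw [neg_sub, sub_neg_eq_add, sub_eq_add_neg, add_comm, ← map_neg]
  congr 2
  push_cast; ring

lemma asAlg_Bel {M : Type*} [AddCommGroup M] [Module ℂ M] (ρ : Representation ℂ G M) (b : G → ℂ)
    (x : M) : ρ.asAlgebraHom (Bel b) x = ∑ w, b w • (x - ρ w x) := by
  simp [Bel, LinearMap.sum_apply, Representation.asAlgebraHom_of]

lemma asAlg_stable {G : Type*} [Group G]
    {M : Type*} [AddCommGroup M] [Module ℂ M] (ρ : Representation ℂ G M)
    (N : Submodule ℂ M) (hN : ∀ g, ∀ x ∈ N, ρ g x ∈ N) (u : MonoidAlgebra ℂ G) {x : M}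
    (hx : x ∈ N) : ρ.asAlgebraHom u x ∈ N := by
  induction u using MonoidAlgebra.induction_on with
  | of g => rw [Representation.asAlgebraHom_of]; exact hN g x hx
  | add a b ha hb => rw [map_add]; exact add_mem ha hb
  | smul r a ha => rw [map_smul]; exact N.smul_mem r ha

variable [FiniteDimensional ℂ V]

theorem claim1 {a b : G → ℂ} (ha : S.Param a) (hb : S.Param b) {κ : ℂ}
    (hκ : ∀ y, ∑ w, a w • (y - σ w⁻¹ y) = κ • y) (D : ℕ) (hG : Gen b (κ + D))
    (N : Submodule ℂ (Y →ₗ[ℂ] K)) (hA : ∀ p ∈ S.A, ∀ F ∈ N, p • F ∈ N)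
    (hD : ∀ w, ∀ F ∈ N, S.Dg σ w F ∈ N) (hT : ∀ v, ∀ F ∈ N, S.T σ a b v F ∈ N)
    (hdeg : N ≤ ⨆ k : ℕ, (S.EuE (Y := Y)).eigenspace (k : ℂ)) :
    (∀ F ∈ N, S.EuE F = (D : ℂ) • F → ∀ v, S.T σ a b v F = 0) ∧
    N ≤ Submodule.span ℂ {F | ∃ p ∈ S.A, ∃ F' ∈ N, S.EuE F' = (D : ℂ) • F' ∧ F = p • F'} := by
  have hRr : ∀ F : Y →ₗ[ℂ] K, ∑ w, a w • (F - Rr σ w F) = κ • F := by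
    intro F; ext y
    have := congrArg F (hκ y)
    simpa [LinearMap.sum_apply] using this
  have hsum : ∀ F ∈ N, ∑ i, S.X ((Module.finBasis ℂ V).coord i) •
      S.T σ a b (Module.finBasis ℂ V i) F ∈ N := fun F hF =>
    Submodule.sum_mem _ fun i _ => hA _ (S.X_mem _) _ (hT _ _ hF)
  have hEu : ∀ F ∈ N, S.EuE F ∈ N := by
    intro F hF
    have h := hsum F hF
    rw [S.sum_T σ ha hb, hRr] at h
    have h2 : ∑ w, b w • (F - S.Dg σ w F) ∈ N :=
      Submodule.sum_mem _ fun w _ => N.smul_mem _ (sub_mem hF (hD _ _ hF))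
    have h3 := sub_mem (add_mem h h2) (N.smul_mem κ hF)
    convert h3 using 1
    abel
  have hTd : ∀ (j : ℂ) v F, S.EuE F = j • F → S.EuE (S.T σ a b v F) = (j - 1) • S.T σ a b v F := by
    intro j v F h
    rw [S.EuE_T σ ha hb, h, map_smul]; ext y; simp [sub_smul]
  have hB : ∀ k : ℕ, k ≠ D → ∀ F, S.EuE F = (k : ℂ) • F → ∃ u : MonoidAlgebra ℂ G,
      F = (S.Dg σ).asAlgebraHom u (∑ i, S.X ((Module.finBasis ℂ V).coord i) •
        S.T σ a b (Module.finBasis ℂ V i) F) := by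
    intro k hk F hF
    obtain ⟨u, hu⟩ := hG ((k : ℤ) - D) (by omega)
    refine ⟨(u⁻¹ : (MonoidAlgebra ℂ G)ˣ), ?_⟩
    have h1 : ∑ i, S.X ((Module.finBasis ℂ V).coord i) •
        S.T σ a b (Module.finBasis ℂ V i) F = (S.Dg σ).asAlgebraHom u F := by
      rw [S.sum_T σ ha hb, hRr, hu, map_sub, LinearMap.sub_apply, asAlg_Bel, AlgHom.commutes,
        Module.algebraMap_end_apply, hF, ← add_smul]
      congr 2
      push_cast; ring
    rw [h1, ← Module.End.mul_apply, ← map_mul, Units.inv_mul, map_one, Module.End.one_apply]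
  have hC : ∀ k : ℕ, k ≤ D → ∀ F ∈ N, S.EuE F = ((k : ℂ) - 1) • F → F = 0 := by
    intro k
    induction k with
    | zero => 
      intro _ F hF h
      refine (comp_of_eig _ _ (fun k => le_rfl) (hdeg hF) h).2 ?_
      intro k hk
      have : ((k + 1 : ℕ) : ℂ) = 0 := by push_cast; rw [hk]; push_cast; ring
      exact absurd this (by exact_mod_cast Nat.succ_ne_zero k)
    | succ k ih =>
      intro hk F hF h
      push_cast at h
      rw [add_sub_cancel_right] at h
      obtain ⟨u, hu⟩ := hB k (by omega) F h
      rw [hu]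
      have : ∀ v, S.T σ a b v F = 0 := fun v => ih (by omega) _ (hT v F hF) (hTd _ v F h)
      simp [this]
  refine ⟨fun F hF h v => hC D le_rfl _ (hT v F hF) (hTd _ v F h), ?_⟩
  set Sp := Submodule.span ℂ
    {F | ∃ p ∈ S.A, ∃ F' ∈ N, S.EuE F' = (D : ℂ) • F' ∧ F = p • F'} with hSp
  have hSpA : ∀ p ∈ S.A, ∀ F ∈ Sp, p • F ∈ Sp := by
    intro p hp F hF
    induction hF using Submodule.span_induction with
    | mem x hx => 
      obtain ⟨q, hq, F', hF', h1, rfl⟩ := hx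
      exact Submodule.subset_span ⟨p * q, mul_mem hp hq, F', hF', h1, by rw [smul_smul]⟩
    | zero => rw [smul_zero]; exact zero_mem _
    | add x y _ _ hx hy => rw [smul_add]; exact add_mem hx hy
    | smul c x _ hx => rw [smul_comm]; exact Sp.smul_mem _ hx
  have hSpD : ∀ w, ∀ F ∈ Sp, S.Dg σ w F ∈ Sp := by
    intro w F hF
    induction hF using Submodule.span_induction with
    | mem x hx => 
      obtain ⟨q, hq, F', hF', h1, rfl⟩ := hx
      exact Submodule.subset_span ⟨S.act w q, S.act_A w hq, S.Dg σ w F', hD w _ hF',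
        by rw [EuE_Dg, h1, map_smul], by rw [Dg_smulK]⟩
    | zero => rw [map_zero]; exact zero_mem _
    | add x y _ _ hx hy => rw [map_add]; exact add_mem hx hy
    | smul c x _ hx => rw [map_smul]; exact Sp.smul_mem _ hx
  have hE : ∀ k : ℕ, ∀ F ∈ N, S.EuE F = (k : ℂ) • F → F ∈ Sp := by
    intro k
    induction k with
    | zero => 
      intro F hF h
      rcases Nat.eq_zero_or_pos D with h0 | h0
      · exact Submodule.subset_span ⟨1, one_mem _, F, hF, by rw [h0, h], by rw [one_smul]⟩
      · rw [hC 1 h0 F hF (by rw [h]; simp)]; exact zero_mem _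
    | succ k ih =>
      intro F hF h
      by_cases hk : k + 1 = D
      · exact Submodule.subset_span ⟨1, one_mem _, F, hF, by rw [← hk, h], by rw [one_smul]⟩
      · obtain ⟨u, hu⟩ := hB (k + 1) hk F h
        rw [hu]
        refine asAlg_stable _ _ hSpD u (Submodule.sum_mem _ fun i _ => hSpA _ (S.X_mem _) _ ?_)
        exact ih _ (hT _ _ hF) (by rw [hTd _ _ _ h]; push_cast; rw [add_sub_cancel_right])
  refine (graded_of_stable _ N hEu hdeg).trans (iSup_le fun k => ?_)
  rintro F ⟨hF, h⟩
  exact hE k F hF (Module.End.mem_eigenspace_iff.1 h)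

end Setup

namespace Setup

variable {G V : Type*} [Group G] [AddCommGroup V] [Module ℂ V]
    {π : Representation ℂ G V} {K : Type} [Field K] [Algebra ℂ K] (S : Setup π K)
    {Y : Type*} [AddCommGroup Y] [Module ℂ Y] (σ : Representation ℂ G Y)

lemma act_sub {w : G} {ξ : Module.Dual ℂ V} (hw : ∀ v, ξ v = 0 → π w v = v) (hξ : ξ ≠ 0)
    {p : K} (hp : p ∈ S.A) : ∃ r ∈ S.A, S.act w p - p = S.X ξ * r := by
  induction hp using Algebra.adjoin_induction with
  | mem x hx => 
    obtain ⟨η, rfl⟩ := hx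
    rw [S.act_X, ← map_sub]
    by_cases h0 : η ∘ₗ π w⁻¹ - η = 0
    · exact ⟨0, zero_mem _, by rw [h0]; simp⟩
    · obtain ⟨c, -, hc⟩ := prop_of_ker h0 hξ (fun v hv => by
        have := hw v hv
        have h2 : π w⁻¹ v = v := by conv_lhs => rw [← this]; simp
        simp [h2])
      exact ⟨algebraMap ℂ K c, Subalgebra.algebraMap_mem _ _, by
        rw [hc, map_smul, Algebra.smul_def, mul_comm]⟩
  | algebraMap r => exact ⟨0, zero_mem _, by simp⟩
  | add x y _ _ hx hy =>
    obtain ⟨r, hr, h1⟩ := hx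
    obtain ⟨r', hr', h2⟩ := hy
    exact ⟨r + r', add_mem hr hr', by rw [map_add, mul_add, ← h1, ← h2]; ring⟩
  | mul x y hx' hy' hx hy =>
    obtain ⟨r, hr, h1⟩ := hx
    obtain ⟨r', hr', h2⟩ := hy
    refine ⟨r * S.act w y + x * r', add_mem (mul_mem hr (S.act_A w hy')) (mul_mem hx' hr'), ?_⟩
    rw [map_mul]
    linear_combination S.act w y * h1 + x * h2

lemma HA_smul {p : K} (hp : p ∈ S.A) {F : Y →ₗ[ℂ] K} (hF : F ∈ S.HA Y) : p • F ∈ S.HA Y :=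
  fun y => mul_mem hp (hF y)

lemma HA_Dg (w : G) {F : Y →ₗ[ℂ] K} (hF : F ∈ S.HA Y) : S.Dg σ w F ∈ S.HA Y :=
  fun _ => S.act_A w (hF _)

lemma denom [FiniteDimensional ℂ Y] (F : Y →ₗ[ℂ] K) : ∃ p ∈ S.A, p ≠ 0 ∧ p • F ∈ S.HA Y := by
  choose p hp q hq hq0 h using S.frac
  refine ⟨∏ i, q (F (Module.finBasis ℂ Y i)), Subalgebra.prod_mem _ fun i _ => hq _,
    Finset.prod_ne_zero_iff.2 fun i _ => hq0 _, ?_⟩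
  have hex : (∏ i, q (F (Module.finBasis ℂ Y i))) • F = ∑ j, (∏ i, q (F (Module.finBasis ℂ Y i))) •
      F (Module.finBasis ℂ Y j) • cst ((Module.finBasis ℂ Y).coord j) := by
    rw [← Finset.smul_sum, ← expand F]
  rw [hex]
  refine Submodule.sum_mem _ fun i _ => ?_
  intro y
  simp only [LinearMap.smul_apply, cst_apply, smul_eq_mul]
  rw [← mul_assoc, ← Finset.mul_prod_erase Finset.univ _ (Finset.mem_univ i),
    mul_right_comm (q _)]
  refine mul_mem (mul_mem ?_ (Subalgebra.prod_mem _ fun i _ => hq _))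
    (Subalgebra.algebraMap_mem _ _)
  have h1 := h (F (Module.finBasis ℂ Y i))
  have h2 := hq0 (F (Module.finBasis ℂ Y i))
  have : q (F (Module.finBasis ℂ Y i)) * F (Module.finBasis ℂ Y i) = p (F (Module.finBasis ℂ Y i)) := by
    rw [eq_div_iff h2] at h1; rw [mul_comm]; exact h1
  rw [this]; exact hp _

lemma eq_cst [FiniteDimensional ℂ V] {F : Y →ₗ[ℂ] K} (hF : F ∈ S.HA Y) (h : S.EuE F = 0) :
    ∃ c, F = cst c := by
  have h1 : ∀ y, F y ∈ LinearMap.range (Algebra.linearMap ℂ K) := by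
    intro y
    have := S.mem_Ak (hF y) 0 (by
      have := LinearMap.congr_fun h y
      simpa using this)
    rw [Ak, pow_zero] at this
    obtain ⟨c, hc⟩ := Submodule.mem_one.1 this
    exact ⟨c, hc⟩
  have hinj : Function.Injective (Algebra.linearMap ℂ K) := (algebraMap ℂ K).injective
  refine ⟨(LinearEquiv.ofInjective _ hinj).symm.toLinearMap ∘ₗ F.codRestrict _ h1, ?_⟩
  ext y
  have := LinearEquiv.apply_symm_apply (LinearEquiv.ofInjective _ hinj) (F.codRestrict _ h1 y)
  exact (congrArg Subtype.val this).symm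

variable [Fintype G]

lemma sum_inv_grp {P : Type*} [AddCommMonoid P] (f : G → P) :
    ∑ w, f w⁻¹ = ∑ w, f w :=
  Equiv.sum_comp (Equiv.inv G) f

lemma HA_T {c : G → ℂ} (hc : S.Param c) (v : V) {F : Y →ₗ[ℂ] K} (hF : F ∈ S.HA Y) :
    S.T σ c c v F ∈ S.HA Y := by
  intro y
  rw [T_apply, LinearMap.sub_apply, nab_apply, Bd_apply, add_sub_assoc, ← Finset.sum_sub_distrib]
  refine add_mem (S.der_A v (hF y)) (Subalgebra.sum_mem _ fun w _ => ?_)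
  by_cases hw : w ∈ S.R
  · rw [← smul_sub]
    refine Subalgebra.smul_mem _ ?_ _
    obtain ⟨r, hr, h⟩ := S.act_sub (fun v hv => (S.α_ker w hw v).1 hv) (S.α_ne w hw)
      (hF (σ w⁻¹ y))
    have h2 := S.X_ne (S.α_ne w hw)
    have : S.ell w v * (F y - F (σ w⁻¹ y)) - S.ell w v * (F y - S.act w (F (σ w⁻¹ y))) =
        algebraMap ℂ K (S.α w v) * r := by
      rw [ell]; field_simp; linear_combination (algebraMap ℂ K (S.α w v)) * h
    rw [this]
    exact mul_mem (Subalgebra.algebraMap_mem _ _) hr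
  · rw [hc.supp w hw]; simp

/-- restriction of the diagonal action to a stable subspace -/
def subrep {M : Type*} [AddCommGroup M] [Module ℂ M] {G : Type*} [Group G]
    (ρ : Representation ℂ G M) (N : Submodule ℂ M)
    (hN : ∀ w, ∀ F ∈ N, ρ w F ∈ N) : Representation ℂ G N where
  toFun w := (ρ w).restrict (hN w)
  map_one' := by ext; simp
  map_mul' g h := by ext; simp

@[simp] lemma subrep_coe {M : Type*} [AddCommGroup M] [Module ℂ M] {G : Type*} [Group G]
    (ρ : Representation ℂ G M) (N : Submodule ℂ M)
    (hN : ∀ w, ∀ F ∈ N, ρ w F ∈ N) (w : G) (x : N) : (subrep ρ N hN w x : M) = ρ w x := rfl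

variable [FiniteDimensional ℂ V]

theorem claim2 {a b : G → ℂ} (hb : S.Param b) {l : ℂ}
    {M : Type*} [AddCommGroup M] [Module ℂ M] [FiniteDimensional ℂ M] (τ : Representation ℂ G M)
    (φ : M →ₗ[ℂ] (Y →ₗ[ℂ] K)) (hφ : Function.Injective φ)
    (hφτ : ∀ w m, φ (τ w m) = S.Dg σ w (φ m)) (hT : ∀ v m, S.T σ a b v (φ m) = 0)
    (hl : ∀ m, ∑ w, b w • (m - τ w m) = l • m) (hG : Gen b l)
    {ι : Type*} (x : ι → M) (hx : LinearIndependent ℂ x) :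
    LinearIndependent K (fun i => φ (x i)) := by
  classical
  let q : Y → (M →ₗ[ℂ] K) := fun y => (LinearMap.applyₗ y) ∘ₗ φ
  have hq : ∀ y (m : M), q y m = φ m y := fun y m => rfl
  let Q : Submodule K (M →ₗ[ℂ] K) := Submodule.span K (Set.range q)
  have hqQ : ∀ y, q y ∈ Q := fun y => Submodule.subset_span ⟨y, rfl⟩
  have hQD : ∀ w, ∀ F ∈ Q, S.Dg τ w F ∈ Q := by
    intro w F hF
    induction hF using Submodule.span_induction with
    | mem F hF =>
      obtain ⟨y, rfl⟩ := hF
      have : S.Dg τ w (q y) = q (σ w y) := by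
        ext m
        simp [hq, hφτ, S.act_act_inv]
      rw [this]; exact hqQ _
    | zero => rw [map_zero]; exact zero_mem _
    | add x y _ _ hx hy => rw [map_add]; exact add_mem hx hy
    | smul c x _ hx => rw [Dg_smulK]; exact Q.smul_mem _ hx
  have hCQ : ∀ (c : ℂ), ∀ F ∈ Q, c • F ∈ Q := by
    intro c F hF
    have : c • F = algebraMap ℂ K c • F := by ext m; simp [Algebra.smul_def]
    rw [this]; exact Q.smul_mem _ hF
  have hbe : ∀ w v, b w • S.ell w v = b w⁻¹ • S.ell w⁻¹ v := by
    intro w v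
    rw [hb.inv]
    by_cases hw : w ∈ S.R
    · rw [S.ell_inv hw]
    · rw [hb.supp w hw]; simp
  have hQn : ∀ v, ∀ F ∈ Q, S.nab τ (fun w => - b w) v F ∈ Q := by
    intro v F hF
    induction hF using Submodule.span_induction with
    | mem F hF =>
      obtain ⟨y, rfl⟩ := hF
      have : S.nab τ (fun w => - b w) v (q y) =
          - ∑ w, a w • (S.ell w v • (q y - q (σ w⁻¹ y))) := by
        ext m
        have h1 := LinearMap.congr_fun (hT v m) y
        rw [T_apply, LinearMap.sub_apply, nab_apply, Bd_apply', LinearMap.sum_apply] at h1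
        have h2 : ∑ w, (-b w) • (S.ell w v * (q y m - q y (τ w⁻¹ m))) =
            - ∑ w, (b w • (S.ell w v • (φ m - S.Dg σ w (φ m)))) y := by
          rw [← Finset.sum_neg_distrib, ← sum_inv_grp]
          refine Finset.sum_congr rfl fun w _ => ?_
          rw [inv_inv]
          have := hbe w v
          simp only [LinearMap.smul_apply, LinearMap.sub_apply, hq, hφτ, smul_eq_mul,
            ← smul_mul_assoc, neg_smul, this]
          ring
        rw [nab_apply, h2, LinearMap.neg_apply, LinearMap.sum_apply]
        simp only [LinearMap.smul_apply, LinearMap.sub_apply, hq, smul_eq_mul] at h1 ⊢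
        rw [LinearMap.zero_apply] at h1
        linear_combination h1
      rw [this]
      refine neg_mem (Submodule.sum_mem _ fun w _ => hCQ _ _ (Q.smul_mem _ (sub_mem (hqQ _) (hqQ _))))
    | zero => rw [map_zero]; exact zero_mem _
    | add x y _ _ hx hy => rw [map_add]; exact add_mem hx hy
    | smul c x hx' hx => rw [nab_smulK]; exact add_mem (Q.smul_mem _ hx') (Q.smul_mem _ hx)
  have hQT : ∀ v, ∀ F ∈ Q, S.T τ (fun w => - b w) (fun w => - b w) v F ∈ Q := by
    intro v F hF
    rw [T_apply, Bd_apply']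
    refine sub_mem (hQn v F hF) (Submodule.sum_mem _ fun w _ => hCQ _ _ (Q.smul_mem _ ?_))
    exact sub_mem hF (hQD w F hF)
  let N2 : Submodule ℂ (M →ₗ[ℂ] K) := 
    { carrier := {F | F ∈ Q ∧ F ∈ S.HA M}
      add_mem' := fun h h' => ⟨add_mem h.1 h'.1, add_mem h.2 h'.2⟩
      zero_mem' := ⟨zero_mem _, zero_mem _⟩
      smul_mem' := fun c F h => ⟨hCQ c F h.1, Submodule.smul_mem _ c h.2⟩ }
  have hc1 := S.claim1 τ hb.neg hb.neg (κ := -l) (fun m => by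
      have h1 := hl m
      rw [← sum_inv_grp]
      simp only [inv_inv, hb.inv, neg_smul, Finset.sum_neg_distrib, h1]
      ) 0 (by simpa using hG.neg) N2
    (fun p hp F hF => ⟨Q.smul_mem _ hF.1, S.HA_smul hp hF.2⟩)
    (fun w F hF => ⟨hQD w F hF.1, S.HA_Dg τ w hF.2⟩)
    (fun v F hF => ⟨hQT v F hF.1, S.HA_T τ hb.neg v hF.2⟩)
    (fun F hF => S.HA_le hF.2)
  let C : Submodule ℂ (Module.Dual ℂ M) :=
    { carrier := {c | cst c ∈ Q}
      add_mem' := fun {c c'} h h' => by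
        have : cst (K := K) (c + c') = cst c + cst c' := by ext; simp
        change cst (c + c') ∈ Q
        rw [this]; exact add_mem h h'
      zero_mem' := by
        have : cst (K := K) (0 : Module.Dual ℂ M) = 0 := by ext; simp
        change cst (0 : Module.Dual ℂ M) ∈ Q
        rw [this]; exact zero_mem _
      smul_mem' := fun r c h => by
        have : cst (K := K) (r • c) = r • cst c := by ext; simp [Algebra.smul_def]
        change cst (r • c) ∈ Q
        rw [this]; exact hCQ _ _ h }
  have hCtop : C = ⊤ := by
    have h0 : C.dualCoannihilator = ⊥ := by
      rw [eq_bot_iff]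
      intro m hm
      rw [Submodule.mem_dualCoannihilator] at hm
      have h1 : ∀ F ∈ N2, F m = 0 := by
        intro F hF
        have := hc1.2 hF
        clear hF
        induction this using Submodule.span_induction with
        | mem F hF =>
          obtain ⟨p, -, F', hF', hE, rfl⟩ := hF
          obtain ⟨c, rfl⟩ := S.eq_cst hF'.2 (by simpa using hE)
          have := hm c hF'.1
          simp [this]
        | zero => rfl
        | add x y _ _ hx hy => rw [LinearMap.add_apply, hx, hy, add_zero]
        | smul c x _ hx => rw [LinearMap.smul_apply, hx, smul_zero]
      rw [Submodule.mem_bot]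
      apply hφ
      ext y
      obtain ⟨p, hp, hp0, h⟩ := S.denom (q y)
      have := h1 (p • q y) ⟨Q.smul_mem _ (hqQ y), h⟩
      rw [LinearMap.smul_apply, smul_eq_mul, hq] at this
      simpa [hp0] using this
    have := Subspace.dualCoannihilator_dualAnnihilator_eq (W := C)
    rw [← this, h0, Submodule.dualAnnihilator_bot]
  rw [linearIndependent_iff']
  intro s g hg i hi
  have hall : ∀ F ∈ Q, ∑ j ∈ s, g j * F (x j) = 0 := by
    intro F hF
    induction hF using Submodule.span_induction with
    | mem F hF =>
      obtain ⟨y, rfl⟩ := hF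
      have := LinearMap.congr_fun hg y
      simpa [LinearMap.sum_apply, hq] using this
    | zero => simp
    | add F F' _ _ h h' => simp [mul_add, Finset.sum_add_distrib, h, h']
    | smul c F _ h => 
      simp only [LinearMap.smul_apply, smul_eq_mul, mul_left_comm _ c]
      rw [← Finset.mul_sum, h, mul_zero]
  obtain ⟨c, hc⟩ := LinearMap.exists_extend (Finsupp.lapply i ∘ₗ hx.repr)
  have hcx : ∀ j, c (x j) = if j = i then 1 else 0 := by
    intro j
    have := LinearMap.congr_fun hc ⟨x j, Submodule.subset_span ⟨j, rfl⟩⟩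
    simp only [LinearMap.comp_apply, Submodule.subtype_apply] at this
    rw [this]
    have h2 := hx.repr_eq_single j ⟨x j, Submodule.subset_span ⟨j, rfl⟩⟩ rfl
    simp [h2, Finsupp.single_apply]
  have hcC : c ∈ C := by rw [hCtop]; trivial
  have := hall _ hcC
  simp only [cst_apply, hcx] at this
  simpa [apply_ite, hi] using this

theorem claim2_dim [FiniteDimensional ℂ Y] {a b : G → ℂ} (hb : S.Param b) {l : ℂ}
    {M : Type*} [AddCommGroup M] [Module ℂ M] [FiniteDimensional ℂ M] (τ : Representation ℂ G M)
    (φ : M →ₗ[ℂ] (Y →ₗ[ℂ] K)) (hφ : Function.Injective φ)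
    (hφτ : ∀ w m, φ (τ w m) = S.Dg σ w (φ m)) (hT : ∀ v m, S.T σ a b v (φ m) = 0)
    (hl : ∀ m, ∑ w, b w • (m - τ w m) = l • m) (hG : Gen b l) :
    Module.finrank ℂ M ≤ Module.finrank ℂ Y := by
  have h := S.claim2 σ hb τ φ hφ hφτ hT hl hG _ (Module.finBasis ℂ M).linearIndependent
  have h2 := h.fintype_card_le_finrank
  rw [Module.finrank_linearMap, Module.finrank_self, mul_one] at h2
  simpa using h2

end Setup

namespace Setup

variable {G V : Type*} [Group G] [AddCommGroup V] [Module ℂ V]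
    {π : Representation ℂ G V} {K : Type} [Field K] [Algebra ℂ K] (S : Setup π K)
    {Y : Type*} [AddCommGroup Y] [Module ℂ Y] (σ : Representation ℂ G Y)

lemma unip [Finite G] (g : G) (n : Module.Dual ℂ V) (y : V) (hy : n y = 0)
    (h : ∀ x, π g x = x + n x • y) (x : V) : n x • y = 0 := by
  have hk : ∀ k : ℕ, π (g ^ k) x = x + (k : ℂ) • (n x • y) := by
    intro k
    induction k with
    | zero => simp
    | succ k ih =>
      rw [pow_succ', map_mul, Module.End.mul_apply, ih, h]
      simp [hy, add_smul]
      abel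
  have h1 := hk (orderOf g)
  rw [pow_orderOf_eq_one] at h1
  have h2 : ((orderOf g : ℕ) : ℂ) ≠ 0 := by
    exact_mod_cast (orderOf_pos g).ne'
  have h3 : ((orderOf g : ℕ) : ℂ) • (n x • y) = 0 := by simpa using h1.symm
  exact (smul_eq_zero.1 h3).resolve_left h2

lemma refl_form {w : G} (hw : w ∈ S.R) {z : V} (hz : S.α w z ≠ 0) (x : V) :
    π w x = x + (S.α w x / S.α w z) • (π w z - z) := by
  have := (S.α_ker w hw (x - (S.α w x / S.α w z) • z)).1 (by simp [hz])
  rw [map_sub, map_smul] at this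
  rw [smul_sub]
  have h2 := sub_eq_iff_eq_add.1 this
  rw [h2]; abel

lemma root_case [Finite G] {s t : G} (A B : Module.Dual ℂ V) (y : V) (hy : y ≠ 0)
    (hA : A ≠ 0)
    (hs : ∀ x, π s x = x + A x • y) (ht : ∀ x, π t x = x + B x • y) (x : V) (hx : A x = 0) :
    B x = 0 := by
  have hAy : A y ≠ 0 := by
    intro h0
    apply hA
    ext x
    have := unip s A y h0 hs x
    exact (smul_eq_zero.1 this).resolve_right hy
  set n : Module.Dual ℂ V := B y • A - A y • B with hn
  have hq : ∀ x, π (t * s) x = π (s * t) x + n x • y := by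
    intro x
    rw [map_mul, map_mul, Module.End.mul_apply, Module.End.mul_apply]
    simp only [hs, ht, map_add, map_smul, hn, LinearMap.sub_apply, LinearMap.smul_apply,
      smul_eq_mul, add_smul, sub_smul, smul_add]
    rw [mul_comm (B y), mul_comm (A y)]
    abel
  have hny : n y = 0 := by simp [hn]; ring
  obtain ⟨c, hc⟩ : ∃ c : ℂ, π (s * t) y = c • y := by
    refine ⟨1 + B y + A y + B y * A y, ?_⟩
    rw [map_mul, Module.End.mul_apply]
    simp only [hs, ht, map_add, map_smul, smul_eq_mul, smul_add, add_smul, one_smul, smul_smul]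
    abel
  have hc0 : c ≠ 0 := by
    rintro rfl
    apply hy
    have : π (s * t)⁻¹ (π (s * t) y) = y := by simp
    rw [← this, hc]; simp
  have hpy : π (s * t)⁻¹ y = c⁻¹ • y := by
    have : π (s * t)⁻¹ (π (s * t) y) = y := by simp
    rw [hc, map_smul] at this
    rw [← this, smul_smul, inv_mul_cancel₀ hc0, one_smul, this]
  have hu := unip (t * s * (s * t)⁻¹) (n ∘ₗ π (s * t)⁻¹) y (by
      rw [LinearMap.comp_apply, hpy, map_smul, hny, smul_zero]) (fun x => by
      rw [map_mul (π) (t * s), Module.End.mul_apply, hq, LinearMap.comp_apply]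
      simp) (π (s * t) x)
  have hnx : n x = 0 := by
    have h1 := (smul_eq_zero.1 hu).resolve_right hy
    rw [LinearMap.comp_apply] at h1
    have : π (s * t)⁻¹ (π (s * t) x) = x := by simp
    rwa [this] at h1
  simp [hn, hx, hAy] at hnx
  exact hnx

/-- if `ww'v = v` with different hyperplanes then `v` is on the hyperplane of `w`. -/
lemma fix_prod [Finite G] {w w' : G} (hw : w ∈ S.R) (hw' : w' ∈ S.R) {v : V}
    (hv : π (w * w') v = v) (hne : S.α w v ≠ 0) (x : V) (hx : S.α w x = 0) : S.α w' x = 0 := by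
  have hwi := (S.alpha_inv hw)
  have hkey : π w' v = π w⁻¹ v := by
    have : π w⁻¹ (π (w * w') v) = π w' v := by simp
    rw [← this, hv]
  have h1 : S.α w⁻¹ v ≠ 0 := by
    intro h; apply hne
    have := (S.alpha_inv hwi.1).2 v h
    rwa [inv_inv] at this
  have hy : π w⁻¹ v - v ≠ 0 := by
    intro h; rw [sub_eq_zero] at h; exact h1 ((S.α_ker _ hwi.1 v).2 h)
  have h2 : S.α w' v ≠ 0 := by
    intro h
    rw [S.α_ker w' hw', hkey] at h
    rw [h, sub_self] at hy; exact hy rfl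
  have := root_case (s := w⁻¹) (t := w') ((S.α w⁻¹ v)⁻¹ • S.α w⁻¹) ((S.α w' v)⁻¹ • S.α w')
    (π w⁻¹ v - v) hy (by
      intro h
      have := LinearMap.congr_fun h v
      simp [h1] at this)
    (fun x => by rw [S.refl_form hwi.1 h1 x]; simp [div_eq_inv_mul])
    (fun x => by rw [S.refl_form hw' h2 x, hkey]; simp [div_eq_inv_mul]) x (by
      simp [hwi.2 x hx])
  simpa [h2] using this

lemma mem_span2 {A B C : Module.Dual ℂ V} (h : ∀ v, A v = 0 → B v = 0 → C v = 0) :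
    ∃ x y : ℂ, C = x • A + y • B := by
  have := mem_span_of_iInf_ker_le_ker (L := ![A, B]) (K := C) (by
    intro v hv
    simp only [Submodule.mem_iInf, LinearMap.mem_ker, Fin.forall_fin_two] at hv
    exact h v hv.1 hv.2)
  simp only [Matrix.range_cons, Matrix.range_empty, Set.union_empty, Set.singleton_union,
    Submodule.mem_span_pair] at this
  obtain ⟨x, y, h⟩ := this
  exact ⟨x, y, h.symm⟩

/-- the logarithmic 2-form coefficient -/
def om (u v : V) (w w' : G) : K := S.ell w u * S.ell w' v - S.ell w v * S.ell w' u

lemma om_swap (u v : V) (w w' : G) : S.om u v w' w = - S.om u v w w' := by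
  unfold om; ring

variable [Fintype G]

lemma om_sum {a : G → ℂ} (ha : S.Param a) (u v : V) (h : G) :
    ∑ w, (a w * a (w⁻¹ * h)) • S.om u v w (w⁻¹ * h) = 0 := by
  classical
  by_cases hall : ∀ w, w ∈ S.R → w⁻¹ * h ∈ S.R → S.om u v w (w⁻¹ * h) = 0
  · refine Finset.sum_eq_zero fun w _ => ?_
    by_cases hw : w ∈ S.R
    · by_cases hw' : w⁻¹ * h ∈ S.R
      · rw [hall w hw hw', smul_zero]
      · rw [ha.supp _ hw']; simp
    · rw [ha.supp _ hw]; simp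
  push Not at hall
  obtain ⟨w0, hw0, hw0', hne⟩ := hall
  have hfix : ∀ x, π h x = x → S.α w0 x = 0 := by
    intro x hx
    by_contra h1
    apply hne
    have h2 := S.fix_prod hw0 hw0' (v := x) (by simpa using hx) h1
    have h3 : ∀ z, S.ell (w0⁻¹ * h) z = S.ell w0 z := fun z =>
      S.ell_eq hw0' (S.α_ne _ hw0) h2 z
    unfold om; rw [h3, h3]; ring
  have key : ∀ w, w ∈ S.R → w⁻¹ * h ∈ S.R →
      S.om u v w (w⁻¹ * h) = S.om u v w w0 - S.om u v (w⁻¹ * h) w0 := by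
    intro w hw hw'
    by_cases hp : ∀ x, S.α w x = 0 → S.α (w⁻¹ * h) x = 0
    · have h3 : ∀ z, S.ell (w⁻¹ * h) z = S.ell w z := fun z =>
        S.ell_eq hw' (S.α_ne _ hw) hp z
      unfold om; rw [h3, h3]; ring
    · obtain ⟨x, y, hxy⟩ := mem_span2 (A := S.α w) (B := S.α (w⁻¹ * h)) (C := S.α w0)
        (fun z h1 h2 => hfix z (by
          have e1 := (S.α_ker _ hw z).1 h1
          have e2 := (S.α_ker _ hw' z).1 h2
          have : h = w * (w⁻¹ * h) := by group
          rw [this, map_mul, Module.End.mul_apply, e2, e1]))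
      have n1 := S.X_ne (S.α_ne _ hw)
      have n2 := S.X_ne (S.α_ne _ hw')
      have n3 := S.X_ne (S.α_ne _ hw0)
      have hX : S.X (S.α w0) = algebraMap ℂ K x * S.X (S.α w) +
          algebraMap ℂ K y * S.X (S.α (w⁻¹ * h)) := by
        rw [hxy, map_add, map_smul, map_smul, Algebra.smul_def, Algebra.smul_def]
      have hv : ∀ z, algebraMap ℂ K (S.α w0 z) = algebraMap ℂ K x * algebraMap ℂ K (S.α w z) +
          algebraMap ℂ K y * algebraMap ℂ K (S.α (w⁻¹ * h) z) := by
        intro z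
        rw [hxy]; simp
      unfold om ell
      rw [hv, hv]
      field_simp
      rw [hX]
      ring
  have hconv : ∀ w, (a w * a (w⁻¹ * h)) • S.om u v w (w⁻¹ * h) =
      (a w * a (w⁻¹ * h)) • S.om u v w w0 - (a w * a (w⁻¹ * h)) • S.om u v (w⁻¹ * h) w0 := by
    intro w
    by_cases hw : w ∈ S.R
    · by_cases hw' : w⁻¹ * h ∈ S.R
      · rw [key w hw hw', smul_sub]
      · rw [ha.supp _ hw']; simp
    · rw [ha.supp _ hw]; simp
  simp_rw [hconv]
  rw [Finset.sum_sub_distrib, sub_eq_zero]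
  -- reindex `w ↦ w⁻¹ h`
  let e : G ≃ G := (Equiv.inv G).trans (Equiv.mulRight h)
  rw [← Equiv.sum_comp e]
  refine Finset.sum_congr rfl fun w _ => ?_
  have he : e w = w⁻¹ * h := rfl
  rw [he]
  congr 1
  have : (w⁻¹ * h)⁻¹ * h = h⁻¹ * w * (h⁻¹)⁻¹ := by group
  rw [this, ha.conj, mul_comm]

theorem flat {a : G → ℂ} (ha : S.Param a) (u v : V) (F : Y →ₗ[ℂ] K) :
    S.nab σ a u (S.nab σ a v F) = S.nab σ a v (S.nab σ a u F) := by
  ext y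
  set f : G → K := fun h => F (σ h⁻¹ y) with hf
  have hfy : F y = f 1 := by simp [hf]
  have hff : ∀ w w' : G, F (σ w'⁻¹ (σ w⁻¹ y)) = f (w * w') := by
    intro w w'; simp [hf]
  have hfw : ∀ w : G, F (σ w⁻¹ y) = f w := fun w => rfl
  have expd : ∀ u v, S.nab σ a u (S.nab σ a v F) y =
      S.der u (S.der v (f 1)) +
      ∑ w, a w • (-(S.ell w u * S.ell w v) * (f 1 - f w)) +
      ∑ w, a w • (S.ell w v * (S.der u (f 1) - S.der u (f w))) +
      ∑ w, a w • (S.ell w u * (S.der v (f 1) - S.der v (f w))) +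
      ∑ w, ∑ w', (a w * a w') • (S.ell w u * S.ell w' v * (f 1 - f w' - f w + f (w * w'))) := by
    intro u v
    simp only [nab_apply, hff, hfw, hfy]
    rw [map_add, map_sum]
    simp only [add_assoc]
    congr 1
    simp only [← Finset.sum_add_distrib]
    refine Finset.sum_congr rfl fun w _ => ?_
    rw [Derivation.map_smul, Derivation.leibniz]
    by_cases hw : w ∈ S.R
    · rw [S.der_ell hw, map_sub]
      have h1 : ∑ w', (a w * a w') • (S.ell w u * S.ell w' v * (f 1 - f w' - f w + f (w * w'))) =
          a w • (S.ell w u * (∑ w', a w' • (S.ell w' v * (f 1 - f w')) -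
            ∑ w', a w' • (S.ell w' v * (f w - f (w * w'))))) := by
        rw [← Finset.sum_sub_distrib, Finset.mul_sum, Finset.smul_sum]
        refine Finset.sum_congr rfl fun w' _ => ?_
        simp only [Algebra.smul_def, map_mul, smul_eq_mul]
        ring
      rw [h1]
      simp only [Algebra.smul_def (A := K) (_ : ℂ), smul_eq_mul]
      ring
    · simp [ha.supp w hw]
  rw [expd, expd, ← sub_eq_zero]
  have hz : ∑ w, ∑ w', (a w * a w') • (S.om u v w w' * (f 1 - f w' - f w + f (w * w'))) = 0 := by
    have h1 : ∀ w w', (a w * a w') • (S.om u v w w' * (f 1 - f w' - f w + f (w * w'))) =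
        (a w * a w') • (S.om u v w w' * (f 1 - f w' - f w)) + 
        (a w * a w') • (S.om u v w w' * f (w * w')) := by
      intro w w'; rw [← smul_add, mul_add]
    simp_rw [h1, Finset.sum_add_distrib]
    have h2 : ∑ w, ∑ w', (a w * a w') • (S.om u v w w' * (f 1 - f w' - f w)) = 0 := by
      have h3 : ∑ w, ∑ w', (a w * a w') • (S.om u v w w' * (f 1 - f w' - f w)) =
          - ∑ w, ∑ w', (a w * a w') • (S.om u v w w' * (f 1 - f w' - f w)) := by
        conv_lhs => rw [Finset.sum_comm]
        rw [← Finset.sum_neg_distrib]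
        refine Finset.sum_congr rfl fun w _ => ?_
        rw [← Finset.sum_neg_distrib]
        refine Finset.sum_congr rfl fun w' _ => ?_
        rw [S.om_swap u v w w', mul_comm (a w') (a w), ← smul_neg]
        congr 1
        ring
      haveI : CharZero K := charZero_of_injective_algebraMap (algebraMap ℂ K).injective
      have h4 := self_eq_neg.1 h3
      exact h4
    have h5 : ∑ w, ∑ w', (a w * a w') • (S.om u v w w' * f (w * w')) = 0 := by
      have h6 : ∀ w, ∑ w', (a w * a w') • (S.om u v w w' * f (w * w')) =
          ∑ h, (a w * a (w⁻¹ * h)) • (S.om u v w (w⁻¹ * h) * f h) := by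
        intro w
        rw [← Equiv.sum_comp (Equiv.mulLeft w)
          (fun h => (a w * a (w⁻¹ * h)) • (S.om u v w (w⁻¹ * h) * f h))]
        simp
      simp_rw [h6]
      rw [Finset.sum_comm]
      refine Finset.sum_eq_zero fun h _ => ?_
      simp_rw [← smul_mul_assoc]
      rw [← Finset.sum_mul, S.om_sum ha, zero_mul]
    rw [h2, h5, add_zero]
  rw [← hz]
  have h7 : ∀ w w', (a w * a w') • (S.om u v w w' * (f 1 - f w' - f w + f (w * w'))) =
      (a w * a w') • (S.ell w u * S.ell w' v * (f 1 - f w' - f w + f (w * w'))) -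
      (a w * a w') • (S.ell w v * S.ell w' u * (f 1 - f w' - f w + f (w * w'))) := by
    intro w w'; rw [← smul_sub, ← sub_mul]; rfl
  simp_rw [h7, Finset.sum_sub_distrib]
  rw [S.der_comm u v]
  simp_rw [mul_comm (S.ell _ v) (S.ell _ u)]
  have h8 : ∀ w : G, S.ell w v * S.ell w u = S.ell w u * S.ell w v := fun w => mul_comm _ _
  ring

end Setup

namespace Setup

variable {G V : Type*} [Group G] [AddCommGroup V] [Module ℂ V]
    {π : Representation ℂ G V} {K : Type} [Field K] [Algebra ℂ K] (S : Setup π K)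
    {Y : Type*} [AddCommGroup Y] [Module ℂ Y] (σ : Representation ℂ G Y)

lemma not_div_mul {ξ : Module.Dual ℂ V} (hξ : ξ ≠ 0) {p q : K} (hp : p ∈ S.A) (hq : q ∈ S.A)
    (hp' : ∀ r ∈ S.A, p ≠ S.X ξ * r) (hq' : ∀ r ∈ S.A, q ≠ S.X ξ * r) :
    ∀ r ∈ S.A, p * q ≠ S.X ξ * r := by
  intro r hr h
  rcases S.prime ξ hξ p hp q hq ⟨r, hr, h⟩ with ⟨t, ht, h1⟩ | ⟨t, ht, h1⟩
  · exact hp' t ht h1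
  · exact hq' t ht h1

/-- the local ring at the hyperplane `ξ = 0` -/
def Oo {ξ : Module.Dual ℂ V} (hξ : ξ ≠ 0) : Subalgebra ℂ K where
  carrier := {f | ∃ p ∈ S.A, ∃ q ∈ S.A, (∀ r ∈ S.A, q ≠ S.X ξ * r) ∧ f * q = p}
  mul_mem' := by
    rintro f f' ⟨p, hp, q, hq, h, e⟩ ⟨p', hp', q', hq', h', e'⟩
    exact ⟨p * p', mul_mem hp hp', q * q', mul_mem hq hq', S.not_div_mul hξ hq hq' h h', by
      rw [← e, ← e']; ring⟩
  add_mem' := by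
    rintro f f' ⟨p, hp, q, hq, h, e⟩ ⟨p', hp', q', hq', h', e'⟩
    exact ⟨p * q' + p' * q, add_mem (mul_mem hp hq') (mul_mem hp' hq), q * q', mul_mem hq hq',
      S.not_div_mul hξ hq hq' h h', by rw [← e, ← e']; ring⟩
  algebraMap_mem' := fun r => ⟨algebraMap ℂ K r, Subalgebra.algebraMap_mem _ _, 1, one_mem _,
    fun r hr h => S.nonunit ξ r hr h.symm, by simp⟩

variable {S} in
lemma mem_Oo {ξ : Module.Dual ℂ V} {hξ : ξ ≠ 0} {f : K} : f ∈ S.Oo hξ ↔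
    ∃ p ∈ S.A, ∃ q ∈ S.A, (∀ r ∈ S.A, q ≠ S.X ξ * r) ∧ f * q = p := Iff.rfl

lemma A_Oo {ξ : Module.Dual ℂ V} (hξ : ξ ≠ 0) {p : K} (hp : p ∈ S.A) : p ∈ S.Oo hξ :=
  ⟨p, hp, 1, one_mem _, fun r hr h => S.nonunit ξ r hr h.symm, by simp⟩

lemma inv_Oo {ξ : Module.Dual ℂ V} (hξ : ξ ≠ 0) {q : K} (hq : q ∈ S.A)
    (h : ∀ r ∈ S.A, q ≠ S.X ξ * r) : q⁻¹ ∈ S.Oo hξ := by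
  refine ⟨1, one_mem _, q, hq, h, inv_mul_cancel₀ ?_⟩
  rintro rfl
  exact h 0 (zero_mem _) (by simp)

lemma ne_div {ξ η : Module.Dual ℂ V} {v : V} (hv : ξ v = 0) (hη : η v ≠ 0) :
    ∀ r ∈ S.A, S.X η ≠ S.X ξ * r := by
  intro r hr h
  have h1 := S.ev_X v η
  have h2 : (⟨S.X η, Algebra.subset_adjoin ⟨η, rfl⟩⟩ : S.A) =
      ⟨S.X ξ, Algebra.subset_adjoin ⟨ξ, rfl⟩⟩ * ⟨r, hr⟩ := Subtype.ext h
  rw [h2, map_mul, S.ev_X, hv, zero_mul] at h1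
  exact hη h1.symm

lemma der_Oo {ξ : Module.Dual ℂ V} (hξ : ξ ≠ 0) (v : V) {f : K} (hf : f ∈ S.Oo hξ) :
    S.der v f ∈ S.Oo hξ := by
  obtain ⟨p, hp, q, hq, h, e⟩ := hf
  refine ⟨S.der v p * q - p * S.der v q, sub_mem (mul_mem (S.der_A v hp) hq)
    (mul_mem hp (S.der_A v hq)), q * q, mul_mem hq hq, S.not_div_mul hξ hq hq h h, ?_⟩
  have h1 := (S.der v).leibniz f q
  rw [e, smul_eq_mul, smul_eq_mul] at h1
  rw [h1, ← e]; ring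

lemma act_sub_Oo {ξ : Module.Dual ℂ V} (hξ : ξ ≠ 0) {w : G} (hw : ∀ v, ξ v = 0 → π w v = v)
    {f : K} (hf : f ∈ S.Oo hξ) : ∃ r ∈ S.Oo hξ, S.act w f - f = S.X ξ * r := by
  obtain ⟨p, hp, q, hq, h, e⟩ := hf
  obtain ⟨p', hp', e1⟩ := S.act_sub hw hξ hp
  obtain ⟨q', hq', e2⟩ := S.act_sub hw hξ hq
  have hn : ∀ r ∈ S.A, S.act w q ≠ S.X ξ * r := by
    intro r hr h1
    apply h (r - q') (sub_mem hr hq')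
    rw [mul_sub, ← h1, ← e2]; ring
  have h0 : S.act w q ≠ 0 := fun h0 => hn 0 (zero_mem _) (by simp [h0])
  have e3 := congrArg (S.act w) e
  rw [map_mul] at e3
  refine ⟨(p' - f * q') * (S.act w q)⁻¹, mul_mem (sub_mem (S.A_Oo hξ hp')
    (mul_mem ⟨p, hp, q, hq, h, e⟩ (S.A_Oo hξ hq'))) (S.inv_Oo hξ (S.act_A w hq) hn), ?_⟩
  field_simp
  linear_combination e3 + e1 - f * e2 - e

lemma comp_ne {ξ : Module.Dual ℂ V} (hξ : ξ ≠ 0) (g : G) : ξ ∘ₗ π g ≠ 0 := by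
  intro h0
  apply hξ
  ext v
  have := LinearMap.congr_fun h0 (π g⁻¹ v)
  simpa using this

lemma act_Oo {ξ : Module.Dual ℂ V} (hξ : ξ ≠ 0) (g : G) (hξ' : ξ ∘ₗ π g ≠ 0) 
    {f : K} (hf : f ∈ S.Oo hξ') : S.act g f ∈ S.Oo hξ := by
  obtain ⟨p, hp, q, hq, h, e⟩ := hf
  refine ⟨_, S.act_A g hp, _, S.act_A g hq, ?_, by rw [← map_mul, e]⟩
  intro r hr h1
  apply h _ (S.act_A g⁻¹ hr)
  have := congrArg (S.act g⁻¹) h1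
  rw [S.act_inv_act, map_mul, S.act_X, inv_inv] at this
  exact this

/-- lattices -/
def lat {ξ : Module.Dual ℂ V} (hξ : ξ ≠ 0) (Y : Type*) [AddCommGroup Y] [Module ℂ Y] (n : ℕ) :
    Submodule ℂ (Y →ₗ[ℂ] K) where
  carrier := {F | ∃ F' : Y →ₗ[ℂ] K, (∀ y, F' y ∈ S.Oo hξ) ∧ F = S.X ξ ^ n • F'}
  add_mem' := by
    rintro _ _ ⟨F, hF, rfl⟩ ⟨F', hF', rfl⟩
    exact ⟨F + F', fun y => add_mem (hF y) (hF' y), by rw [smul_add]⟩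
  zero_mem' := ⟨0, fun y => zero_mem _, by simp⟩
  smul_mem' := by
    rintro c _ ⟨F, hF, rfl⟩
    exact ⟨c • F, fun y => Subalgebra.smul_mem _ (hF y) c, smul_comm _ _ _⟩

variable {ξ : Module.Dual ℂ V} (hξ : ξ ≠ 0)

variable {S} in
lemma mem_lat0 {F : Y →ₗ[ℂ] K} : F ∈ S.lat hξ Y 0 ↔ ∀ y, F y ∈ S.Oo hξ := by
  constructor
  · rintro ⟨F', h, rfl⟩ y
    simpa using h y
  · intro h; exact ⟨F, h, by simp⟩

lemma lat_smul {u : K} (hu : u ∈ S.Oo hξ) {n : ℕ} {F : Y →ₗ[ℂ] K} (hF : F ∈ S.lat hξ Y n) :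
    u • F ∈ S.lat hξ Y n := by
  obtain ⟨F', h, rfl⟩ := hF
  exact ⟨u • F', fun y => mul_mem hu (h y), smul_comm _ _ _⟩

lemma lat_X {n : ℕ} {F : Y →ₗ[ℂ] K} (hF : F ∈ S.lat hξ Y n) :
    S.X ξ • F ∈ S.lat hξ Y (n + 1) := by
  obtain ⟨F', h, rfl⟩ := hF
  exact ⟨F', h, by rw [smul_smul, pow_succ']⟩

lemma lat_Xpow {n m : ℕ} {F : Y →ₗ[ℂ] K} (hF : F ∈ S.lat hξ Y n) :
    S.X ξ ^ m • F ∈ S.lat hξ Y (n + m) := by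
  obtain ⟨F', h, rfl⟩ := hF
  exact ⟨F', h, by rw [smul_smul, ← pow_add, add_comm]⟩

lemma lat_X' {n : ℕ} {F : Y →ₗ[ℂ] K} (hF : S.X ξ • F ∈ S.lat hξ Y (n + 1)) :
     F ∈ S.lat hξ Y n := by
  obtain ⟨F', h, e⟩ := hF
  refine ⟨F', h, ?_⟩
  rw [pow_succ', mul_smul] at e
  exact smul_right_injective _ (S.X_ne hξ) e

lemma lat_mono {n m : ℕ} (h : n ≤ m) : S.lat hξ Y m ≤ S.lat hξ Y n := by
  rintro _ ⟨F, hF, rfl⟩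
  obtain ⟨k, rfl⟩ := Nat.exists_eq_add_of_le h
  exact ⟨S.X ξ ^ k • F, fun y => mul_mem (pow_mem (S.A_Oo hξ (S.X_mem ξ)) k) (hF y), by
    rw [smul_smul, pow_add]⟩

lemma lat_Rr (w : G) {n : ℕ} {F : Y →ₗ[ℂ] K} (hF : F ∈ S.lat hξ Y n) :
    Rr σ w F ∈ S.lat hξ Y n := by
  obtain ⟨F', h, rfl⟩ := hF
  exact ⟨Rr σ w F', fun y => h _, by ext y; simp⟩

lemma lat_Dg (g : G) (hξ' : ξ ∘ₗ π g ≠ 0) {n : ℕ} {F : Y →ₗ[ℂ] K} (hF : F ∈ S.lat hξ' Y n) :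
    S.Dg σ g F ∈ S.lat hξ Y n := by
  obtain ⟨F', h, rfl⟩ := hF
  refine ⟨S.Dg σ g F', fun y => S.act_Oo hξ g hξ' (h _), ?_⟩
  rw [Dg_smulK, map_pow, S.act_X]
  congr 3
  ext v; simp

variable (π ξ) in
/-- pointwise stabilizer of the hyperplane -/
def stb : Subgroup G where
  carrier := {w | ∀ v, ξ v = 0 → π w v = v}
  one_mem' := by intro v _; simp
  mul_mem' := by
    intro x y hx hy v hv
    rw [map_mul, Module.End.mul_apply, hy v hv, hx v hv]
  inv_mem' := by
    intro x hx v hv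
    conv_lhs => rw [← hx v hv]
    simp

lemma mem_stb {w : G} : w ∈ stb π ξ ↔ ∀ v, ξ v = 0 → π w v = v := Iff.rfl

lemma stb_R {w : G} (hξ : ξ ≠ 0) (hw : w ∈ stb π ξ) (h1 : w ≠ 1) : w ∈ S.R :=
  S.mem_R w h1 ⟨ξ, hξ, hw⟩

lemma stb_alpha {w : G} (hξ : ξ ≠ 0) (hw : w ∈ stb π ξ) (h1 : w ≠ 1) :
    ∀ v, ξ v = 0 → S.α w v = 0 := fun v hv => (S.α_ker w (S.stb_R hξ hw h1) v).2 (hw v hv)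

lemma stb_ell {w : G} (hξ : ξ ≠ 0) (hw : w ∈ stb π ξ) (h1 : w ≠ 1) (v : V) :
    S.ell w v = algebraMap ℂ K (ξ v) / S.X ξ :=
  S.ell_eq (S.stb_R hξ hw h1) hξ (S.stb_alpha hξ hw h1) v

lemma nstb_ell {w : G} (hR : w ∈ S.R) (hw : w ∉ stb π ξ) (v : V) :
    S.ell w v ∈ S.Oo hξ := by
  obtain ⟨u, hu, hu'⟩ : ∃ u, ξ u = 0 ∧ S.α w u ≠ 0 := by
    by_contra hc
    push Not at hc
    exact hw fun v hv => (S.α_ker w hR v).1 (hc v hv)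
  rw [ell, div_eq_mul_inv]
  exact mul_mem (Subalgebra.algebraMap_mem _ _)
    (S.inv_Oo hξ (S.X_mem _) (S.ne_div hu hu'))

variable (π ξ) in
/-- adapted vector -/
structure Adm (y0 : V) : Prop where
  one : ξ y0 = 1
  eig : ∀ w ∈ stb π ξ, ∃ c : ℂ, π w y0 = c • y0

lemma Adm.ne {y0 : V} (h : Adm π ξ y0) : ξ ≠ 0 := by
  rintro rfl
  simpa using h.one

lemma Adm.act_X {S : Setup π K} {y0 : V} (h : Adm π ξ y0) {w : G} (hw : w ∈ stb π ξ) :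
    ∃ c : ℂ, c ≠ 0 ∧ π w y0 = c • y0 ∧ S.act w (S.X ξ) = algebraMap ℂ K c⁻¹ * S.X ξ ∧
     (∀ k : ℕ, w ^ k = 1 → c ^ k = 1) := by
  obtain ⟨c, hc⟩ := h.eig w hw
  have hy : y0 ≠ 0 := by rintro rfl; simpa using h.one
  have hc0 : c ≠ 0 := by
    rintro rfl
    apply hy
    have : π w⁻¹ (π w y0) = y0 := by simp
    rw [← this, hc]; simp
  have hi : π w⁻¹ y0 = c⁻¹ • y0 := by
    have : π w⁻¹ (π w y0) = y0 := by simp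
    rw [hc, map_smul] at this
    rw [← this, smul_smul, inv_mul_cancel₀ hc0, one_smul, this]
  refine ⟨c, hc0, hc, ?_, ?_⟩
  · rw [S.act_X, ← Algebra.smul_def, ← map_smul]
    congr 1
    ext v
    have h1 : π w⁻¹ (v - ξ v • y0) = v - ξ v • y0 :=
      (inv_mem hw) _ (by simp [h.one])
    have h2 := congrArg ξ h1
    rw [map_sub, map_smul, hi] at h2
    simp [h.one] at h2
    simp
    linear_combination h2
  · intro k hk
    have h1 : ∀ k : ℕ, π (w ^ k) y0 = c ^ k • y0 := by
      intro k
      induction k with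
      | zero => simp
      | succ k ih => rw [pow_succ, map_mul, Module.End.mul_apply, hc, map_smul, ih, smul_smul,
          pow_succ']
    have h2 := h1 k
    rw [hk] at h2
    have h3 := congrArg ξ h2
    simpa [h.one] using h3.symm

variable [Fintype G]

open Classical in
variable (π ξ) in
def St : Finset G := Finset.univ.filter (fun w => w ∈ stb π ξ)

lemma mem_St {w : G} : w ∈ St π ξ ↔ w ∈ stb π ξ := by simp [St]

lemma St_pow {w : G} (hw : w ∈ stb π ξ) : w ^ (St π ξ).card = 1 := by
  classical
  have h1 : (St π ξ).card = Nat.card (stb π ξ) := by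
    rw [Nat.card_eq_fintype_card, Fintype.card_subtype]; rfl
  have := pow_card_eq_one' (x := (⟨w, hw⟩ : stb π ξ))
  rw [h1]
  exact congrArg Subtype.val this

lemma St_pos : 0 < (St π ξ).card := Finset.card_pos.2 ⟨1, mem_St.2 (one_mem _)⟩

variable (π ξ) in
/-- sum over the stabilizer, acting on arguments -/
def sR : Module.End ℂ (Y →ₗ[ℂ] K) := ∑ w ∈ St π ξ, Rr σ w

variable (ξ) in
def sD : Module.End ℂ (Y →ₗ[ℂ] K) := ∑ w ∈ St π ξ, S.Dg σ w

lemma sum_St {M : Type*} [AddCommMonoid M] {u : G} (hu : u ∈ stb π ξ) (f : G → M) :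
    ∑ w ∈ St π ξ, f (u * w) = ∑ w ∈ St π ξ, f w :=
  Finset.sum_bijective (fun w => u * w) (Group.mulLeft_bijective u)
    (fun w => by rw [mem_St, mem_St, Subgroup.mul_mem_cancel_left _ hu]) (fun w _ => rfl)

lemma sR_sR (F : Y →ₗ[ℂ] K) :
    sR π σ ξ (sR π σ ξ F) = ((St π ξ).card : ℂ) • sR π σ ξ F := by
  have : ∀ u ∈ St π ξ, Rr σ u (sR π σ ξ F) = sR π σ ξ F := by
    intro u hu
    rw [mem_St] at hu
    unfold sR
    rw [LinearMap.sum_apply, map_sum, ← sum_St hu (fun w => Rr σ w F)]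
    refine Finset.sum_congr rfl fun w _ => ?_
    ext y; simp
  have e : ∀ F' : Y →ₗ[ℂ] K, sR π σ ξ F' = ∑ w ∈ St π ξ, Rr σ w F' := fun F' => by
    rw [sR, LinearMap.sum_apply]
  rw [e (sR π σ ξ F), Finset.sum_congr rfl this, Finset.sum_const, Nat.cast_smul_eq_nsmul]

lemma lat_sR {n : ℕ} {F : Y →ₗ[ℂ] K} (hF : F ∈ S.lat hξ Y n) :
    sR π σ ξ F ∈ S.lat hξ Y n := by
  rw [sR, LinearMap.sum_apply]
  exact Submodule.sum_mem _ fun w _ => S.lat_Rr σ hξ w hF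

lemma lat_sD {y0 : V} (hy : Adm π ξ y0) {n : ℕ} (hn : (St π ξ).card ∣ n) {F : Y →ₗ[ℂ] K}
    (hF : F ∈ S.lat hξ Y n) : S.sD σ ξ F - sR π σ ξ F ∈ S.lat hξ Y (n + 1) := by
  rw [sR, sD, LinearMap.sum_apply, LinearMap.sum_apply, ← Finset.sum_sub_distrib]
  refine Submodule.sum_mem _ fun w hw => ?_
  rw [mem_St] at hw
  obtain ⟨F', h, rfl⟩ := hF
  obtain ⟨c, hc0, -, hX, hk⟩ := hy.act_X (S := S) hw
  have h1 : S.Dg σ w (S.X ξ ^ n • F') - Rr σ w (S.X ξ ^ n • F') =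
      S.X ξ ^ n • (S.Dg σ w F' - Rr σ w F') := by
    obtain ⟨m, rfl⟩ := hn
    rw [Dg_smulK, map_pow, hX, mul_pow, ← map_pow, inv_pow, pow_mul c, hk _ (St_pow hw)]
    ext y
    simp [mul_sub]
  rw [h1, add_comm n 1]
  refine S.lat_Xpow hξ ?_
  choose r hr hr' using fun y => S.act_sub_Oo hξ hw (h y)
  refine ⟨(S.X ξ)⁻¹ • (S.Dg σ w F' - Rr σ w F'), fun y => ?_, ?_⟩
  · simp only [LinearMap.smul_apply, LinearMap.sub_apply, Dg_apply, Rr_apply, smul_eq_mul]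
    rw [hr', inv_mul_cancel_left₀ (S.X_ne hξ)]
    exact hr _
  · rw [smul_smul, pow_one, mul_inv_cancel₀ (S.X_ne hξ), one_smul]

variable (ξ) in
/-- the Euler-type operator at the hyperplane -/
def th (a : G → ℂ) (y0 : V) : Module.End ℂ (Y →ₗ[ℂ] K) :=
  post (LinearMap.mulLeft ℂ (S.X ξ)) ∘ₗ S.nab σ a y0

lemma th_apply (a : G → ℂ) (y0 : V) (F : Y →ₗ[ℂ] K) :
    S.th σ ξ a y0 F = S.X ξ • S.nab σ a y0 F := by
  ext y; simp [th]

lemma th_smulK (a : G → ℂ) (y0 : V) (k : K) (F : Y →ₗ[ℂ] K) :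
    S.th σ ξ a y0 (k • F) = (S.X ξ * S.der y0 k) • F + k • S.th σ ξ a y0 F := by
  rw [th_apply, th_apply, nab_smulK, smul_add, smul_smul, smul_comm (S.X ξ) k]

lemma th_lat0 {a : G → ℂ} (ha : S.Param a) {y0 : V} (hy : ξ y0 = 1) {c : ℂ}
    (hc : ∀ w ∈ stb π ξ, w ≠ 1 → a w = c) {F : Y →ₗ[ℂ] K} (hF : F ∈ S.lat hξ Y 0) :
    S.th σ ξ a y0 F - c • (((St π ξ).card : ℂ) • F - sR π σ ξ F) ∈ S.lat hξ Y 1 := by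
  classical
  rw [mem_lat0] at hF
  let r : G → K := fun w => if w ∈ stb π ξ then 0 else a w • S.ell w y0
  have hr : ∀ w, r w ∈ S.Oo hξ := by
    intro w
    simp only [r]
    split_ifs with h
    · exact zero_mem _
    · by_cases hw : w ∈ S.R
      · exact Subalgebra.smul_mem _ (S.nstb_ell hξ hw h y0) _
      · rw [ha.supp w hw, zero_smul]; exact zero_mem _
  have key : S.th σ ξ a y0 F - c • (((St π ξ).card : ℂ) • F - sR π σ ξ F) =
      S.X ξ ^ 1 • (post (S.der y0 : K →ₗ[ℂ] K) F + ∑ w, r w • (F - Rr σ w F)) := by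
    ext y
    have e1 : c • (((St π ξ).card : ℂ) • F - sR π σ ξ F) y =
        ∑ w, if w ∈ stb π ξ then c • (F y - F (σ w⁻¹ y)) else 0 := by
      rw [← Finset.sum_filter]
      change _ = ∑ w ∈ St π ξ, _
      rw [← Finset.smul_sum, Finset.sum_sub_distrib]
      simp [sR, LinearMap.sum_apply]
      congr 2
      exact Algebra.smul_def (A := K) _ _ |>.trans (by simp)
    rw [LinearMap.sub_apply, LinearMap.smul_apply, e1, th_apply, LinearMap.smul_apply, nab_apply]
    simp only [LinearMap.smul_apply, LinearMap.add_apply, LinearMap.sum_apply, smul_eq_mul,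
      post_apply, LinearMap.sub_apply, Rr_apply, pow_one, mul_add, Finset.mul_sum]
    rw [add_sub_assoc, ← Finset.sum_sub_distrib]
    congr 1
    refine Finset.sum_congr rfl fun w _ => ?_
    simp only [r]
    split_ifs with h
    · by_cases h1 : w = 1
      · subst h1; simp
      · rw [S.stb_ell hξ h h1, hc w h h1, hy]
        have := S.X_ne hξ
        simp only [Algebra.smul_def (A := K) (_ : ℂ), map_one]
        field_simp
        ring
    · simp only [Algebra.smul_def (A := K) (_ : ℂ)]
      ring
  rw [key]
  refine ⟨_, ?_, rfl⟩
  intro y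
  simp only [LinearMap.add_apply, LinearMap.sum_apply, LinearMap.smul_apply, post_apply]
  exact add_mem (S.der_Oo hξ y0 (hF y)) (Subalgebra.sum_mem _ fun w _ =>
    mul_mem (hr w) (sub_mem (hF _) (hF _)))

lemma th_lat' {a : G → ℂ} (ha : S.Param a) {y0 : V} (hy : ξ y0 = 1) {c : ℂ}
    (hc : ∀ w ∈ stb π ξ, w ≠ 1 → a w = c) {n : ℕ} {F : Y →ₗ[ℂ] K} (hF : F ∈ S.lat hξ Y n) :
    S.th σ ξ a y0 F - (n : ℂ) • F - c • (((St π ξ).card : ℂ) • F - sR π σ ξ F) ∈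
      S.lat hξ Y (n + 1) := by
  obtain ⟨F', h, rfl⟩ := hF
  have h1 := S.th_lat0 σ hξ ha hy hc ((mem_lat0 hξ).2 h)
  have h2 := S.lat_Xpow hξ (m := n) h1
  rw [add_comm 1 n] at h2
  convert h2 using 1
  have h3 : S.X ξ * S.der y0 (S.X ξ ^ n) = (n : K) * S.X ξ ^ n := by
    rw [Derivation.leibniz_pow, S.der_X, hy]
    cases n with
    | zero => simp
    | succ n => simp [pow_succ]; ring
  have h4 : sR π σ ξ (S.X ξ ^ n • F') = S.X ξ ^ n • sR π σ ξ F' := by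
    ext y; simp [sR, LinearMap.sum_apply, Finset.mul_sum]
  rw [th_smulK, h3, h4]
  ext y
  simp only [LinearMap.sub_apply, LinearMap.add_apply, LinearMap.smul_apply, smul_eq_mul,
    Algebra.smul_def (A := K) (_ : ℂ), map_natCast]
  ring

lemma th_lat {a : G → ℂ} (ha : S.Param a) {y0 : V} (hy : ξ y0 = 1) {c : ℂ}
    (hc : ∀ w ∈ stb π ξ, w ≠ 1 → a w = c) {n : ℕ} {F : Y →ₗ[ℂ] K} (hF : F ∈ S.lat hξ Y n) :
    S.th σ ξ a y0 F ∈ S.lat hξ Y n := by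
  have h := S.lat_mono hξ (Nat.le_succ n) (S.th_lat' σ hξ ha hy hc hF)
  have h2 : (n : ℂ) • F + c • (((St π ξ).card : ℂ) • F - sR π σ ξ F) ∈ S.lat hξ Y n :=
    add_mem (Submodule.smul_mem _ _ hF) (Submodule.smul_mem _ _ (sub_mem
      (Submodule.smul_mem _ _ hF) (S.lat_sR σ hξ hF)))
  have := add_mem h h2
  convert this using 1
  abel

end Setup

/-- `F` becomes small after applying finitely many operators `θ - l`, `l` an integer. -/
inductive LL {E : Type*} [AddCommGroup E] [Module ℂ E] (θ : Module.End ℂ E)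
    (P0 PN : Submodule ℂ E) : E → Prop
  | base (F : E) : F ∈ P0 → F ∈ PN → LL θ P0 PN F
  | step (F : E) (l : ℤ) : F ∈ P0 → LL θ P0 PN (θ F - (l : ℂ) • F) → LL θ P0 PN F

namespace LL
variable {E : Type*} [AddCommGroup E] [Module ℂ E] {θ : Module.End ℂ E} {P0 PN : Submodule ℂ E}

lemma p0 {F : E} (h : LL θ P0 PN F) : F ∈ P0 := by
  cases h <;> assumption

lemma map {E' : Type*} [AddCommGroup E'] [Module ℂ E'] {θ' : Module.End ℂ E'}
    {P0' PN' : Submodule ℂ E'} (φ : E →ₗ[ℂ] E') (hφ : ∀ F, φ (θ F) = θ' (φ F))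
    (h0 : ∀ F ∈ P0, φ F ∈ P0') (hN : ∀ F ∈ PN, φ F ∈ PN') {F : E} (h : LL θ P0 PN F) :
    LL θ' P0' PN' (φ F) := by
  induction h with
  | base F h1 h2 => exact base _ (h0 _ h1) (hN _ h2)
  | step F l h1 _ ih =>
    refine step _ l (h0 _ h1) ?_
    rwa [map_sub, hφ, map_smul] at ih

lemma mono {PN' : Submodule ℂ E} (hN : PN ≤ PN') {F : E} (h : LL θ P0 PN F) :
    LL θ P0 PN' F :=
  map (θ := θ) (θ' := θ) LinearMap.id (fun _ => rfl) (fun _ h => h) (fun _ h => hN h) h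

lemma th (h0 : ∀ F ∈ P0, θ F ∈ P0) (hN : ∀ F ∈ PN, θ F ∈ PN) {F : E} (h : LL θ P0 PN F) :
    LL θ P0 PN (θ F) := map θ (fun _ => rfl) h0 hN h

lemma smul (c : ℂ) {F : E} (h : LL θ P0 PN F) : LL θ P0 PN (c • F) :=
  map (c • LinearMap.id) (fun F => by simp) (fun _ h => by simpa using Submodule.smul_mem _ _ h)
    (fun _ h => by simpa using Submodule.smul_mem _ _ h) h

lemma add (h0 : ∀ F ∈ P0, θ F ∈ P0) (hN : ∀ F ∈ PN, θ F ∈ PN) {F F' : E} (h : LL θ P0 PN F)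
    (h' : LL θ P0 PN F') : LL θ P0 PN (F + F') := by
  induction h generalizing F' with
  | base F h1 h2 =>
    induction h' generalizing F with
    | base F' h1' h2' => exact base _ (add_mem h1 h1') (add_mem h2 h2')
    | step F' l h1' _ ih =>
      refine step _ l (add_mem h1 h1') ?_
      have := ih (θ F - (l : ℂ) • F) (sub_mem (h0 _ h1) (Submodule.smul_mem _ _ h1))
        (sub_mem (hN _ h2) (Submodule.smul_mem _ _ h2))
      convert this using 1
      rw [map_add, smul_add]; abel
  | step F l h1 _ ih =>
    refine step _ l (add_mem h1 h'.p0) ?_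
    have h2 : LL θ P0 PN (θ F' - (l : ℂ) • F') := by
      have hid : LL θ P0 PN ((θ - (l : ℂ) • (1 : Module.End ℂ E)) F') :=
        map (θ - (l : ℂ) • (1 : Module.End ℂ E)) (fun F => by simp) (fun F hF => by
          simpa using sub_mem (h0 _ hF) (Submodule.smul_mem P0 (l : ℂ) hF)) (fun F hF => by
          simpa using sub_mem (hN _ hF) (Submodule.smul_mem PN (l : ℂ) hF)) h'
      simpa using hid
    have := ih h2
    convert this using 1
    rw [map_add, smul_add]; abel

end LL

namespace Setup

variable {G V : Type*} [Group G] [AddCommGroup V] [Module ℂ V]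
    {π : Representation ℂ G V} {K : Type} [Field K] [Algebra ℂ K] (S : Setup π K)
    {Y : Type*} [AddCommGroup Y] [Module ℂ Y] (σ : Representation ℂ G Y)
    {ξ : Module.Dual ℂ V} (hξ : ξ ≠ 0) [Fintype G]

def Lp (a : G → ℂ) (y0 : V) (N : ℕ) (F : Y →ₗ[ℂ] K) : Prop :=
  LL (S.th σ ξ a y0) (S.lat hξ Y 0) (S.lat hξ Y N) F

section
variable {a : G → ℂ} (ha : S.Param a) {y0 : V} (hy : ξ y0 = 1) {c : ℂ}
    (hc : ∀ w ∈ stb π ξ, w ≠ 1 → a w = c)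
include ha hy hc

lemma Lp_add {N : ℕ} {F F' : Y →ₗ[ℂ] K} (h : S.Lp σ hξ a y0 N F) (h' : S.Lp σ hξ a y0 N F') :
    S.Lp σ hξ a y0 N (F + F') :=
  LL.add (fun _ => S.th_lat σ hξ ha hy hc) (fun _ => S.th_lat σ hξ ha hy hc) h h'

lemma Lp_sum {ι : Type*} (s : Finset ι) {N : ℕ} (F : ι → (Y →ₗ[ℂ] K))
    (h : ∀ i ∈ s, S.Lp σ hξ a y0 N (F i)) : S.Lp σ hξ a y0 N (∑ i ∈ s, F i) := by
  classical
  induction s using Finset.induction_on with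
  | empty => exact LL.base _ (by simp) (by simp)
  | insert i s hi ih =>
    rw [Finset.sum_insert hi]
    exact S.Lp_add σ hξ ha hy hc (h i (by simp)) (ih fun j hj => h j (by simp [hj]))

omit ha hc in
lemma Lp_X {N : ℕ} {F : Y →ₗ[ℂ] K} (h : S.Lp σ hξ a y0 N F) :
    S.Lp σ hξ a y0 (N + 1) (S.X ξ • F) := by
  unfold Lp at h
  induction h with
  | base F h1 h2 =>
    exact LL.base _ (S.lat_mono hξ (Nat.zero_le _) (S.lat_X hξ h1)) (S.lat_X hξ h2)
  | step F l h1 _ ih =>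
    refine LL.step _ (l + 1) (S.lat_mono hξ (Nat.zero_le _) (S.lat_X hξ h1)) ?_
    unfold Lp at ih
    convert ih using 1
    rw [th_smulK, S.der_X, hy]
    ext y
    simp only [LinearMap.sub_apply, LinearMap.add_apply, LinearMap.smul_apply, smul_eq_mul,
      Algebra.smul_def (A := K) (_ : ℂ), map_one, Int.cast_add, Int.cast_one, map_add]
    ring

lemma Lp_smul {N : ℕ} {F : Y →ₗ[ℂ] K} (h : S.Lp σ hξ a y0 N F) {u : K} (hu : u ∈ S.Oo hξ) :
    S.Lp σ hξ a y0 N (u • F) := by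
  induction N generalizing F u with
  | zero => exact LL.base _ (S.lat_smul hξ hu h.p0) (S.lat_smul hξ hu h.p0)
  | succ N ihN =>
    unfold Lp at h
    induction h with
    | base F h1 h2 => exact LL.base _ (S.lat_smul hξ hu h1) (S.lat_smul hξ hu h2)
    | step F l h1 hs ih =>
      refine LL.step _ l (S.lat_smul hξ hu h1) ?_
      have hF : S.Lp σ hξ a y0 N F :=
        LL.mono (S.lat_mono hξ (Nat.le_succ N)) (LL.step _ l h1 hs)
      have h3 := S.Lp_X σ hξ hy (ihN hF (S.der_Oo hξ y0 hu))
      have h4 := S.Lp_add σ hξ ha hy hc ih h3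
      unfold Lp at h4
      convert h4 using 1
      rw [th_smulK]
      ext y
      simp only [LinearMap.sub_apply, LinearMap.add_apply, LinearMap.smul_apply, smul_eq_mul,
        Algebra.smul_def (A := K) (_ : ℂ)]
      ring

/-- tangential derivatives -/
lemma lat_nab {n : ℕ} {v : V} (hv : ξ v = 0) {F : Y →ₗ[ℂ] K} (h : F ∈ S.lat hξ Y n) :
    S.nab σ a v F ∈ S.lat hξ Y n := by
  obtain ⟨F', h, rfl⟩ := h
  refine ⟨S.nab σ a v F', fun y => ?_, ?_⟩
  · rw [nab_apply]
    refine add_mem (S.der_Oo hξ v (h y)) (Subalgebra.sum_mem _ fun w _ => ?_)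
    by_cases hw : w ∈ S.R
    · refine Subalgebra.smul_mem _ (mul_mem ?_ (sub_mem (h _) (h _))) _
      by_cases hs : w ∈ stb π ξ
      · rw [S.stb_ell hξ hs (fun h1 => S.one_R (h1 ▸ hw)), hv]; simp
      · exact S.nstb_ell hξ hw hs v
    · rw [ha.supp w hw, zero_smul]; exact zero_mem _
  · rw [nab_smulK, Derivation.leibniz_pow, S.der_X, hv]; simp

lemma Lp_nab {N : ℕ} {v : V} (hv : ξ v = 0) {F : Y →ₗ[ℂ] K} (h : S.Lp σ hξ a y0 N F) :
    S.Lp σ hξ a y0 N (S.nab σ a v F) := by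
  refine LL.map (S.nab σ a v) (fun F => ?_) (fun F hF => S.lat_nab σ hξ ha hy hc hv hF)
    (fun F hF => S.lat_nab σ hξ ha hy hc hv hF) h
  rw [th_apply, th_apply, nab_smulK, S.der_X, hv, S.flat σ ha]
  simp

/-- the residue estimate -/
lemma Lp_res {N : ℕ} (hN : 1 ≤ N) (hcl : ∀ l : ℤ, c * (St π ξ).card ≠ l) {F : Y →ₗ[ℂ] K}
    (h : S.Lp σ hξ a y0 N F) : ((St π ξ).card : ℂ) • F - sR π σ ξ F ∈ S.lat hξ Y 1 := by
  unfold Lp at h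
  set e : ℂ := ((St π ξ).card : ℂ) with he
  induction h with
  | base F h1 h2 =>
    have h3 := S.lat_mono hξ hN h2
    exact sub_mem (Submodule.smul_mem _ _ h3) (S.lat_sR σ hξ h3)
  | step F l h1 hs ih =>
    have h3 := S.th_lat0 σ hξ ha hy hc h1
    have h4 : ((c * e - l)) • (e • F - sR π σ ξ F) ∈ S.lat hξ Y 1 := by
      have h5 := sub_mem ih (sub_mem (Submodule.smul_mem _ e h3) (S.lat_sR σ hξ h3))
      convert h5 using 1
      simp only [map_sub, map_smul, sR_sR, ← he]
      module
    exact (Submodule.smul_mem_iff _ (sub_ne_zero.2 (hcl l))).1 h4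

end

lemma Dg_th {a : G → ℂ} (ha : S.Param a) {y0 : V} (hy : Adm π ξ y0) {w : G}
    (hw : w ∈ stb π ξ) (F : Y →ₗ[ℂ] K) :
    S.Dg σ w (S.th σ ξ a y0 F) = S.th σ ξ a y0 (S.Dg σ w F) := by
  obtain ⟨c, hc0, h1, hX, -⟩ := hy.act_X (S := S) hw
  rw [th_apply, th_apply, Dg_smulK, S.Dg_nab σ ha, h1, nab_smul, hX]
  ext y
  simp only [LinearMap.smul_apply, smul_eq_mul, Algebra.smul_def (A := K) (_ : ℂ)]
  have : algebraMap ℂ K c ≠ 0 := by simpa using hc0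
  rw [map_inv₀]
  field_simp

lemma sD_th {a : G → ℂ} (ha : S.Param a) {y0 : V} (hy : Adm π ξ y0) (F : Y →ₗ[ℂ] K) :
    S.sD σ ξ (S.th σ ξ a y0 F) = S.th σ ξ a y0 (S.sD σ ξ F) := by
  rw [sD, LinearMap.sum_apply, LinearMap.sum_apply, map_sum]
  exact Finset.sum_congr rfl fun w hw => S.Dg_th σ ha hy (mem_St.1 hw) F

/-- the normal Dunkl operator -/
def hh (ξ : Module.Dual ℂ V) (a : G → ℂ) (y0 : V) (β : ℂ) : Module.End ℂ (Y →ₗ[ℂ] K) :=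
  S.th σ ξ a y0 - β • (((St π ξ).card : ℂ) • LinearMap.id - S.sD σ ξ)

lemma hh_apply (a : G → ℂ) (y0 : V) (β : ℂ) (F : Y →ₗ[ℂ] K) : S.hh σ ξ a y0 β F =
    S.th σ ξ a y0 F - β • (((St π ξ).card : ℂ) • F - S.sD σ ξ F) := rfl

lemma hh_th {a : G → ℂ} (ha : S.Param a) {y0 : V} (hy : Adm π ξ y0) (β : ℂ) (F : Y →ₗ[ℂ] K) :
    S.hh σ ξ a y0 β (S.th σ ξ a y0 F) = S.th σ ξ a y0 (S.hh σ ξ a y0 β F) := by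
  simp only [hh_apply, S.sD_th σ ha hy, map_sub, map_smul]

/-- `F` is `Xξ` times an element of `L^N` -/
lemma Lp_hh {a : G → ℂ} (ha : S.Param a) {y0 : V} (hy : Adm π ξ y0) {c : ℂ}
    (hc : ∀ w ∈ stb π ξ, w ≠ 1 → a w = c) (nn : ℕ)
    (hcl : nn ≠ 0 → ∀ l : ℤ, c * (St π ξ).card ≠ l) {F : Y →ₗ[ℂ] K}
    (h : S.Lp σ hξ a y0 (nn * (St π ξ).card) F) :
    ∃ F', S.Lp σ hξ a y0 (nn * (St π ξ).card) F' ∧ S.hh σ ξ a y0 (c + nn) F = S.X ξ • F' := by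
  set e : ℂ := ((St π ξ).card : ℂ) with he
  -- first : in `lat 1`
  have h1 : ∀ F : Y →ₗ[ℂ] K, S.Lp σ hξ a y0 (nn * (St π ξ).card) F →
      S.hh σ ξ a y0 (c + nn) F ∈ S.lat hξ Y 1 := by
    intro F h
    have e1 := S.th_lat0 σ hξ ha hy.one hc h.p0
    have e2 := S.lat_sD σ hξ hy (Dvd.intro_left 0 (by simp)) h.p0
    have e3 : (nn : ℂ) • (e • F - sR π σ ξ F) ∈ S.lat hξ Y 1 := by
      rcases Nat.eq_zero_or_pos nn with h0 | h0
      · rw [h0]; simp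
      · exact Submodule.smul_mem _ _ (S.Lp_res σ hξ ha hy.one hc
          (Nat.mul_pos h0 St_pos) (hcl h0.ne') h)
    have e4 := sub_mem (add_mem e1 (Submodule.smul_mem _ (c + nn) e2)) e3
    convert e4 using 1
    rw [hh_apply, ← he]
    module
  have hX0 := S.X_ne hξ
  have hdiv : ∀ F : Y →ₗ[ℂ] K, F = S.X ξ • ((S.X ξ)⁻¹ • F) := fun F => by
    rw [smul_smul, mul_inv_cancel₀ hX0, one_smul]
  have hthdiv : ∀ (F : Y →ₗ[ℂ] K) (l : ℤ), S.th σ ξ a y0 ((S.X ξ)⁻¹ • F) - ((l - 1 : ℤ) : ℂ) •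
      ((S.X ξ)⁻¹ • F) = (S.X ξ)⁻¹ • (S.th σ ξ a y0 F - (l : ℂ) • F) := by
    intro F l
    have := S.th_smulK σ (ξ := ξ) a y0 (S.X ξ) ((S.X ξ)⁻¹ • F)
    rw [← hdiv, S.der_X, hy.one] at this
    rw [this]
    ext y
    simp only [LinearMap.sub_apply, LinearMap.add_apply, LinearMap.smul_apply, smul_eq_mul,
      Algebra.smul_def (A := K) (_ : ℂ), map_one, Int.cast_sub, Int.cast_one, map_sub]
    field_simp
    ring
  refine ⟨(S.X ξ)⁻¹ • S.hh σ ξ a y0 (c + nn) F, ?_, hdiv _⟩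
  have hl0 : ∀ F : Y →ₗ[ℂ] K, S.Lp σ hξ a y0 (nn * (St π ξ).card) F →
      (S.X ξ)⁻¹ • S.hh σ ξ a y0 (c + nn) F ∈ S.lat hξ Y 0 := by
    intro F h
    apply S.lat_X' hξ
    rw [← hdiv]; exact h1 F h
  unfold Lp at h
  induction h with
  | base F h0 hN =>
    refine LL.step _ ((nn * (St π ξ).card : ℕ) - 1 : ℤ) (hl0 F (LL.base _ h0 hN)) ?_
    rw [hthdiv]
    have e1 := S.th_lat' σ hξ ha hy.one hc hN
    have e2 := S.lat_sD σ hξ hy (Dvd.intro_left nn rfl) hN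
    have hF1 : S.hh σ ξ a y0 (c + nn) F - ((nn : ℂ)) • sR π σ ξ F ∈
        S.lat hξ Y (nn * (St π ξ).card + 1) := by
      have e4 := (add_mem e1 (Submodule.smul_mem _ (c + nn) e2))
      convert e4 using 1
      rw [hh_apply, ← he]
      push_cast
      rw [← he]
      module
    have e5 := S.th_lat' σ hξ ha hy.one hc (S.lat_sR σ hξ hN)
    rw [sR_sR, sub_self, smul_zero, sub_zero] at e5
    have e6 := S.th_lat σ hξ ha hy.one hc hF1
    have e7 : S.th σ ξ a y0 (S.hh σ ξ a y0 (c + nn) F) -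
        (((nn * (St π ξ).card : ℕ) : ℤ) : ℂ) • S.hh σ ξ a y0 (c + nn) F ∈
        S.lat hξ Y (nn * (St π ξ).card + 1) := by
      have e8 := add_mem (sub_mem e6 (Submodule.smul_mem _
        (((nn * (St π ξ).card : ℕ) : ℂ)) hF1)) (Submodule.smul_mem _ (nn : ℂ) e5)
      convert e8 using 1
      rw [map_sub, map_smul]
      push_cast
      module
    have e9 : (S.X ξ)⁻¹ • (S.th σ ξ a y0 (S.hh σ ξ a y0 (c + nn) F) -
        (((nn * (St π ξ).card : ℕ) : ℤ) : ℂ) • S.hh σ ξ a y0 (c + nn) F) ∈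
        S.lat hξ Y (nn * (St π ξ).card) := by
      apply S.lat_X' hξ
      rw [← hdiv]; exact e7
    exact LL.base _ (S.lat_mono hξ (Nat.zero_le _) e9) e9
  | step F l h0 hs ih =>
    refine LL.step _ (l - 1) (hl0 F (LL.step _ l h0 hs)) ?_
    rw [hthdiv, ← S.hh_th σ ha hy, ← map_smul, ← map_sub]
    exact ih

end Setup

namespace Setup

variable {G V : Type*} [Group G] [AddCommGroup V] [Module ℂ V]
    {π : Representation ℂ G V} {K : Type} [Field K] [Algebra ℂ K] (S : Setup π K)
    {Y : Type*} [AddCommGroup Y] [Module ℂ Y] (σ : Representation ℂ G Y)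
    {ξ : Module.Dual ℂ V} (hξ : ξ ≠ 0) [Fintype G]

omit [Fintype G] in
lemma stb_same {a : G → ℂ} (ha : S.Param a) (hξ : ξ ≠ 0) {w0 : G} (h0 : w0 ∈ stb π ξ) (h01 : w0 ≠ 1) :
    ∀ w ∈ stb π ξ, w ≠ 1 → a w = a w0 := by
  intro w hw hw1
  refine (ha.same w0 (S.stb_R hξ h0 h01) w (S.stb_R hξ hw hw1) fun v hv => ?_).symm
  obtain ⟨c, hc, e⟩ := prop_of_ker (S.α_ne _ (S.stb_R hξ h0 h01)) hξ (S.stb_alpha hξ h0 h01)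
  rw [e] at hv
  exact S.stb_alpha hξ hw hw1 v (by simpa [hc] using hv)

/-- the module of quasi-invariant type -/
def Npp {a : G → ℂ} (ha : S.Param a) (nn : G → ℕ) : Submodule ℂ (Y →ₗ[ℂ] K) where
  carrier := {f | f ∈ S.HA Y ∧ ∀ (ξ : Module.Dual ℂ V) (hξ : ξ ≠ 0) (y0 : V), Adm π ξ y0 →
    ∀ w0 ∈ stb π ξ, w0 ≠ 1 → S.Lp σ hξ a y0 (nn w0 * (St π ξ).card) f}
  add_mem' := by
    rintro f f' ⟨h1, h2⟩ ⟨h1', h2'⟩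
    exact ⟨add_mem h1 h1', fun ξ hξ y0 hy w0 hw hw1 => S.Lp_add σ hξ ha hy.one
      (S.stb_same ha hξ hw hw1) (h2 ξ hξ y0 hy w0 hw hw1) (h2' ξ hξ y0 hy w0 hw hw1)⟩
  zero_mem' := ⟨zero_mem _, fun ξ hξ y0 hy w0 hw hw1 => LL.base _ (zero_mem _) (zero_mem _)⟩
  smul_mem' := by
    rintro c f ⟨h1, h2⟩
    exact ⟨Submodule.smul_mem _ _ h1, fun ξ hξ y0 hy w0 hw hw1 =>
      LL.smul c (h2 ξ hξ y0 hy w0 hw hw1)⟩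

variable {S σ} in
lemma mem_Npp {a : G → ℂ} {ha : S.Param a} {nn : G → ℕ} {f : Y →ₗ[ℂ] K} : f ∈ S.Npp σ ha nn ↔
  (f ∈ S.HA Y ∧ ∀ (ξ : Module.Dual ℂ V) (hξ : ξ ≠ 0) (y0 : V), Adm π ξ y0 →
    ∀ w0 ∈ stb π ξ, w0 ≠ 1 → S.Lp σ hξ a y0 (nn w0 * (St π ξ).card) f) := Iff.rfl

lemma Npp_A {a : G → ℂ} (ha : S.Param a) (nn : G → ℕ) {p : K} (hp : p ∈ S.A) {f : Y →ₗ[ℂ] K}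
    (hf : f ∈ S.Npp σ ha nn) : p • f ∈ S.Npp σ ha nn :=
  ⟨S.HA_smul hp hf.1, fun ξ hξ y0 hy w0 hw hw1 => S.Lp_smul σ hξ ha hy.one
      (S.stb_same ha hξ hw hw1) (hf.2 ξ hξ y0 hy w0 hw hw1) (S.A_Oo hξ hp)⟩

omit [Fintype G] in
lemma stb_conj (g : G) {w : G} : w ∈ stb π (ξ ∘ₗ π g) ↔ g * w * g⁻¹ ∈ stb π ξ := by
  rw [mem_stb, mem_stb]
  constructor
  · intro h v hv
    have := h (π g⁻¹ v) (by simpa using hv)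
    rw [map_mul, map_mul, Module.End.mul_apply, Module.End.mul_apply, this]
    simp
  · intro h v hv
    have := h (π g v) (by simpa using hv)
    have h2 := congrArg (π g⁻¹) this
    simpa using h2

lemma St_conj (g : G) : (St π (ξ ∘ₗ π g)).card = (St π ξ).card := by
  refine Finset.card_bijective (fun w => g * w * g⁻¹) (MulAut.conj g).bijective (fun w => ?_)
  rw [mem_St, mem_St, stb_conj]

omit [Fintype G] in
lemma Adm.conj {y0 : V} (h : Adm π ξ y0) (g : G) : Adm π (ξ ∘ₗ π g) (π g⁻¹ y0) := by
  refine ⟨by simpa using h.one, fun w hw => ?_⟩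
  obtain ⟨c, hc⟩ := h.eig _ ((stb_conj g).1 hw)
  refine ⟨c, ?_⟩
  rw [← map_smul, ← hc]
  simp

lemma Npp_Dg {a : G → ℂ} (ha : S.Param a) {nn : G → ℕ} (hnn : ∀ h w, nn (h * w * h⁻¹) = nn w)
    (g : G) {f : Y →ₗ[ℂ] K} (hf : f ∈ S.Npp σ ha nn) : S.Dg σ g f ∈ S.Npp σ ha nn := by
  refine ⟨S.HA_Dg σ g hf.1, fun ξ hξ y0 hy w0 hw hw1 => ?_⟩
  have h1 := hf.2 (ξ ∘ₗ π g) (comp_ne hξ g) _ (hy.conj g) (g⁻¹ * w0 * g) ((stb_conj g).2 (by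
    convert hw using 1; group)) (fun h => hw1 (by
      have := congrArg (fun x => g * x * g⁻¹) h
      simpa [mul_assoc] using this))
  have h2 := hnn g⁻¹ w0
  rw [inv_inv] at h2
  rw [h2, St_conj] at h1
  refine LL.map (S.Dg σ g) (fun F => ?_) (fun F hF => S.lat_Dg σ hξ g _ hF)
    (fun F hF => S.lat_Dg σ hξ g _ hF) h1
  rw [th_apply, th_apply, Dg_smulK, S.Dg_nab σ ha, S.act_X]
  have e1 : (ξ ∘ₗ π g) ∘ₗ π g⁻¹ = ξ := by ext v; simp
  have e2 : π g (π g⁻¹ y0) = y0 := by simp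
  rw [e1, e2]

omit [Fintype G] in
lemma Adm_exists [Fintype G] {w : G} (hw : w ∈ S.R) : ∃ y0, Adm π (S.α w) y0 := by
  obtain ⟨y1, hy1⟩ : ∃ v, S.α w v ≠ 0 := by
    by_contra hc; push Not at hc; exact S.α_ne w hw (LinearMap.ext hc)
  set ξ := S.α w with hξ
  have hwst : w ∈ stb π ξ := fun v hv => (S.α_ker w hw v).1 hv
  let y := (ξ y1)⁻¹ • y1
  have hy : ξ y = 1 := by simp [y, hy1]
  set e : ℂ := ((St π ξ).card : ℂ) with he
  have he0 : e ≠ 0 := by rw [he]; exact_mod_cast (St_pos).ne'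
  let av : Module.End ℂ V := e⁻¹ • ∑ u ∈ St π ξ, π u
  have hav : ∀ v, av v = e⁻¹ • ∑ u ∈ St π ξ, π u v := fun v => by
    simp [av, LinearMap.sum_apply]
  have hinv : ∀ u ∈ stb π ξ, ∀ v, π u (av v) = av v := by
    intro u hu v
    rw [hav, map_smul, map_sum, ← sum_St hu (fun w => π w v)]
    congr 1
    exact Finset.sum_congr rfl fun w _ => by simp
  have havu : ∀ u ∈ stb π ξ, ∀ v, av (π u v) = av v := by
    intro u hu v
    rw [hav, hav]
    congr 1
    refine Finset.sum_bijective (fun w => w * u) (Group.mulRight_bijective u)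
      (fun w => by rw [mem_St, mem_St, Subgroup.mul_mem_cancel_right _ hu]) (fun w _ => by simp)
  have havf : ∀ v, (∀ u ∈ stb π ξ, π u v = v) → av v = v := by
    intro v hv
    rw [hav, Finset.sum_congr rfl (fun u hu => hv u (mem_St.1 hu)), Finset.sum_const,
      ← Nat.cast_smul_eq_nsmul ℂ, smul_smul, inv_mul_cancel₀ he0, one_smul]
  have hav0 : ∀ v, ξ (av v) = 0 := fun v => (S.α_ker w hw _).2 (hinv w hwst v)
  have h1 : ξ (y - av y) = 1 := by rw [map_sub, hy, hav0, sub_zero]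
  refine ⟨y - av y, h1, fun u hu => ?_⟩
  refine ⟨ξ (π u (y - av y)), ?_⟩
  set y0 := y - av y with hy0
  have hz : ξ (π u y0 - ξ (π u y0) • y0) = 0 := by rw [map_sub, map_smul, h1]; simp
  have hz2 := havf _ (fun u' hu' => hu' _ hz)
  have hay0 : av y0 = 0 := by
    rw [hy0, map_sub, havf (av y) (fun u hu => hinv u hu y), sub_self]
  rw [map_sub, map_smul, havu u hu, hay0, smul_zero, sub_zero] at hz2
  exact sub_eq_zero.1 hz2.symm

omit [Fintype G] in
lemma remove_primes (s : Finset G) (hs : ∀ w ∈ s, w ∈ S.R) {k : K}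
    (h : (∏ w ∈ s, S.X (S.α w)) * k ∈ S.A) (hO : ∀ w (hw : w ∈ S.R), k ∈ S.Oo (S.α_ne w hw)) :
    k ∈ S.A := by
  classical
  induction s using Finset.induction_on with
  | empty => simpa using h
  | insert w s hw ih =>
    apply ih (fun w hw => hs w (by simp [hw]))
    have hwR := hs w (by simp)
    rw [Finset.prod_insert hw, mul_assoc] at h
    set x := (∏ w ∈ s, S.X (S.α w)) * k with hx
    have hxO : x ∈ S.Oo (S.α_ne w hwR) :=
      mul_mem (Subalgebra.prod_mem _ fun i _ => S.A_Oo _ (S.X_mem _)) (hO w hwR)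
    obtain ⟨p, hp, q, hq, hn, e⟩ := hxO
    rcases S.prime _ (S.α_ne w hwR) q hq _ h ⟨p, hp, by rw [← e]; ring⟩ with ⟨r, hr, h1⟩ | ⟨r, hr, h1⟩
    · exact absurd h1 (hn r hr)
    · have := mul_left_cancel₀ (S.X_ne (S.α_ne w hwR)) h1
      rwa [this]

lemma T_denom {a b : G → ℂ} (ha : S.Param a) (hb : S.Param b) (v : V) {f : Y →ₗ[ℂ] K}
    (hf : f ∈ S.HA Y) (y : Y) (s : Finset G) (hs : ∀ w, w ∈ s ↔ w ∈ S.R) :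
    (∏ w ∈ s, S.X (S.α w)) * S.T σ a b v f y ∈ S.A := by
  have hP : (∏ w ∈ s, S.X (S.α w)) ∈ S.A := Subalgebra.prod_mem _ fun i _ => S.X_mem _
  have hl : ∀ w ∈ S.R, (∏ w ∈ s, S.X (S.α w)) * S.ell w v ∈ S.A := by
    classical
    intro w hw
    rw [← Finset.mul_prod_erase s _ ((hs w).2 hw), ell]
    have := S.X_ne (S.α_ne w hw)
    have e' : (S.X (S.α w) * ∏ x ∈ s.erase w, S.X (S.α x)) * (algebraMap ℂ K (S.α w v) / S.X (S.α w))
      = algebraMap ℂ K (S.α w v) * ∏ x ∈ s.erase w, S.X (S.α x) := by field_simp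
    rw [e']
    exact mul_mem (Subalgebra.algebraMap_mem _ _) (Subalgebra.prod_mem _ fun i _ => S.X_mem _)
  rw [T_apply, LinearMap.sub_apply, nab_apply, Bd_apply, mul_sub, mul_add, Finset.mul_sum,
    Finset.mul_sum]
  refine sub_mem (add_mem (mul_mem hP (S.der_A v (hf y))) (Subalgebra.sum_mem _ fun w _ => ?_))
    (Subalgebra.sum_mem _ fun w _ => ?_)
  · by_cases hw : w ∈ S.R
    · rw [mul_smul_comm, ← mul_assoc]
      exact Subalgebra.smul_mem _ (mul_mem (hl w hw) (sub_mem (hf _) (hf _))) _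
    · rw [ha.supp w hw, zero_smul, mul_zero]; exact zero_mem _
  · by_cases hw : w ∈ S.R
    · rw [mul_smul_comm, ← mul_assoc]
      exact Subalgebra.smul_mem _ (mul_mem (hl w hw) (sub_mem (hf _) (S.act_A w (hf _)))) _
    · rw [hb.supp w hw, zero_smul, mul_zero]; exact zero_mem _

lemma T_local {a b : G → ℂ} (hb : S.Param b) {y0 : V} (hy : ξ y0 = 1) {β : ℂ}
    (hβ : ∀ w ∈ stb π ξ, w ≠ 1 → b w = β) (v : V) (f F' : Y →ₗ[ℂ] K)
    (hF' : S.hh σ ξ a y0 β f = S.X ξ • F') [DecidablePred (· ∈ stb π ξ)] :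
    S.T σ a b v f = S.nab σ a (v - ξ v • y0) f + ξ v • F' -
      ∑ w, (if w ∈ stb π ξ then 0 else b w • S.ell w v) • (f - S.Dg σ w f) := by
  have hξ : ξ ≠ 0 := by rintro rfl; simp at hy
  have hX := S.X_ne hξ
  have e0 : S.nab σ a v f = S.nab σ a (v - ξ v • y0) f + ξ v • S.nab σ a y0 f := by
    rw [← LinearMap.smul_apply, ← nab_smul, ← LinearMap.add_apply, ← nab_add]; simp
  have e1 : F' = S.nab σ a y0 f - β • (S.X ξ)⁻¹ • (((St π ξ).card : ℂ) • f - S.sD σ ξ f) := by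
    have h1 := congrArg (fun F => (S.X ξ)⁻¹ • F) hF'
    simp only [smul_smul, inv_mul_cancel₀ hX, one_smul] at h1
    rw [← h1, hh_apply, th_apply, smul_sub, smul_smul, inv_mul_cancel₀ hX, one_smul,
      smul_comm β]
  have e2 : ∀ y, (((St π ξ).card : ℂ) • f - S.sD σ ξ f) y =
      ∑ w, if w ∈ stb π ξ then (f y - S.Dg σ w f y) else 0 := by
    intro y
    rw [← Finset.sum_filter]
    have : Finset.univ.filter (fun w => w ∈ stb π ξ) = St π ξ := by ext; simp [St]
    rw [this, Finset.sum_sub_distrib]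
    simp [sD, LinearMap.sum_apply]
    exact Algebra.smul_def (A := K) _ _ |>.trans (by simp)
  rw [T_apply, e0, Bd_apply']
  ext y
  have eF : F' y = S.nab σ a y0 f y - β • ((S.X ξ)⁻¹ *
      ∑ w, if w ∈ stb π ξ then (f y - S.Dg σ w f y) else 0) := by
    rw [← e2 y]; conv_lhs => rw [e1]
    rfl
  have e3 : ∑ w, b w • (S.ell w v * (f y - S.Dg σ w f y)) =
     (∑ w, ξ v • β • ((S.X ξ)⁻¹ * if w ∈ stb π ξ then (f y - S.Dg σ w f y) else 0)) +
     ∑ w, (if w ∈ stb π ξ then 0 else b w • S.ell w v) * (f y - S.Dg σ w f y) := by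
    rw [← Finset.sum_add_distrib]
    refine Finset.sum_congr rfl fun w _ => ?_
    split_ifs with h
    · by_cases h1 : w = 1
      · subst h1; simp
      · rw [S.stb_ell hξ h h1, hβ w h h1]
        simp only [Algebra.smul_def (A := K) (_ : ℂ)]
        field_simp
        ring
    · simp only [Algebra.smul_def (A := K) (_ : ℂ)]
      ring
  simp only [LinearMap.sub_apply, LinearMap.add_apply, LinearMap.smul_apply, LinearMap.sum_apply,
    smul_eq_mul]
  rw [e3, eF, ← Finset.smul_sum, ← Finset.smul_sum, ← Finset.mul_sum, smul_sub]
  abel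

lemma Npp_T {a b : G → ℂ} (ha : S.Param a) (hb : S.Param b) {nn : G → ℕ}
    (hnn : ∀ h w, nn (h * w * h⁻¹) = nn w) (hab : ∀ w ∈ S.R, b w = a w + nn w)
    (hcl : ∀ w ∈ S.R, nn w ≠ 0 → ∀ k : ℕ, 0 < k → k ≤ Fintype.card G → ∀ l : ℤ, a w * k ≠ l)
    (v : V) {f : Y →ₗ[ℂ] K} (hf : f ∈ S.Npp σ ha nn) : S.T σ a b v f ∈ S.Npp σ ha nn := by
  classical
  have key : ∀ (ξ : Module.Dual ℂ V) (hξ : ξ ≠ 0) (y0 : V), Adm π ξ y0 →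
    ∀ w0 ∈ stb π ξ, w0 ≠ 1 → S.Lp σ hξ a y0 (nn w0 * (St π ξ).card) (S.T σ a b v f) := by
    intro ξ hξ y0 hy w0 hw hw1
    have hc := S.stb_same ha hξ hw hw1
    have hR := S.stb_R hξ hw hw1
    have hfL := hf.2 ξ hξ y0 hy w0 hw hw1
    obtain ⟨F', hF', e⟩ := S.Lp_hh σ hξ ha hy hc (nn w0) (fun h l =>
      hcl w0 hR h _ St_pos (Finset.card_le_univ _) l) hfL
    rw [S.T_local σ hb hy.one (β := a w0 + nn w0) (fun w h h1 => by
      rw [S.stb_same hb hξ hw hw1 w h h1, hab w0 hR]) v f F' e, sub_eq_add_neg,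
      ← Finset.sum_neg_distrib]
    refine S.Lp_add σ hξ ha hy.one hc (S.Lp_add σ hξ ha hy.one hc
      (S.Lp_nab σ hξ ha hy.one hc (by simp [hy.one]) hfL) (LL.smul _ hF'))
      (S.Lp_sum σ hξ ha hy.one hc _ _ fun w _ => ?_)
    have hfD := (sub_mem hf (S.Npp_Dg σ ha hnn w hf)).2 ξ hξ y0 hy w0 hw hw1
    have hneg : ∀ (k : K) (F : Y →ₗ[ℂ] K), -(k • F) = (-k) • F := fun k F => by ext y; simp
    rw [hneg]
    refine S.Lp_smul σ hξ ha hy.one hc hfD (neg_mem ?_)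
    split_ifs with h
    · exact zero_mem _
    · by_cases hwR : w ∈ S.R
      · exact Subalgebra.smul_mem _ (S.nstb_ell hξ hwR h v) _
      · rw [hb.supp w hwR, zero_smul]; exact zero_mem _
  refine ⟨fun y => ?_, key⟩
  refine S.remove_primes (Finset.univ.filter (· ∈ S.R)) (by simp)
    (S.T_denom σ ha hb v hf.1 y _ (by simp)) (fun w hw => ?_)
  obtain ⟨y0, hy⟩ := S.Adm_exists hw
  have := key (S.α w) (S.α_ne w hw) y0 hy w (fun v hv => (S.α_ker w hw v).1 hv)
    (fun h => S.one_R (h ▸ hw))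
  exact (mem_lat0 _).1 this.p0 y

/-- `Npp` contains the multiples of the discriminant -/
lemma Npp_disc {a : G → ℂ} (ha : S.Param a) {nn : G → ℕ} (hnn : ∀ w, nn w ≤ 1)
    (s : Finset G) (hs : ∀ w, w ∈ s ↔ w ∈ S.R) {f : Y →ₗ[ℂ] K} (hf : f ∈ S.HA Y) :
    (∏ w ∈ s, S.X (S.α w) ^ Fintype.card G) • f ∈ S.Npp σ ha nn := by
  classical
  have hP : (∏ w ∈ s, S.X (S.α w) ^ Fintype.card G) ∈ S.A :=
    Subalgebra.prod_mem _ fun i _ => pow_mem (S.X_mem _) _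
  refine ⟨S.HA_smul hP hf, fun ξ hξ y0 hy w0 hw hw1 => ?_⟩
  have hR := S.stb_R hξ hw hw1
  have h1 : (∏ w ∈ s, S.X (S.α w) ^ Fintype.card G) • f ∈ S.lat hξ Y (Fintype.card G) := by
    obtain ⟨c, hc, e⟩ := prop_of_ker (S.α_ne _ hR) hξ (S.stb_alpha hξ hw hw1)
    rw [← Finset.mul_prod_erase s _ ((hs w0).2 hR), e, map_smul, smul_pow]
    refine ⟨(c ^ Fintype.card G • (∏ w ∈ s.erase w0, S.X (S.α w) ^ Fintype.card G)) • f,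
      fun y => S.A_Oo hξ (mul_mem (Subalgebra.smul_mem _ (Subalgebra.prod_mem _ fun i _ =>
        pow_mem (S.X_mem _) _) _) (hf y)), ?_⟩
    rw [smul_smul]
    congr 1
    simp only [Algebra.smul_def (A := K) (_ : ℂ)]
    ring
  have h2 : nn w0 * (St π ξ).card ≤ Fintype.card G :=
    (Nat.mul_le_mul (hnn w0) (Finset.card_le_univ (St π ξ))).trans (by simp)
  exact LL.base _ (S.lat_mono hξ (Nat.zero_le _) h1) (S.lat_mono hξ h2 h1)

end Setup

namespace Setup
variable {G V : Type*} [Group G] [AddCommGroup V] [Module ℂ V]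
    {π : Representation ℂ G V} {K : Type} [Field K] [Algebra ℂ K] (S : Setup π K)
    {Y : Type*} [AddCommGroup Y] [Module ℂ Y] (σ : Representation ℂ G Y)

lemma ev_act (v : V) (g : G) {p : K} (hp : p ∈ S.A) :
    S.ev v ⟨S.act g p, S.act_A g hp⟩ = S.ev (π g⁻¹ v) ⟨p, hp⟩ := by
  let e : S.A →ₐ[ℂ] S.A := AlgHom.codRestrict ((S.act g).comp S.A.val) S.A
    (fun x => S.act_A g x.2)
  have h : ∀ x : S.A, (S.ev v).comp e x = S.ev (π g⁻¹ v) x := by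
    rintro ⟨x, hx⟩
    induction hx using Algebra.adjoin_induction with
    | mem x hx =>
      obtain ⟨ξ, rfl⟩ := hx
      rw [S.ev_X]
      have : e ⟨S.X ξ, S.X_mem ξ⟩ = ⟨S.X (ξ ∘ₗ π g⁻¹), S.X_mem _⟩ := by
        apply Subtype.ext; exact S.act_X g ξ
      rw [AlgHom.comp_apply, this, S.ev_X]; rfl
    | algebraMap r => exact ((S.ev v).comp e).commutes r |>.trans ((S.ev _).commutes r).symm
    | add x y hx hy h1 h2 =>
      have : (⟨x + y, add_mem hx hy⟩ : S.A) = ⟨x, hx⟩ + ⟨y, hy⟩ := rfl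
      rw [this, map_add, map_add, h1, h2]
    | mul x y hx hy h1 h2 =>
      have : (⟨x * y, mul_mem hx hy⟩ : S.A) = ⟨x, hx⟩ * ⟨y, hy⟩ := rfl
      rw [this, map_mul, map_mul, h1, h2]
  exact h ⟨p, hp⟩

/-- evaluation at a point -/
def evH (v : V) : S.HA Y →ₗ[ℂ] Module.Dual ℂ Y where
  toFun F :=
    { toFun := fun y => S.ev v ⟨F.1 y, F.2 y⟩
      map_add' := fun y z => by
        rw [← map_add]; congr 1; exact Subtype.ext (map_add F.1 y z)
      map_smul' := fun c y => by
        rw [RingHom.id_apply, ← map_smul]; congr 1; exact Subtype.ext (map_smul F.1 c y) }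
  map_add' F F' := by
    ext y; exact map_add (S.ev v) ⟨F.1 y, F.2 y⟩ ⟨F'.1 y, F'.2 y⟩
  map_smul' c F := by
    ext y; exact map_smul (S.ev v) c ⟨F.1 y, F.2 y⟩

lemma evH_apply (v : V) (F : S.HA Y) (y : Y) : S.evH v F y = S.ev v ⟨F.1 y, F.2 y⟩ := rfl

variable [FiniteDimensional ℂ V]

lemma Ak_fin (k : ℕ) : (S.Ak k).FG := by
  refine Submodule.FG.pow ?_ k
  rw [← Submodule.map_top]
  exact Submodule.FG.map _ (Module.finite_def.1 inferInstance)

lemma fin_of_deg [FiniteDimensional ℂ Y] (D : ℕ) (N : Submodule ℂ (Y →ₗ[ℂ] K))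
    (h : ∀ F ∈ N, ∀ y, F y ∈ S.Ak D) : FiniteDimensional ℂ N := by
  haveI : FiniteDimensional ℂ (S.Ak D) := Module.Finite.iff_fg.2 (S.Ak_fin D)
  let j : N →ₗ[ℂ] (Fin (Module.finrank ℂ Y) → S.Ak D) :=
    LinearMap.pi fun i => 
      { toFun := fun F => ⟨F.1 (Module.finBasis ℂ Y i), h _ F.2 _⟩
        map_add' := fun F F' => rfl
        map_smul' := fun c F => rfl }
  refine FiniteDimensional.of_injective j fun F F' hF => ?_
  apply Subtype.ext
  refine (Module.finBasis ℂ Y).ext fun i => ?_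
  exact congrArg Subtype.val (congrFun hF i)

variable [Fintype G]

lemma shift_abs [FiniteDimensional ℂ Y] {a b : G → ℂ} (hb : S.Param b) {l : ℂ}
    {M : Type*} [AddCommGroup M] [Module ℂ M] [FiniteDimensional ℂ M] (τ : Representation ℂ G M)
    (φ : M →ₗ[ℂ] (Y →ₗ[ℂ] K)) (hφ : Function.Injective φ)
    (hφτ : ∀ w m, φ (τ w m) = S.Dg σ w (φ m)) (hT : ∀ v m, S.T σ a b v (φ m) = 0)
    (hl : ∀ m, ∑ w, b w • (m - τ w m) = l • m) (hG : Gen b l)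
    (ψ : M →ₗ[ℂ] Module.Dual ℂ Y) (hψ : Function.Surjective ψ) (g : G) (z : ℂ)
    (hg : ∀ m, ψ (τ g m) = z • (ψ m ∘ₗ σ g⁻¹)) :
    ∃ (τ : Representation ℂ G (Module.Dual ℂ Y)) (φ : Module.Dual ℂ Y →ₗ[ℂ] (Y →ₗ[ℂ] K)),
      Function.Injective φ ∧ (∀ w m, φ (τ w m) = S.Dg σ w (φ m)) ∧
      (∀ v m, S.T σ a b v (φ m) = 0) ∧ (∀ m, ∑ w, b w • (m - τ w m) = l • m) ∧
      (∀ m, τ g m = z • (m ∘ₗ σ g⁻¹)) := by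
  have h1 := S.claim2_dim σ hb τ φ hφ hφτ hT hl hG
  have h2 : Module.finrank ℂ M = Module.finrank ℂ (Module.Dual ℂ Y) := by
    refine le_antisymm (h1.trans_eq Subspace.dual_finrank_eq.symm) ?_
    exact LinearMap.finrank_le_finrank_of_surjective hψ
  let e := LinearEquiv.ofBijective ψ
    ⟨(LinearMap.injective_iff_surjective_of_finrank_eq_finrank h2).2 hψ, hψ⟩
  have he : ∀ m, e m = ψ m := fun m => rfl
  let τ' : Representation ℂ G (Module.Dual ℂ Y) :=
    { toFun := fun w => e.toLinearMap ∘ₗ τ w ∘ₗ e.symm.toLinearMap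
      map_one' := by ext1; simp
      map_mul' := fun x y => by ext1; simp }
  have hτ : ∀ w m, e.symm (τ' w m) = τ w (e.symm m) := fun w m => by simp [τ']
  refine ⟨τ', φ ∘ₗ e.symm.toLinearMap, hφ.comp e.symm.injective, fun w m => ?_, fun v m => hT v _,
    fun m => ?_, fun m => ?_⟩
  · simp only [LinearMap.comp_apply, LinearEquiv.coe_coe]
    rw [hτ, hφτ]
  · apply e.symm.injective
    rw [map_smul, ← hl, map_sum]
    refine Finset.sum_congr rfl fun w _ => ?_
    rw [map_smul, map_sub, hτ]
  · obtain ⟨m, rfl⟩ := e.surjective m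
    apply e.symm.injective
    rw [hτ, e.symm_apply_apply]
    apply e.injective
    rw [e.apply_symm_apply, he, he, hg]

set_option maxHeartbeats 2000000 in
theorem shift [FiniteDimensional ℂ Y] {a b : G → ℂ} (ha : S.Param a) (hb : S.Param b) {nn : G → ℕ}
    (hnn : ∀ h w, nn (h * w * h⁻¹) = nn w) (hnn1 : ∀ w, nn w ≤ 1)
    (hab : ∀ w ∈ S.R, b w = a w + nn w)
    (hcl : ∀ w ∈ S.R, nn w ≠ 0 → ∀ k : ℕ, 0 < k → k ≤ Fintype.card G → ∀ l : ℤ, a w * k ≠ l)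
    {κ : ℂ} (hκ : ∀ y, ∑ w, a w • (y - σ w⁻¹ y) = κ • y) (D : ℕ) (hG : Gen b (κ + D))
    (v0 : V) (hv0 : ∀ w ∈ S.R, S.α w v0 ≠ 0) (g : G) (ζ : ℂ) (hζ : ζ ≠ 0) (hg : π g v0 = ζ • v0) :
    ∃ (τ : Representation ℂ G (Module.Dual ℂ Y)) (φ : Module.Dual ℂ Y →ₗ[ℂ] (Y →ₗ[ℂ] K)),
      Function.Injective φ ∧ (∀ w m, φ (τ w m) = S.Dg σ w (φ m)) ∧
      (∀ v m, S.T σ a b v (φ m) = 0) ∧ (∀ m, ∑ w, b w • (m - τ w m) = (κ + D) • m) ∧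
      (∀ m, τ g m = (ζ⁻¹) ^ D • (m ∘ₗ σ g⁻¹)) := by
  classical
  have hle : S.Npp σ ha nn ≤ S.HA Y := fun F hF => hF.1
  obtain ⟨c1, c2⟩ := S.claim1 σ ha hb hκ D hG (S.Npp σ ha nn)
    (fun p hp F hF => S.Npp_A σ ha _ hp hF) (fun w F hF => S.Npp_Dg σ ha hnn w hF)
    (fun v F hF => S.Npp_T σ ha hb hnn hab hcl v hF) (hle.trans (S.HA_le))
  let ND : Submodule ℂ (Y →ₗ[ℂ] K) := S.Npp σ ha nn ⊓ (S.EuE (Y := Y)).eigenspace (D : ℂ)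
  have hND : ∀ F, F ∈ ND ↔ F ∈ S.Npp σ ha nn ∧ S.EuE F = (D : ℂ) • F := fun F => by
    simp [ND, Module.End.mem_eigenspace_iff]
  have hAk : ∀ F ∈ ND, ∀ y, F y ∈ S.Ak D := fun F hF y => by
    obtain ⟨h1, h2⟩ := (hND F).1 hF
    exact S.mem_Ak (hle h1 y) D (LinearMap.congr_fun h2 y)
  haveI := S.fin_of_deg D ND hAk
  have hDg : ∀ w, ∀ F ∈ ND, S.Dg σ w F ∈ ND := fun w F hF => by
    obtain ⟨h1, h2⟩ := (hND F).1 hF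
    refine (hND _).2 ⟨S.Npp_Dg σ ha hnn w h1, ?_⟩
    rw [S.EuE_Dg, h2, map_smul]
  have hNH : ∀ F ∈ ND, F ∈ S.HA Y := fun F hF => hle ((hND F).1 hF).1
  let ψ : ND →ₗ[ℂ] Module.Dual ℂ Y := S.evH v0 ∘ₗ Submodule.inclusion hNH
  have hψ : ∀ (F : ND) y, ψ F y = S.ev v0 ⟨F.1 y, hNH F.1 F.2 y⟩ := fun F y => rfl
  refine S.shift_abs (M := ND) σ hb (subrep (S.Dg σ) ND hDg) ND.subtype ND.injective_subtype
    (fun w m => rfl) (fun v m => c1 m.1 ((hND _).1 m.2).1 ((hND _).1 m.2).2 v) (fun m => ?_)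
    hG ψ ?_ g _ (fun m => ?_)
  · have h0 := S.sum_T σ ha hb m.1
    have hz : ∀ v, S.T σ a b v m.1 = 0 := fun v => c1 m.1 ((hND _).1 m.2).1 ((hND _).1 m.2).2 v
    have hRr : ∑ w, a w • (m.1 - Rr σ w m.1) = κ • m.1 := by
      ext y
      have := congrArg m.1 (hκ y)
      rw [map_sum, map_smul] at this
      rw [LinearMap.smul_apply, ← this, LinearMap.sum_apply]
      refine Finset.sum_congr rfl fun w _ => ?_
      rw [map_smul, map_sub]; rfl
    rw [hRr, ((hND _).1 m.2).2] at h0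
    have h1 : (0 : Y →ₗ[ℂ] K) = (D : ℂ) • m.1 + κ • m.1 - ∑ w, b w • (m.1 - S.Dg σ w m.1) := by
      rw [← h0]
      symm
      refine Finset.sum_eq_zero fun i _ => ?_
      rw [hz, smul_zero]
    apply Subtype.ext
    have h2 := sub_eq_zero.1 h1.symm
    have h3 : ((∑ w, b w • (m - subrep (S.Dg σ) ND hDg w m) : ND) : Y →ₗ[ℂ] K) =
      ∑ w, b w • (m.1 - S.Dg σ w m.1) := by
      rw [Submodule.coe_sum]; rfl
    rw [h3, ← h2]
    change _ = (κ + D) • m.1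
    module
  · intro c
    have key : ∀ F (hF : F ∈ S.Npp σ ha nn), S.evH v0 ⟨F, hle hF⟩ ∈ LinearMap.range ψ := by
      intro F hF
      have h1 := c2 hF
      have h2 : ∀ F ∈ Submodule.span ℂ {F | ∃ p ∈ S.A, ∃ F' ∈ S.Npp σ ha nn,
          S.EuE F' = (D : ℂ) • F' ∧ F = p • F'}, ∃ hF : F ∈ S.HA Y,
            S.evH v0 ⟨F, hF⟩ ∈ LinearMap.range ψ := by
        intro F hF
        induction hF using Submodule.span_induction with
        | mem F hF =>
          obtain ⟨p, hp, F', hF', hE, rfl⟩ := hF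
          refine ⟨S.HA_smul hp (hle hF'), ?_⟩
          have : S.evH v0 ⟨p • F', S.HA_smul hp (hle hF')⟩ =
              S.ev v0 ⟨p, hp⟩ • ψ ⟨F', (hND _).2 ⟨hF', hE⟩⟩ := by
            ext y
            exact map_mul (S.ev v0) ⟨p, hp⟩ ⟨F' y, hle hF' y⟩
          rw [this]
          exact Submodule.smul_mem _ _ ⟨_, rfl⟩
        | zero => exact ⟨zero_mem _, by
            have : (⟨0, zero_mem _⟩ : S.HA Y) = 0 := rfl
            rw [this, map_zero]; exact zero_mem _⟩
        | add x y _ _ hx hy =>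
          obtain ⟨hx, hx'⟩ := hx
          obtain ⟨hy, hy'⟩ := hy
          refine ⟨add_mem hx hy, ?_⟩
          have : (⟨x + y, add_mem hx hy⟩ : S.HA Y) = ⟨x, hx⟩ + ⟨y, hy⟩ := rfl
          rw [this, map_add]; exact add_mem hx' hy'
        | smul c x _ hx =>
          obtain ⟨hx, hx'⟩ := hx
          refine ⟨Submodule.smul_mem _ c hx, ?_⟩
          have : (⟨c • x, Submodule.smul_mem _ c hx⟩ : S.HA Y) = c • ⟨x, hx⟩ := rfl
          rw [this, map_smul]; exact Submodule.smul_mem _ _ hx'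
      exact (h2 F h1).2
    have hs : ∀ w, w ∈ Finset.univ.filter (· ∈ S.R) ↔ w ∈ S.R := by simp
    have hcst : cst (K := K) c ∈ S.HA Y := fun y => Subalgebra.algebraMap_mem _ _
    have hmem := S.Npp_disc σ ha hnn1 _ hs hcst
    have h3 := key _ hmem
    have hP : (∏ w ∈ Finset.univ.filter (· ∈ S.R), S.X (S.α w) ^ Fintype.card G) ∈ S.A :=
      Subalgebra.prod_mem _ fun i _ => pow_mem (S.X_mem _) _
    have hPv : S.ev v0 ⟨_, hP⟩ ≠ 0 := by
      have : (⟨_, hP⟩ : S.A) = ∏ w ∈ Finset.univ.filter (· ∈ S.R),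
          (⟨S.X (S.α w), S.X_mem _⟩ : S.A) ^ Fintype.card G := by
        apply Subtype.ext
        rw [← Subalgebra.coe_val, map_prod]
        rfl
      rw [this, map_prod]
      refine Finset.prod_ne_zero_iff.2 fun w hw => ?_
      rw [map_pow, S.ev_X]
      exact pow_ne_zero _ (hv0 w ((hs w).1 hw))
    have h4 : S.evH v0 ⟨_, hle hmem⟩ = S.ev v0 ⟨_, hP⟩ • c := by
      ext y
      refine (map_mul (S.ev v0) ⟨_, hP⟩ (algebraMap ℂ S.A (c y))).trans ?_
      rw [AlgHom.commutes]; rfl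
    rw [h4] at h3
    have := Submodule.smul_mem _ (S.ev v0 ⟨_, hP⟩)⁻¹ h3
    rw [smul_smul, inv_mul_cancel₀ hPv, one_smul] at this
    exact this
  · ext y
    rw [hψ]
    have h1 : π g⁻¹ v0 = ζ⁻¹ • v0 := by
      have := congrArg (π g⁻¹) hg
      rw [map_smul] at this
      have e : π g⁻¹ (π g v0) = v0 := by
        rw [← Module.End.mul_apply, ← map_mul, inv_mul_cancel, map_one]; rfl
      rw [e] at this
      conv_rhs => rw [this]
      rw [smul_smul, inv_mul_cancel₀ hζ, one_smul]
    have h2 := S.ev_act v0 g (hNH m.1 m.2 (σ g⁻¹ y))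
    rw [h1, S.ev_Ak v0 _ D (hAk _ m.2 _)] at h2
    exact h2

end Setup

namespace Setup
variable {G V : Type*} [Group G] [AddCommGroup V] [Module ℂ V]
    {π : Representation ℂ G V} {K : Type} [Field K] [Algebra ℂ K] (S : Setup π K)
    {Y : Type*} [AddCommGroup Y] [Module ℂ Y] (σ : Representation ℂ G Y)

/-- the commutant of a representation -/
def Com {M : Type*} [AddCommGroup M] [Module ℂ M] (ρ : Representation ℂ G M) :
    Submodule ℂ (Module.End ℂ M) where
  carrier := {s | ∀ w m, s (ρ w m) = ρ w (s m)}
  add_mem' := fun h h' w m => by simp [h w m, h' w m]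
  zero_mem' := fun w m => by simp
  smul_mem' := fun c s h w m => by simp [h w m]

lemma cst_inj {c c' : Module.Dual ℂ Y} (h : cst (K := K) c = cst c') : c = c' := by
  ext y
  exact (algebraMap ℂ K).injective (LinearMap.congr_fun h y)

lemma Dg_cst (w : G) (c : Module.Dual ℂ Y) :
    S.Dg σ w (cst c) = cst (σ.dual w c) := by
  ext y
  simp [Representation.dual_apply, Module.Dual.transpose_apply]

variable [FiniteDimensional ℂ V] [Fintype G]

omit [FiniteDimensional ℂ V] in
lemma T_cst (a : G → ℂ) (v : V) (c : Module.Dual ℂ Y) : S.T σ a a v (cst c) = 0 := by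
  ext y
  rw [T_apply, LinearMap.sub_apply, nab_apply, Bd_apply]
  simp

omit [FiniteDimensional ℂ V] in
lemma sum_dual {a : G → ℂ} {κ : ℂ} (hκ : ∀ y, ∑ w, a w • (y - σ w⁻¹ y) = κ • y)
    (c : Module.Dual ℂ Y) : ∑ w, a w • (c - σ.dual w c) = κ • c := by
  ext y
  have := congrArg c (hκ y)
  rw [map_sum, map_smul] at this
  rw [LinearMap.smul_apply, ← this, LinearMap.sum_apply]
  refine Finset.sum_congr rfl fun w _ => ?_
  simp [Representation.dual_apply, Module.Dual.transpose_apply]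

lemma surj_of_inj {P M : Type*} [AddCommGroup P] [Module ℂ P] [AddCommGroup M] [Module ℂ M]
    [FiniteDimensional ℂ P] [FiniteDimensional ℂ M] (j : P →ₗ[ℂ] M) (hj : Function.Injective j)
    (h : Module.finrank ℂ P = Module.finrank ℂ M) : Function.Surjective j :=
  (LinearMap.injective_iff_surjective_of_finrank_eq_finrank h).1 hj

/-- uniqueness of the lattice of constants -/
lemma cst_max [FiniteDimensional ℂ Y] {a : G → ℂ} (ha : S.Param a) {κ : ℂ} (hG : Gen a κ)
    (N : Submodule ℂ (Y →ₗ[ℂ] K)) [FiniteDimensional ℂ N]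
    (hN : ∀ w, ∀ F ∈ N, S.Dg σ w F ∈ N) (hT : ∀ v, ∀ F ∈ N, S.T σ a a v F = 0)
    (hs : ∀ F ∈ N, ∑ w, a w • (F - S.Dg σ w F) = κ • F) (hc : ∀ c, cst c ∈ N) :
    ∀ F ∈ N, ∃ c, F = cst c := by
  have h1 := S.claim2_dim (M := N) σ ha (subrep (S.Dg σ) N hN) N.subtype N.injective_subtype
    (fun w m => rfl) (fun v m => hT v m.1 m.2) (fun m => by
      apply Subtype.ext
      have h3 : ((∑ w, a w • (m - subrep (S.Dg σ) N hN w m) : N) : Y →ₗ[ℂ] K) =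
        ∑ w, a w • (m.1 - S.Dg σ w m.1) := by
        rw [Submodule.coe_sum]; rfl
      rw [h3]
      exact hs m.1 m.2) hG
  let j : Module.Dual ℂ Y →ₗ[ℂ] N :=
    { toFun := fun c => ⟨cst c, hc c⟩
      map_add' := fun c c' => by apply Subtype.ext; ext y; simp
      map_smul' := fun r c => by apply Subtype.ext; ext y; simp [Algebra.smul_def] }
  have hj : Function.Injective j := fun c c' h => cst_inj (congrArg Subtype.val h)
  have h2 : Module.finrank ℂ (Module.Dual ℂ Y) = Module.finrank ℂ N := by
    refine le_antisymm (LinearMap.finrank_le_finrank_of_injective hj) ?_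
    rw [Subspace.dual_finrank_eq]
    exact h1
  have h3 := surj_of_inj (M := N) j hj h2
  intro F hF
  obtain ⟨c, hc⟩ := h3 ⟨F, hF⟩
  exact ⟨c, (congrArg Subtype.val hc).symm⟩

omit [FiniteDimensional ℂ V] in
lemma comm_Bd (F : (Y →ₗ[ℂ] K) →ₗ[K] (Y →ₗ[ℂ] K)) (b : G → ℂ) (v : V)
    (hD : ∀ w f, F (S.Dg σ w f) = S.Dg σ w (F f)) (f : Y →ₗ[ℂ] K) :
    F (S.Bd σ b v f) = S.Bd σ b v (F f) := by
  have hC : ∀ (c : ℂ) (f : Y →ₗ[ℂ] K), F (c • f) = c • F f := fun c f => by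
    rw [← algebraMap_smul K c f, map_smul, algebraMap_smul]
  rw [Bd_apply', Bd_apply', map_sum]
  refine Finset.sum_congr rfl fun w _ => ?_
  rw [hC, map_smul, map_sub, hD]

lemma comm_key [FiniteDimensional ℂ Y] {a b : G → ℂ} (ha : S.Param a)
    {κ : ℂ} (hκ : ∀ y, ∑ w, a w • (y - σ w⁻¹ y) = κ • y) (hG : Gen a κ)
    (F : (Y →ₗ[ℂ] K) →ₗ[K] (Y →ₗ[ℂ] K))
    (P : Set (Y →ₗ[ℂ] K)) (hP : Submodule.span K P = ⊤)
    (hPD : ∀ f ∈ P, ∀ w, F (S.Dg σ w f) = S.Dg σ w (F f))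
    (hPT : ∀ f ∈ P, ∀ v, S.T σ a b v f = 0) (hPT' : ∀ f ∈ P, ∀ v, S.T σ a b v (F f) = 0) :
    (∀ w f, F (S.Dg σ w f) = S.Dg σ w (F f)) ∧ ∀ c, ∃ c', F (cst c) = cst c' := by
  have hC : ∀ (c : ℂ) (f : Y →ₗ[ℂ] K), F (c • f) = c • F f := fun c f => by
    rw [← algebraMap_smul K c f, map_smul, algebraMap_smul]
  have hD : ∀ w f, F (S.Dg σ w f) = S.Dg σ w (F f) := by
    intro w f
    have hf : f ∈ Submodule.span K P := hP ▸ Submodule.mem_top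
    induction hf using Submodule.span_induction with
    | mem f hf => exact hPD f hf w
    | zero => simp
    | add x y _ _ hx hy => rw [map_add, map_add, map_add, map_add, hx, hy]
    | smul c x _ hx => rw [Dg_smulK, map_smul, map_smul, Dg_smulK, hx]
  have hN : ∀ v f, F (S.nab σ a v f) = S.nab σ a v (F f) := by
    intro v f
    have hf : f ∈ Submodule.span K P := hP ▸ Submodule.mem_top
    induction hf using Submodule.span_induction with
    | mem f hf =>
      have e1 := sub_eq_zero.1 ((S.T_apply σ a b v f).symm.trans (hPT f hf v))
      have e2 := sub_eq_zero.1 ((S.T_apply σ a b v (F f)).symm.trans (hPT' f hf v))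
      rw [e1, e2, S.comm_Bd σ F b v hD]
    | zero => simp
    | add x y _ _ hx hy => rw [map_add, map_add, map_add, map_add, hx, hy]
    | smul c x _ hx => rw [nab_smulK, map_add, map_smul, map_smul, map_smul, nab_smulK, hx]
  refine ⟨hD, ?_⟩
  let ι : Module.Dual ℂ Y →ₗ[ℂ] (Y →ₗ[ℂ] K) :=
    { toFun := fun c => cst c
      map_add' := fun c c' => by ext y; simp
      map_smul' := fun r c => by ext y; simp [Algebra.smul_def] }
  let ι' : Module.Dual ℂ Y →ₗ[ℂ] (Y →ₗ[ℂ] K) :=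
    { toFun := fun c => F (cst c)
      map_add' := fun c c' => by
        rw [← map_add]; congr 1; ext y; simp
      map_smul' := fun r c => by
        rw [RingHom.id_apply, ← hC]; congr 1; ext y; simp [Algebra.smul_def] }
  let N : Submodule ℂ (Y →ₗ[ℂ] K) := LinearMap.range ι ⊔ LinearMap.range ι'
  have hmem : ∀ c, cst c ∈ N := fun c => Submodule.mem_sup_left ⟨c, rfl⟩
  have hmem' : ∀ c, F (cst c) ∈ N := fun c => Submodule.mem_sup_right ⟨c, rfl⟩
  have hNr : ∀ f ∈ N, ∃ c c', f = cst c + F (cst c') := by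
    intro f hf
    obtain ⟨_, ⟨c, rfl⟩, _, ⟨c', rfl⟩, rfl⟩ := Submodule.mem_sup.1 hf
    exact ⟨c, c', rfl⟩
  haveI : FiniteDimensional ℂ N := by
    refine Module.Finite.iff_fg.2 (Submodule.FG.sup ?_ ?_)
    · rw [← Submodule.map_top]
      exact Submodule.FG.map _ (Module.finite_def.1 inferInstance)
    · rw [← Submodule.map_top]
      exact Submodule.FG.map _ (Module.finite_def.1 inferInstance)
  have hsc : ∀ c : Module.Dual ℂ Y, ∑ w, a w • (cst (K := K) c - S.Dg σ w (cst c)) = κ • cst c := by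
    intro c
    have := congrArg ι (sum_dual σ hκ c)
    rw [map_smul, map_sum] at this
    refine Eq.trans ?_ this
    refine Finset.sum_congr rfl fun w _ => ?_
    rw [map_smul, map_sub, S.Dg_cst]; rfl
  intro c
  refine S.cst_max σ ha hG N ?_ ?_ ?_ hmem _ (hmem' c)
  · intro w f hf
    obtain ⟨c, c', rfl⟩ := hNr f hf
    rw [map_add, ← hD, S.Dg_cst, S.Dg_cst]
    exact add_mem (hmem _) (hmem' _)
  · intro v f hf
    obtain ⟨c, c', rfl⟩ := hNr f hf
    have : S.T σ a a v (F (cst c')) = F (S.T σ a a v (cst c')) := by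
      rw [T_apply, T_apply, map_sub, hN, S.comm_Bd σ F a v hD]
    rw [map_add, this, S.T_cst, S.T_cst, map_zero, add_zero]
  · intro f hf
    obtain ⟨c, c', rfl⟩ := hNr f hf
    have h2 : ∑ w, a w • (F (cst c') - S.Dg σ w (F (cst c'))) = κ • F (cst c') := by
      have := congrArg F (hsc c')
      rw [hC, map_sum] at this
      refine Eq.trans ?_ this
      refine Finset.sum_congr rfl fun w _ => ?_
      rw [hC, map_sub, hD]
    rw [smul_add, ← h2, ← hsc, ← Finset.sum_add_distrib]
    refine Finset.sum_congr rfl fun w _ => ?_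
    rw [map_add, ← smul_add]
    congr 1
    abel

theorem Com_le [FiniteDimensional ℂ Y] {a b : G → ℂ} (ha : S.Param a) (hb : S.Param b)
    {κ l : ℂ} (hκ : ∀ y, ∑ w, a w • (y - σ w⁻¹ y) = κ • y) (hG : Gen a κ)
    {M : Type*} [AddCommGroup M] [Module ℂ M] [FiniteDimensional ℂ M] (τ : Representation ℂ G M)
    (φ : M →ₗ[ℂ] (Y →ₗ[ℂ] K)) (hφ : Function.Injective φ)
    (hφτ : ∀ w m, φ (τ w m) = S.Dg σ w (φ m)) (hT : ∀ v m, S.T σ a b v (φ m) = 0)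
    (hl : ∀ m, ∑ w, b w • (m - τ w m) = l • m) (hG' : Gen b l)
    (hdim : Module.finrank ℂ M = Module.finrank ℂ Y) :
    Module.finrank ℂ (Com τ) ≤ Module.finrank ℂ (Com σ.dual) := by
  have hli := S.claim2 σ hb τ φ hφ hφτ hT hl hG' _ (Module.finBasis ℂ M).linearIndependent
  let B : Module.Basis (Fin (Module.finrank ℂ M)) K (Y →ₗ[ℂ] K) :=
    basisOfLinearIndependentOfCardEqFinrank' _ hli (by
      rw [Module.finrank_linearMap, Module.finrank_self, mul_one, Fintype.card_fin, hdim])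
  have hB : ∀ i, B i = φ (Module.finBasis ℂ M i) := fun i => by
    simp [B]
  let F : Module.End ℂ M → ((Y →ₗ[ℂ] K) →ₗ[K] (Y →ₗ[ℂ] K)) := fun s =>
    B.constr K (fun i => φ (s (Module.finBasis ℂ M i)))
  have hC : ∀ s (c : ℂ) (f : Y →ₗ[ℂ] K), F s (c • f) = c • F s f := fun s c f => by
    rw [← algebraMap_smul K c f, map_smul, algebraMap_smul]
  have hF : ∀ s m, F s (φ m) = φ (s m) := by
    intro s m
    conv_lhs => rw [← (Module.finBasis ℂ M).sum_repr m]
    conv_rhs => rw [← (Module.finBasis ℂ M).sum_repr m]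
    rw [map_sum, map_sum, map_sum, map_sum]
    refine Finset.sum_congr rfl fun i _ => ?_
    rw [φ.map_smul, s.map_smul, φ.map_smul, hC, ← hB, B.constr_basis]
  have hadd : ∀ s t f, F (s + t) f = F s f + F t f := by
    intro s t f
    have : F (s + t) = F s + F t := B.ext fun i => by
      change _ = F s (B i) + F t (B i)
      rw [hB, hF, hF, hF, LinearMap.add_apply, map_add]
    rw [this]; rfl
  have hsm : ∀ (r : ℂ) s f, F (r • s) f = r • F s f := by
    intro r s f
    have : F (r • s) = (algebraMap ℂ K r) • F s := B.ext fun i => by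
      change _ = (algebraMap ℂ K r) • F s (B i)
      rw [hB, hF, hF, LinearMap.smul_apply, φ.map_smul, algebraMap_smul]
    rw [this]
    exact algebraMap_smul K r (F s f)
  have hcom := fun (s : Com τ) => S.comm_key σ (b := b) ha hκ hG (F s.1) (Set.range B) B.span_eq
    (by
      rintro _ ⟨i, rfl⟩ w
      rw [hB, ← hφτ, hF, hF, s.2 w, hφτ])
    (by rintro _ ⟨i, rfl⟩ v; rw [hB, hT])
    (by rintro _ ⟨i, rfl⟩ v; rw [hB, hF, hT])
  choose f hf using fun s => (hcom s).2
  have hcadd : ∀ c c' : Module.Dual ℂ Y, cst (K := K) (c + c') = cst c + cst c' := fun c c' => by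
    ext y; simp
  have hcsm : ∀ (r : ℂ) (c : Module.Dual ℂ Y), cst (K := K) (r • c) = r • cst c := fun c c' => by
    ext y; simp [Algebra.smul_def]
  let L : Com τ →ₗ[ℂ] Com σ.dual :=
    { toFun := fun s => ⟨
        { toFun := f s
          map_add' := fun c c' => cst_inj (K := K) (by
            rw [← hf, hcadd, hcadd, map_add, hf, hf])
          map_smul' := fun r c => cst_inj (K := K) (by
            rw [RingHom.id_apply, ← hf, hcsm, hcsm, hC, hf]) },
        fun w c => cst_inj (K := K) (by
          change cst (f s _) = cst (σ.dual w (f s c))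
          rw [← hf, ← S.Dg_cst, ← S.Dg_cst, (hcom s).1, hf])⟩
      map_add' := fun s t => by
        apply Subtype.ext; ext1 c
        refine cst_inj (K := K) ?_
        change cst (f (s + t) c) = cst (f s c + f t c)
        rw [← hf, hcadd, ← hf, ← hf, ← hadd]; rfl
      map_smul' := fun r s => by
        apply Subtype.ext; ext1 c
        refine cst_inj (K := K) ?_
        change cst (f (r • s) c) = cst (r • f s c)
        rw [← hf, hcsm, ← hf, ← hsm]; rfl }
  refine LinearMap.finrank_le_finrank_of_injective (f := L) ?_
  rw [injective_iff_map_eq_zero]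
  intro s hs
  have h1 : ∀ c, F s.1 (cst c) = 0 := fun c => by
    rw [hf]
    have : f s c = (L s).1 c := rfl
    rw [this, hs]; ext y; simp
  apply Subtype.ext; ext1 m
  apply hφ
  rw [← hF, expand (φ m), map_sum]
  simp [h1]

end Setup

namespace Setup
variable {G : Type*} [Group G]

/-- no nontrivial stable subspace -/
def Irr {M : Type*} [AddCommGroup M] [Module ℂ M] (ρ : Representation ℂ G M) : Prop :=
  ∀ U : Submodule ℂ M, (∀ g, ∀ x ∈ U, ρ g x ∈ U) → U = ⊥ ∨ U = ⊤

lemma irrChar_of {M : Type*} [AddCommGroup M] [Module ℂ M] [FiniteDimensional ℂ M] [Nontrivial M]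
    (ρ : Representation ℂ G M) (h : Irr ρ) : IsIrredChar G ρ.character := by
  let e : M ≃ₗ[ℂ] (Fin (Module.finrank ℂ M) → ℂ) := (Module.finBasis ℂ M).equivFun
  let ρ' : Representation ℂ G (Fin (Module.finrank ℂ M) → ℂ) :=
    { toFun := fun w => e.toLinearMap ∘ₗ ρ w ∘ₗ e.symm.toLinearMap
      map_one' := LinearMap.ext fun x => by simp
      map_mul' := fun x y => LinearMap.ext fun x => by simp }
  refine ⟨_, ρ', Module.finrank_pos, fun U hU => ?_, fun g => ?_⟩
  · rcases h (U.map e.symm.toLinearMap) (by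
      rintro g _ ⟨u, hu, rfl⟩
      refine ⟨ρ' g u, hU g ⟨u, hu, rfl⟩, by simp [ρ']⟩) with h0 | h0
    · left
      exact (Submodule.map_injective_of_injective (f := e.symm.toLinearMap) e.symm.injective)
        (h0.trans (Submodule.map_bot _).symm)
    · right
      rw [eq_top_iff]
      intro x _
      have : e.symm x ∈ U.map e.symm.toLinearMap := h0 ▸ Submodule.mem_top
      obtain ⟨u, hu, he⟩ := this
      have := e.symm.injective he
      exact this ▸ hu
  · exact (LinearMap.trace_conj' (ρ g) e).symm

lemma exists_irr {M : Type*} [AddCommGroup M] [Module ℂ M] [FiniteDimensional ℂ M] [Nontrivial M]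
    (ρ : Representation ℂ G M) : ∃ (U : Submodule ℂ M) (hU : ∀ g, ∀ x ∈ U, ρ g x ∈ U),
      Nontrivial U ∧ Irr (subrep ρ U hU) := by
  classical
  have hex : ∃ n, ∃ U : Submodule ℂ M, (∀ g, ∀ x ∈ U, ρ g x ∈ U) ∧ U ≠ ⊥ ∧
      Module.finrank ℂ U = n := ⟨_, ⊤, fun _ _ _ => Submodule.mem_top, top_ne_bot, rfl⟩
  obtain ⟨U, hU, hU0, hn⟩ := Nat.find_spec hex
  refine ⟨U, hU, (Submodule.nontrivial_iff_ne_bot).2 hU0, fun U' hU' => ?_⟩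
  by_cases h0 : U' = ⊥
  · exact Or.inl h0
  right
  have hmap : U'.map U.subtype ≠ ⊥ := fun h =>
    h0 ((Submodule.map_injective_of_injective U.injective_subtype) (h.trans (Submodule.map_bot _).symm))
  have h1 := Nat.find_min' hex ⟨U'.map U.subtype, by
    rintro g _ ⟨u, hu, rfl⟩
    exact ⟨subrep ρ U hU g u, hU' g u hu, rfl⟩, hmap, rfl⟩
  rw [← hn, (Submodule.equivMapOfInjective U.subtype U.injective_subtype U').symm.finrank_eq] at h1
  exact Submodule.eq_top_of_finrank_eq (le_antisymm (Submodule.finrank_le U') h1)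

lemma char_subrep_add {M : Type*} [AddCommGroup M] [Module ℂ M] [FiniteDimensional ℂ M]
    (ρ : Representation ℂ G M) (U U' : Submodule ℂ M) (hU : ∀ g, ∀ x ∈ U, ρ g x ∈ U)
    (hU' : ∀ g, ∀ x ∈ U', ρ g x ∈ U') (hc : IsCompl U U') (g : G) :
    ρ.character g = (subrep ρ U hU).character g + (subrep ρ U' hU').character g := by
  let e := Submodule.prodEquivOfIsCompl U U' hc
  unfold Representation.character
  rw [← LinearMap.trace_prodMap', ← LinearMap.trace_conj' _ e]
  congr 1
  ext x
  obtain ⟨y, rfl⟩ := e.surjective x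
  simp [e, LinearEquiv.conj_apply, subrep]

lemma sum_trace [Fintype G] {M : Type*} [AddCommGroup M] [Module ℂ M] [FiniteDimensional ℂ M]
    (ρ : Representation ℂ G M) {b : G → ℂ} {l : ℂ}
    (hl : ∀ m, ∑ w, b w • (m - ρ w m) = l • m) :
    ∑ w, b w * (ρ.character 1 - ρ.character w) = l * ρ.character 1 := by
  have h : ∑ w, b w • ((1 : Module.End ℂ M) - ρ w) = l • 1 := by
    ext m; simpa [LinearMap.sum_apply] using hl m
  have := congrArg (LinearMap.trace ℂ M) h
  simpa [Representation.character] using this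

lemma exists_compl [Finite G] {M : Type*} [AddCommGroup M] [Module ℂ M] (ρ : Representation ℂ G M)
    (U : Submodule ℂ M) (hU : ∀ g, ∀ x ∈ U, ρ g x ∈ U) :
    ∃ U' : Submodule ℂ M, (∀ g, ∀ x ∈ U', ρ g x ∈ U') ∧ IsCompl U U' := by
  haveI : NeZero (Nat.card G : ℂ) := ⟨by simp [Nat.card_pos.ne']⟩
  have hs : Representation.IsSemisimpleRepresentation ρ := inferInstance
  obtain ⟨Q, hQ⟩ := hs.exists_isCompl ⟨U, hU⟩
  refine ⟨Q.toSubmodule, fun g x hx => Q.apply_mem_toSubmodule g hx, ?_⟩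
  constructor
  · rw [disjoint_iff]
    exact congrArg Subrepresentation.toSubmodule (disjoint_iff.1 hQ.1)
  · rw [codisjoint_iff]
    exact congrArg Subrepresentation.toSubmodule (codisjoint_iff.1 hQ.2)

theorem decomp [Fintype G] (S : Finset (G → ℂ)) (hS : ∀ χ, χ ∈ S ↔ IsIrredChar G χ) (b : G → ℂ) (l : ℂ)
    (N : ℕ) : ∀ (M : Type*) [AddCommGroup M] [Module ℂ M] [FiniteDimensional ℂ M]
    (ρ : Representation ℂ G M) (_ : ∀ m, ∑ w, b w • (m - ρ w m) = l • m)
    (_ : Module.finrank ℂ M ≤ N),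
    ∃ n : (G → ℂ) → ℕ, (∀ g, ρ.character g = ∑ χ ∈ S, n χ * χ g) ∧
      ∀ χ ∈ S, n χ ≠ 0 → ∑ w, b w * (χ 1 - χ w) = l * χ 1 := by
  classical
  induction N with
  | zero =>
    intro M _ _ _ ρ hl hN
    haveI := Module.finrank_zero_iff.1 (Nat.le_zero.1 hN)
    refine ⟨0, fun g => ?_, fun χ _ h => (h rfl).elim⟩
    have : ρ g = 0 := by ext m; exact Subsingleton.elim _ _
    simp [Representation.character, this]
  | succ N ih =>
    intro M _ _ _ ρ hl hN
    rcases subsingleton_or_nontrivial M with hM | hM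
    · refine ⟨0, fun g => ?_, fun χ _ h => (h rfl).elim⟩
      have : ρ g = 0 := by ext m; exact Subsingleton.elim _ _
      simp [Representation.character, this]
    obtain ⟨U, hU, hUn, hUi⟩ := exists_irr ρ
    obtain ⟨U', hU', hc⟩ := exists_compl ρ U hU
    have hrel : ∀ (U : Submodule ℂ M) (hU : ∀ g, ∀ x ∈ U, ρ g x ∈ U) (m : U),
        ∑ w, b w • (m - subrep ρ U hU w m) = l • m := fun U hU m => by
      apply Subtype.ext
      rw [Submodule.coe_sum]
      exact hl m.1
    have hd : Module.finrank ℂ U' ≤ N := by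
      have h1 := Submodule.finrank_add_eq_of_isCompl hc
      have h2 : 0 < Module.finrank ℂ U := Module.finrank_pos
      omega
    obtain ⟨n, hn, hn'⟩ := ih U' (subrep ρ U' hU') (hrel U' hU') hd
    let χ0 := (subrep ρ U hU).character
    have hχ0 : χ0 ∈ S := (hS _).2 (irrChar_of _ hUi)
    refine ⟨fun χ => n χ + if χ = χ0 then 1 else 0, fun g => ?_, fun χ hχ h => ?_⟩
    · rw [char_subrep_add ρ U U' hU hU' hc, hn]
      simp only [Nat.cast_add, add_mul, Finset.sum_add_distrib]
      rw [add_comm]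
      congr 1
      simp [hχ0, χ0]
    · by_cases h0 : χ = χ0
      · rw [h0]
        exact sum_trace _ (hrel U hU)
      · exact hn' χ hχ (by simpa [h0] using h)

lemma Irr.isIrr {M : Type*} [AddCommGroup M] [Module ℂ M] [Nontrivial M]
    {ρ : Representation ℂ G M} (h : Irr ρ) : ρ.IsIrreducible where
  exists_pair_ne := ⟨⊥, ⊤, fun h => bot_ne_top (congrArg Subrepresentation.toSubmodule h)⟩
  eq_bot_or_eq_top := fun U => by
    rcases h U.toSubmodule (fun g x hx => U.apply_mem_toSubmodule g hx) with h | h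
    · exact Or.inl (Subrepresentation.toSubmodule_injective h)
    · exact Or.inr (Subrepresentation.toSubmodule_injective h)

lemma irrChar_rep {χ : G → ℂ} (h : IsIrredChar G χ) : ∃ (n : ℕ) (ρ : Representation ℂ G (Fin n → ℂ)),
    0 < n ∧ Irr ρ ∧ χ = ρ.character := by
  obtain ⟨n, ρ, hn, hi, hc⟩ := h
  exact ⟨n, ρ, hn, fun U hU => hi U (fun g => by rintro _ ⟨x, hx, rfl⟩; exact hU g x hx), funext hc⟩

lemma irrChar_one {χ : G → ℂ} (h : IsIrredChar G χ) : ∃ n : ℕ, 0 < n ∧ χ 1 = n := by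
  obtain ⟨n, ρ, hn, hi, rfl⟩ := irrChar_rep h
  exact ⟨n, hn, by simp⟩

open Classical in
lemma orth [Fintype G] {χ χ' : G → ℂ} (h : IsIrredChar G χ) (h' : IsIrredChar G χ') :
    (Nat.card G : ℂ)⁻¹ * ∑ g, χ g * χ' g⁻¹ = if χ = χ' then 1 else 0 := by
  have hcard : (Nat.card G : ℂ) ≠ 0 := by simp [Nat.card_pos.ne']
  letI : Invertible (Nat.card G : ℂ) := invertibleOfNonzero hcard
  by_cases hχ : χ = χ'
  · subst hχ
    obtain ⟨n, ρ, hn, hi, rfl⟩ := irrChar_rep h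
    haveI : Nonempty (Fin n) := ⟨⟨0, hn⟩⟩
    haveI := hi.isIrr
    rw [Representation.char_orthonormal ρ ρ, if_pos rfl, if_pos ⟨Representation.Equiv.refl ρ⟩]
  · obtain ⟨n, ρ, hn, hi, rfl⟩ := irrChar_rep h
    obtain ⟨n', ρ', hn', hi', rfl⟩ := irrChar_rep h'
    haveI : Nonempty (Fin n) := ⟨⟨0, hn⟩⟩
    haveI : Nonempty (Fin n') := ⟨⟨0, hn'⟩⟩
    haveI := hi.isIrr
    haveI := hi'.isIrr
    rw [Representation.char_orthonormal ρ ρ', if_neg hχ, if_neg]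
    rintro ⟨e⟩
    exact hχ (Representation.char_iso e).symm

lemma com_formula [Fintype G] {M : Type*} [AddCommGroup M] [Module ℂ M] [FiniteDimensional ℂ M]
    (ρ : Representation ℂ G M) : (Module.finrank ℂ (Com ρ) : ℂ) =
      (Nat.card G : ℂ)⁻¹ * ∑ g, ρ.character g * ρ.character g⁻¹ := by
  have hcard : (Nat.card G : ℂ) ≠ 0 := by simp [Nat.card_pos.ne']
  letI : Invertible (Nat.card G : ℂ) := invertibleOfNonzero hcard
  rw [Representation.card_inv_mul_sum_char_mul_char_eq_finrank]
  congr 1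
  refine LinearEquiv.finrank_eq (LinearEquiv.symm
    { toFun := fun f => ⟨f.toLinearMap, fun w m => Representation.IntertwiningMap.isIntertwining _ _ f w m⟩
      map_add' := fun _ _ => rfl
      map_smul' := fun _ _ => rfl
      invFun := fun s => ⟨s.1, fun g => LinearMap.ext (s.2 g)⟩
      left_inv := fun _ => rfl
      right_inv := fun _ => rfl })

lemma norm_sum [Fintype G] (S : Finset (G → ℂ)) (hS : ∀ χ ∈ S, IsIrredChar G χ) (n : (G → ℂ) → ℕ) :
    (Nat.card G : ℂ)⁻¹ * ∑ g, (∑ χ ∈ S, n χ * χ g) * (∑ χ ∈ S, n χ * χ g⁻¹) =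
      ∑ χ ∈ S, (n χ : ℂ) ^ 2 := by
  classical
  have : ∀ g, (∑ χ ∈ S, n χ * χ g) * (∑ χ ∈ S, n χ * χ g⁻¹) =
      ∑ χ ∈ S, ∑ χ' ∈ S, (n χ : ℂ) * n χ' * (χ g * χ' g⁻¹) := fun g => by
    rw [Finset.sum_mul_sum]
    refine Finset.sum_congr rfl fun χ _ => Finset.sum_congr rfl fun χ' _ => by ring
  simp_rw [this]
  rw [Finset.sum_comm, Finset.mul_sum]
  refine Finset.sum_congr rfl fun χ hχ => ?_
  rw [Finset.sum_comm, Finset.mul_sum]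
  have h2 : ∀ χ' ∈ S, (Nat.card G : ℂ)⁻¹ * ∑ g, (n χ : ℂ) * n χ' * (χ g * χ' g⁻¹) =
      if χ = χ' then (n χ : ℂ) ^ 2 else 0 := fun χ' hχ' => by
    rw [← Finset.mul_sum, mul_left_comm, orth (hS χ hχ) (hS χ' hχ')]
    split_ifs with h
    · subst h; ring
    · ring
  rw [Finset.sum_congr rfl h2]
  simp [hχ]

/-- rigidity -/
theorem rigid [Fintype G] (S : Finset (G → ℂ)) (hS : ∀ χ, χ ∈ S ↔ IsIrredChar G χ)
    (s : Finset (G → ℂ)) (hs : s ⊆ S) (deg : (G → ℂ) → ℕ) (hdeg : ∀ χ ∈ S, χ 1 = deg χ)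
    {b : G → ℂ} {l : ℂ} (hgen : ∀ χ ∈ S, ∑ w, b w * (χ 1 - χ w) = l * χ 1 → χ ∈ s)
    {M : Type*} [AddCommGroup M] [Module ℂ M] [FiniteDimensional ℂ M]
    (ρ : Representation ℂ G M) (hl : ∀ m, ∑ w, b w • (m - ρ w m) = l • m)
    (hd : Module.finrank ℂ M = ∑ χ ∈ s, deg χ ^ 2)
    (hc : Module.finrank ℂ (Com ρ) ≤ ∑ χ ∈ s, deg χ ^ 2) (g : G) :
    ρ.character g = ∑ χ ∈ s, deg χ * χ g := by
  classical
  obtain ⟨n, hn, hn'⟩ := decomp S hS b l _ M ρ hl le_rfl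
  have h0 : ∀ χ ∈ S, χ ∉ s → n χ = 0 := fun χ hχ h => by
    by_contra h1
    exact h (hgen χ hχ (hn' χ hχ h1))
  have h1 : ∀ g, ρ.character g = ∑ χ ∈ s, n χ * χ g := fun g => by
    rw [hn]
    symm
    exact Finset.sum_subset hs fun χ hχ h => by rw [h0 χ hχ h]; simp
  have h2 : (Module.finrank ℂ (Com ρ) : ℂ) = ∑ χ ∈ s, (n χ : ℂ) ^ 2 := by
    rw [com_formula, ← norm_sum s (fun χ hχ => (hS χ).1 (hs hχ))]
    simp_rw [h1]
  have h3 : Module.finrank ℂ (Com ρ) = ∑ χ ∈ s, n χ ^ 2 := by exact_mod_cast h2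
  have h4 : (Module.finrank ℂ M : ℂ) = ∑ χ ∈ s, n χ * deg χ := by
    rw [← Representation.char_one ρ, h1]
    push_cast
    refine Finset.sum_congr rfl fun χ hχ => by rw [hdeg χ (hs hχ)]
  have h5 : Module.finrank ℂ M = ∑ χ ∈ s, n χ * deg χ := by exact_mod_cast h4
  have h6 : ∑ χ ∈ s, ((n χ : ℤ) - deg χ) ^ 2 ≤ 0 := by
    have e : ∑ χ ∈ s, ((n χ : ℤ) - deg χ) ^ 2 = ∑ χ ∈ s, (n χ : ℤ) ^ 2 -
        2 * (∑ χ ∈ s, (n χ : ℤ) * deg χ) + ∑ χ ∈ s, (deg χ : ℤ) ^ 2 := by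
      rw [Finset.mul_sum, ← Finset.sum_sub_distrib, ← Finset.sum_add_distrib]
      exact Finset.sum_congr rfl fun χ _ => by ring
    have e1 : (∑ χ ∈ s, (n χ : ℤ) ^ 2) ≤ ∑ χ ∈ s, (deg χ : ℤ) ^ 2 := by
      exact_mod_cast h3 ▸ hc
    have e2 : (∑ χ ∈ s, (n χ : ℤ) * deg χ) = ∑ χ ∈ s, (deg χ : ℤ) ^ 2 := by
      exact_mod_cast h5.symm.trans hd
    linarith
  rw [h1]
  refine Finset.sum_congr rfl fun χ hχ => ?_
  have h7 := (Finset.sum_eq_zero_iff_of_nonneg (fun χ _ => sq_nonneg _)).1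
    (le_antisymm h6 (Finset.sum_nonneg fun χ _ => sq_nonneg _)) χ hχ
  have h8 : (n χ : ℤ) = deg χ := by
    have := pow_eq_zero_iff (two_ne_zero) |>.1 h7
    linarith
  have h9 : n χ = deg χ := by exact_mod_cast h8
  rw [h9]

lemma schur [Fintype G] {n : ℕ} (hn : 0 < n) (ρ : Representation ℂ G (Fin n → ℂ)) (h : Irr ρ)
    {a : G → ℂ} (ha : ∀ h w, a (h * w * h⁻¹) = a w) {κ : ℂ}
    (hκ : ∑ w, a w * (ρ.character 1 - ρ.character w) = κ * ρ.character 1) :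
    ∀ y, ∑ w, a w • (y - ρ w y) = κ • y := by
  haveI : Nonempty (Fin n) := ⟨⟨0, hn⟩⟩
  let B : Module.End ℂ (Fin n → ℂ) := ∑ w, a w • (1 - ρ w)
  have hB : ∀ y, B y = ∑ w, a w • (y - ρ w y) := fun y => by simp [B, LinearMap.sum_apply]
  have hcomm : ∀ g y, B (ρ g y) = ρ g (B y) := by
    intro g y
    rw [hB, hB, map_sum]
    rw [← Equiv.sum_comp (MulAut.conj g).toEquiv]
    refine Finset.sum_congr rfl fun w _ => ?_
    have : (MulAut.conj g).toEquiv w = g * w * g⁻¹ := rfl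
    rw [this, ha, map_smul, map_sub, ← Module.End.mul_apply, ← map_mul, ← Module.End.mul_apply,
      ← map_mul]
    congr 4
    group
  obtain ⟨c, hc⟩ := Module.End.exists_eigenvalue B
  have htop : B.eigenspace c = ⊤ := by
    rcases h (B.eigenspace c) (fun g x hx => by
      rw [Module.End.mem_eigenspace_iff] at hx ⊢
      rw [hcomm, hx, map_smul]) with h | h
    · exact (hc h).elim
    · exact h
  have hcy : ∀ y, ∑ w, a w • (y - ρ w y) = c • y := fun y => by
    rw [← hB]
    exact Module.End.mem_eigenspace_iff.1 (htop ▸ Submodule.mem_top)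
  have h1 := sum_trace ρ hcy
  rw [hκ] at h1
  have h2 : ρ.character 1 ≠ 0 := by simp [hn.ne']
  rw [mul_right_cancel₀ h2 h1]
  exact hcy

/-- realizability of a sum of characters in the class `s` -/
def Real' [Fintype G] (s : Finset (G → ℂ)) (f : G → ℂ) : Prop :=
  ∃ (Y : Type) (_ : AddCommGroup Y) (_ : Module ℂ Y) (_ : FiniteDimensional ℂ Y)
    (σ : Representation ℂ G Y), σ.character = f ∧ ∀ (a : G → ℂ) (κ : ℂ),
      (∀ h w, a (h * w * h⁻¹) = a w) → (∀ χ ∈ s, ∑ w, a w * (χ 1 - χ w) = κ * χ 1) →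
      ∀ y, ∑ w, a w • (y - σ w y) = κ • y

lemma Real'.zero [Fintype G] (s : Finset (G → ℂ)) : Real' s 0 := by
  refine ⟨PUnit, inferInstance, inferInstance, inferInstance, 1, ?_, fun a κ _ _ y => rfl⟩
  ext g
  have : (1 : Representation ℂ G PUnit) g = 0 := LinearMap.ext fun _ => rfl
  simp [Representation.character, this]

lemma Real'.add [Fintype G] {s : Finset (G → ℂ)} {f f' : G → ℂ} (h : Real' s f) (h' : Real' s f') :
    Real' s (f + f') := by
  obtain ⟨Y, _, _, _, σ, rfl, hσ⟩ := h
  obtain ⟨Y', _, _, _, σ', rfl, hσ'⟩ := h'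
  refine ⟨Y × Y', inferInstance, inferInstance, inferInstance, σ.prod σ', ?_, fun a κ ha hκ y => ?_⟩
  · ext g
    exact LinearMap.trace_prodMap' (σ g) (σ' g)
  · refine Prod.ext ?_ ?_
    · rw [Prod.fst_sum]; exact hσ a κ ha hκ y.1
    · rw [Prod.snd_sum]; exact hσ' a κ ha hκ y.2

lemma Real'.irr [Fintype G] {s : Finset (G → ℂ)} {χ : G → ℂ} (hs : χ ∈ s) (h : IsIrredChar G χ) :
    Real' s χ := by
  obtain ⟨n, ρ, hn, hi, rfl⟩ := irrChar_rep h
  exact ⟨_, inferInstance, inferInstance, inferInstance, ρ, rfl, fun a κ ha hκ =>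
    schur hn ρ hi ha (hκ _ hs)⟩

lemma Real'.sum [Fintype G] {s : Finset (G → ℂ)} (h : ∀ χ ∈ s, IsIrredChar G χ) (n : (G → ℂ) → ℕ) :
    Real' s (∑ χ ∈ s, n χ • χ) := by
  refine Finset.sum_induction _ (Real' s) (fun _ _ => Real'.add) (Real'.zero s) fun χ hχ => ?_
  induction n χ with
  | zero => rw [zero_smul]; exact Real'.zero s
  | succ k ih => rw [succ_nsmul]; exact ih.add (Real'.irr hχ (h χ hχ))

end Setup

namespace Setup

lemma Bel_central {G : Type*} [Group G] [Fintype G] {a : G → ℂ} (ha : ∀ h w, a (h * w * h⁻¹) = a w)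
    (g : G) : MonoidAlgebra.of ℂ G g * Bel a = Bel a * MonoidAlgebra.of ℂ G g := by
  unfold Bel
  rw [Finset.mul_sum, Finset.sum_mul]
  rw [← Equiv.sum_comp (MulAut.conj g).toEquiv (fun w => a w • (1 - MonoidAlgebra.of ℂ G w) *
    MonoidAlgebra.of ℂ G g)]
  refine Finset.sum_congr rfl fun w _ => ?_
  have : (MulAut.conj g).toEquiv w = g * w * g⁻¹ := rfl
  rw [this, ha, mul_smul_comm, smul_mul_assoc, mul_sub, sub_mul, ← map_mul, ← map_mul]
  simp

lemma gen_of {G : Type*} [Group G] [Fintype G] (S : Finset (G → ℂ)) (hS : ∀ χ, χ ∈ S ↔ IsIrredChar G χ)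
    {a : G → ℂ} (ha : ∀ h w, a (h * w * h⁻¹) = a w) {l : ℂ}
    (h : ∀ χ ∈ S, ∀ j : ℤ, j ≠ 0 → ∑ w, a w * (χ 1 - χ w) ≠ (l + j) * χ 1) : Gen a l := by
  intro j hj
  by_contra hu
  let x : MonoidAlgebra ℂ G := algebraMap ℂ (MonoidAlgebra ℂ G) (l + j) - Bel a
  haveI : FiniteDimensional ℂ (MonoidAlgebra ℂ G) := inferInstance
  let ρ : Representation ℂ G (MonoidAlgebra ℂ G) :=
    { toFun := fun w => LinearMap.mulLeft ℂ (MonoidAlgebra.of ℂ G w)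
      map_one' := LinearMap.ext fun y => by rw [map_one]; simp only [LinearMap.mulLeft_apply, one_mul, Module.End.one_apply]
      map_mul' := fun u v => LinearMap.ext fun y => by
        rw [map_mul]; simp only [LinearMap.mulLeft_apply, Module.End.mul_apply, mul_assoc] }
  have hx : ∀ g, MonoidAlgebra.of ℂ G g * x = x * MonoidAlgebra.of ℂ G g := fun g => by
    simp only [x]
    rw [mul_sub, sub_mul, Bel_central ha, Algebra.commutes]
  let U := LinearMap.ker (LinearMap.mulLeft ℂ x)
  have hU : ∀ g, ∀ y ∈ U, ρ g y ∈ U := by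
    intro g y hy
    have hy' : x * y = 0 := hy
    change x * (MonoidAlgebra.of ℂ G g * y) = 0
    rw [← mul_assoc, ← hx, mul_assoc, hy', mul_zero]
  have hUne : U ≠ ⊥ := by
    intro hb
    have hinj := LinearMap.ker_eq_bot.1 hb
    obtain ⟨y, hy⟩ := (LinearMap.injective_iff_surjective.1 hinj) 1
    have hy' : x * y = 1 := hy
    have h1 : y * x = 1 := hinj (by
      change x * (y * x) = x * 1
      rw [← mul_assoc, hy', one_mul, mul_one])
    exact hu ⟨⟨x, y, hy', h1⟩, rfl⟩
  haveI : Nontrivial U := Submodule.nontrivial_iff_ne_bot.2 hUne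
  have hrel : ∀ m : U, ∑ w, a w • (m - subrep ρ U hU w m) = (l + j) • m := fun m => by
    apply Subtype.ext
    rw [Submodule.coe_sum]
    have hm : x * m.1 = 0 := m.2
    simp only [x] at hm
    rw [sub_mul, sub_eq_zero, ← Algebra.smul_def] at hm
    change ∑ w, a w • (m.1 - MonoidAlgebra.of ℂ G w * m.1) = (l + j) • m.1
    rw [hm, Bel, Finset.sum_mul]
    refine Finset.sum_congr rfl fun w _ => ?_
    rw [smul_mul_assoc, sub_mul, one_mul]
  obtain ⟨N, hN, hNn, hNi⟩ := exists_irr (subrep ρ U hU)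
  have hrel2 : ∀ m : N, ∑ w, a w • (m - subrep (subrep ρ U hU) N hN w m) = (l + j) • m := fun m => by
    apply Subtype.ext
    rw [Submodule.coe_sum]
    exact hrel m.1
  exact h _ ((hS _).2 (irrChar_of _ hNi)) j hj (sum_trace _ hrel2)

variable {G V : Type*} [Group G] [AddCommGroup V] [Module ℂ V]
    {π : Representation ℂ G V} {K : Type} [Field K] [Algebra ℂ K] (S : Setup π K)

theorem combine [Fintype G] [FiniteDimensional ℂ V] (I : Finset (G → ℂ)) (hI : ∀ χ, χ ∈ I ↔ IsIrredChar G χ)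
    (s : Finset (G → ℂ)) (hs : s ⊆ I)
    {a b : G → ℂ} (ha : S.Param a) (hb : S.Param b) {nn : G → ℕ}
    (hnn : ∀ h w, nn (h * w * h⁻¹) = nn w) (hnn1 : ∀ w, nn w ≤ 1)
    (hab : ∀ w ∈ S.R, b w = a w + nn w)
    (hcl : ∀ w ∈ S.R, nn w ≠ 0 → ∀ k : ℕ, 0 < k → k ≤ Fintype.card G → ∀ l : ℤ, a w * k ≠ l)
    (κ : ℂ) (D : ℕ)
    (hκa : ∀ χ ∈ s, ∑ w, a w * (χ 1 - χ w) = κ * χ 1)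
    (hga : ∀ χ ∈ I, ∀ j : ℤ, ∑ w, a w * (χ 1 - χ w) = (κ + j) * χ 1 → χ ∈ s)
    (hgb : ∀ χ ∈ I, ∀ j : ℤ, ∑ w, b w * (χ 1 - χ w) = (κ + D + j) * χ 1 → χ ∈ s)
    (hκb : ∀ χ ∈ s, ∑ w, b w * (χ 1 - χ w) = (κ + D) * χ 1)
    (v0 : V) (hv0 : ∀ w ∈ S.R, S.α w v0 ≠ 0) (g : G) (ζ : ℂ) (hζ : ζ ≠ 0) (hg : π g v0 = ζ • v0)
    (hD : ζ ^ D ≠ 1) : ∑ χ ∈ s, χ 1 * χ g⁻¹ = 0 := by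
  classical
  have hone : ∀ χ ∈ I, ∃ n : ℕ, χ 1 = n := fun χ hχ => by
    obtain ⟨n, -, h⟩ := irrChar_one ((hI χ).1 hχ)
    exact ⟨n, h⟩
  have hone' : ∀ χ ∈ I, χ 1 ≠ 0 := fun χ hχ => by
    obtain ⟨n, h0, h⟩ := irrChar_one ((hI χ).1 hχ)
    rw [h]; exact_mod_cast h0.ne'
  choose! deg hdeg using hone
  have hGa : Gen a κ := gen_of I hI ha.conj fun χ hχ j hj he => by
    have h1 := hκa χ (hga χ hχ j he)
    rw [he] at h1
    have h2 := mul_right_cancel₀ (hone' χ hχ) h1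
    apply hj
    have : (j : ℂ) = 0 := by linear_combination h2
    exact_mod_cast this
  have hGb : Gen b (κ + D) := gen_of I hI hb.conj fun χ hχ j hj he => by
    have h1 := hκb χ (hgb χ hχ j he)
    rw [he] at h1
    have h2 := mul_right_cancel₀ (hone' χ hχ) h1
    apply hj
    have : (j : ℂ) = 0 := by linear_combination h2
    exact_mod_cast this
  obtain ⟨Y, _, _, _, σ, hσ, hσ'⟩ := Real'.sum (s := s) (fun χ hχ => (hI χ).1 (hs hχ)) deg
  have hσc : ∀ h, σ.character h = ∑ χ ∈ s, deg χ * χ h := fun h => by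
    rw [hσ]; simp
  have hκ : ∀ y, ∑ w, a w • (y - σ w⁻¹ y) = κ • y := fun y => by
    rw [← hσ' a κ ha.conj hκa y, ← Equiv.sum_comp (Equiv.inv G)]
    refine Finset.sum_congr rfl fun w _ => ?_
    simp [ha.inv]
  obtain ⟨τ, φ, h1, h2, h3, h4, h5⟩ := S.shift σ ha hb hnn hnn1 hab hcl hκ D hGb v0 hv0 g ζ hζ hg
  have hdimY : Module.finrank ℂ Y = ∑ χ ∈ s, deg χ ^ 2 := by
    have : (Module.finrank ℂ Y : ℂ) = ∑ χ ∈ s, (deg χ : ℂ) ^ 2 := by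
      rw [← Representation.char_one σ, hσc]
      refine Finset.sum_congr rfl fun χ hχ => by rw [hdeg χ (hs hχ)]; ring
    exact_mod_cast this
  have hdimD : Module.finrank ℂ (Module.Dual ℂ Y) = Module.finrank ℂ Y := Subspace.dual_finrank_eq
  have hle := S.Com_le σ ha hb hκ hGa τ φ h1 h2 h3 h4 hGb hdimD
  have hcom : Module.finrank ℂ (Com σ.dual) = ∑ χ ∈ s, deg χ ^ 2 := by
    have : (Module.finrank ℂ (Com σ.dual) : ℂ) = ∑ χ ∈ s, (deg χ : ℂ) ^ 2 := by
      rw [com_formula, ← norm_sum s (fun χ hχ => (hI χ).1 (hs hχ))]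
      congr 1
      refine Finset.sum_congr rfl fun w _ => ?_
      rw [Representation.char_dual, Representation.char_dual, hσc, hσc, inv_inv, mul_comm]
    exact_mod_cast this
  have r1 := rigid I hI s hs deg hdeg (fun χ hχ h => hgb χ hχ 0 (by simpa using h)) τ h4
    (hdimD.trans hdimY) (hcom ▸ hle) g
  have r2 := rigid I hI s hs deg hdeg (fun χ hχ h => hga χ hχ 0 (by simpa using h)) σ.dual
    (sum_dual σ hκ) (hdimD.trans hdimY) hcom.le g
  have h6 : τ g = (ζ⁻¹) ^ D • σ.dual g := by
    refine LinearMap.ext fun m => ?_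
    rw [h5]; rfl
  have h7 : τ.character g = (ζ⁻¹) ^ D * σ.dual.character g := by
    unfold Representation.character
    rw [h6, map_smul, smul_eq_mul]
  rw [r1, ← r2] at h7
  have h8 : σ.dual.character g = 0 := by
    by_contra h0
    apply hD
    have : (ζ⁻¹) ^ D = 1 := mul_right_cancel₀ h0 (by rw [← h7, one_mul])
    rwa [inv_pow, inv_eq_one] at this
  rw [Representation.char_dual, hσc] at h8
  rw [← h8]
  exact Finset.sum_congr rfl fun χ hχ => by rw [hdeg χ (hs hχ)]

end Setup

namespace Conc
variable {V : Type*} [AddCommGroup V] [Module ℂ V] [FiniteDimensional ℂ V]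

/-- polynomial functions on `V` -/
abbrev PolyV (V : Type*) [AddCommGroup V] [Module ℂ V] : Type :=
  MvPolynomial (Fin (Module.finrank ℂ V)) ℂ

/-- rational functions on `V` -/
abbrev RatV (V : Type*) [AddCommGroup V] [Module ℂ V] : Type := FractionRing (PolyV V)

/-- linear forms as polynomials -/
def L : Module.Dual ℂ V →ₗ[ℂ] PolyV V where
  toFun ξ := ∑ i, ξ (Module.finBasis ℂ V i) • MvPolynomial.X i
  map_add' ξ η := by simp [add_smul, Finset.sum_add_distrib]
  map_smul' c ξ := by simp [mul_smul, Finset.smul_sum]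

lemma L_apply (ξ : Module.Dual ℂ V) :
    L ξ = ∑ i, ξ (Module.finBasis ℂ V i) • (MvPolynomial.X i : PolyV V) := rfl

lemma L_coord (i) : L ((Module.finBasis ℂ V).coord i) = MvPolynomial.X i := by
  rw [L_apply]
  simp [Finsupp.single_apply, ite_smul]

lemma L_inj : Function.Injective (L (V := V)) := by
  rw [← LinearMap.ker_eq_bot, LinearMap.ker_eq_bot']
  intro ξ h
  apply (Module.finBasis ℂ V).ext
  intro j
  have h2 : MvPolynomial.aeval (fun i => if i = j then (1 : ℂ) else 0) (L ξ) = 0 := by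
    rw [h, map_zero]
  rw [L_apply, map_sum] at h2
  simpa using h2

lemma dual_eq (ξ : Module.Dual ℂ V) :
    ξ = ∑ i, ξ (Module.finBasis ℂ V i) • (Module.finBasis ℂ V).coord i := by
  apply (Module.finBasis ℂ V).ext
  intro j
  simp [LinearMap.sum_apply, Finsupp.single_apply]

lemma L_deg (ξ : Module.Dual ℂ V) (hξ : ξ ≠ 0) : (L ξ).totalDegree = 1 := by
  have hh : (L ξ).IsHomogeneous 1 := by
    rw [L_apply]
    refine MvPolynomial.IsHomogeneous.sum _ _ _ fun i _ => ?_
    rw [MvPolynomial.smul_eq_C_mul]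
    exact (MvPolynomial.isHomogeneous_X ℂ i).C_mul _
  exact hh.totalDegree fun h => hξ (L_inj (by rw [h, map_zero]))

lemma L_prime (ξ : Module.Dual ℂ V) (hξ : ξ ≠ 0) : Prime (L ξ) := by
  rw [← irreducible_iff_prime]
  apply MvPolynomial.irreducible_of_totalDegree_eq_one (L_deg ξ hξ)
  intro x hx
  have h1 : L ξ ≠ 0 := fun h => hξ (L_inj (by rw [h, map_zero]))
  obtain ⟨i, hi⟩ := MvPolynomial.ne_zero_iff.1 h1
  have := hx i
  exact (ne_zero_of_dvd_ne_zero hi this).isUnit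

/-- the linear forms in `K` -/
def XK : Module.Dual ℂ V →ₗ[ℂ] RatV V := (Algebra.linearMap (PolyV V) (RatV V)).restrictScalars ℂ ∘ₗ L

lemma XK_apply (ξ : Module.Dual ℂ V) : XK ξ = algebraMap (PolyV V) (RatV V) (L ξ) := rfl

lemma am_inj : Function.Injective (algebraMap (PolyV V) (RatV V)) := IsFractionRing.injective _ _

lemma adj : Algebra.adjoin ℂ (Set.range (XK (V := V))) =
    (IsScalarTower.toAlgHom ℂ (PolyV V) (RatV V)).range := by
  apply le_antisymm
  · rw [Algebra.adjoin_le_iff]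
    rintro _ ⟨ξ, rfl⟩
    exact ⟨L ξ, rfl⟩
  · rw [← Algebra.map_top, ← MvPolynomial.adjoin_range_X, AlgHom.map_adjoin]
    apply Algebra.adjoin_mono
    rintro _ ⟨_, ⟨i, rfl⟩, rfl⟩
    exact ⟨(Module.finBasis ℂ V).coord i, by rw [XK_apply, L_coord]; rfl⟩

lemma mem_adj (x : RatV V) : x ∈ Algebra.adjoin ℂ (Set.range (XK (V := V))) ↔
    ∃ p, algebraMap (PolyV V) (RatV V) p = x := by
  rw [adj]; rfl

section der

lemma exists_der {A K : Type*} [CommRing A] [IsDomain A] [Field K] [Algebra ℂ A] [Algebra ℂ K]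
    [Algebra A K] [IsScalarTower ℂ A K] [IsFractionRing A K] (D0 : Derivation ℂ A K) :
    ∃ D : Derivation ℂ K K, ∀ p, D (algebraMap A K p) = D0 p := by
  let f : A →ₐ[ℂ] TrivSqZeroExt K K :=
    { toFun := fun p => TrivSqZeroExt.inl (algebraMap _ _ p) + TrivSqZeroExt.inr (D0 p)
      map_one' := by
        apply TrivSqZeroExt.ext
        · simp only [TrivSqZeroExt.fst_add, TrivSqZeroExt.fst_inl, TrivSqZeroExt.fst_inr, map_one,
            TrivSqZeroExt.fst_one, add_zero]
        · simp only [TrivSqZeroExt.snd_add, TrivSqZeroExt.snd_inl, TrivSqZeroExt.snd_inr,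
            TrivSqZeroExt.snd_one, zero_add, Derivation.map_one_eq_zero]
      map_mul' := fun p q => by
        apply TrivSqZeroExt.ext
        · simp only [TrivSqZeroExt.fst_add, TrivSqZeroExt.fst_inl, TrivSqZeroExt.fst_inr, map_mul,
            TrivSqZeroExt.fst_mul, add_zero]
        · simp only [TrivSqZeroExt.snd_add, TrivSqZeroExt.snd_inl, TrivSqZeroExt.snd_inr,
            TrivSqZeroExt.fst_add, TrivSqZeroExt.fst_inl, TrivSqZeroExt.fst_inr, add_zero,
            TrivSqZeroExt.snd_mul, zero_add, Derivation.leibniz, Algebra.smul_def,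
            op_smul_eq_smul, Algebra.algebraMap_self, RingHom.id_apply]
      map_zero' := by
        apply TrivSqZeroExt.ext
        · simp only [TrivSqZeroExt.fst_add, TrivSqZeroExt.fst_inl, TrivSqZeroExt.fst_inr, map_zero,
            TrivSqZeroExt.fst_zero, add_zero]
        · simp only [TrivSqZeroExt.snd_add, TrivSqZeroExt.snd_inl, TrivSqZeroExt.snd_inr,
            TrivSqZeroExt.snd_zero, zero_add, map_zero]
      map_add' := fun p q => by
        apply TrivSqZeroExt.ext
        · simp only [TrivSqZeroExt.fst_add, TrivSqZeroExt.fst_inl, TrivSqZeroExt.fst_inr, map_add,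
            add_zero]
        · simp only [TrivSqZeroExt.snd_add, TrivSqZeroExt.snd_inl, TrivSqZeroExt.snd_inr,
            zero_add, map_add]
      commutes' := fun c => by
        apply TrivSqZeroExt.ext
        · simp only [TrivSqZeroExt.fst_add, TrivSqZeroExt.fst_inl, TrivSqZeroExt.fst_inr,
            add_zero, TrivSqZeroExt.algebraMap_eq_inl']
          exact (IsScalarTower.algebraMap_apply ℂ A K c).symm
        · simp only [TrivSqZeroExt.snd_add, TrivSqZeroExt.snd_inl, TrivSqZeroExt.snd_inr,
            zero_add, TrivSqZeroExt.algebraMap_eq_inl', Derivation.map_algebraMap] }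
  have hf1 : ∀ p, (f p).fst = algebraMap A K p := fun p => by
    change TrivSqZeroExt.fst (TrivSqZeroExt.inl (algebraMap A K p) + TrivSqZeroExt.inr (D0 p)) = _
    rw [TrivSqZeroExt.fst_add, TrivSqZeroExt.fst_inl, TrivSqZeroExt.fst_inr, add_zero]
  have hf2 : ∀ p, (f p).snd = D0 p := fun p => by
    change TrivSqZeroExt.snd (TrivSqZeroExt.inl (algebraMap A K p) + TrivSqZeroExt.inr (D0 p)) = _
    rw [TrivSqZeroExt.snd_add, TrivSqZeroExt.snd_inl, TrivSqZeroExt.snd_inr, zero_add]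
  have hf : ∀ y : nonZeroDivisors A, IsUnit (f y) := fun y => by
    rw [TrivSqZeroExt.isUnit_iff_isUnit_fst, hf1]
    exact IsLocalization.map_units _ y
  let F : K →ₐ[ℂ] TrivSqZeroExt K K := IsLocalization.liftAlgHom hf
  have hF : ∀ p, F (algebraMap _ _ p) = f p := fun p => by
    exact IsLocalization.lift_eq hf p
  have hfst : ∀ x, (F x).fst = x := by
    have : (TrivSqZeroExt.fstHom ℂ K K).comp F = AlgHom.id ℂ _ := by
      apply IsLocalization.algHom_ext (nonZeroDivisors A)
      refine AlgHom.ext fun p => ?_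
      change (F (algebraMap A K p)).fst = algebraMap A K p
      rw [hF, hf1]
    intro x
    exact DFunLike.congr_fun this x
  let T : K →ₗ[ℂ] K :=
    { toFun := fun x => (F x).snd
      map_add' := fun x y => by rw [map_add, TrivSqZeroExt.snd_add]
      map_smul' := fun c x => by rw [map_smul, TrivSqZeroExt.snd_smul]; rfl }
  refine ⟨Derivation.mk' T ?_, ?_⟩
  · intro x y
    change (F (x * y)).snd = x * (F y).snd + y * (F x).snd
    rw [map_mul, TrivSqZeroExt.snd_mul, hfst, hfst, op_smul_eq_smul, smul_eq_mul, smul_eq_mul]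
  · intro p
    change (F (algebraMap A K p)).snd = D0 p
    rw [hF, hf2]

lemma der_ext (D : Derivation ℂ (RatV V) (RatV V)) (h : ∀ ξ, D (XK ξ) = 0) : D = 0 := by
  have h1 : ∀ p : PolyV V, D (algebraMap _ _ p) = 0 := by
    intro p
    have : algebraMap (PolyV V) (RatV V) p ∈ Algebra.adjoin ℂ (Set.range (XK (V := V))) :=
      (mem_adj _).2 ⟨p, rfl⟩
    generalize algebraMap (PolyV V) (RatV V) p = x at this
    induction this using Algebra.adjoin_induction with
    | mem x hx => obtain ⟨ξ, rfl⟩ := hx; exact h ξ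
    | algebraMap r => simp
    | add x y _ _ hx hy => rw [map_add, hx, hy, add_zero]
    | mul x y _ _ hx hy => rw [Derivation.leibniz, hx, hy]; simp
  ext x
  obtain ⟨p, q, hq, rfl⟩ := IsFractionRing.div_surjective (A := PolyV V) x
  have hq0 : algebraMap (PolyV V) (RatV V) q ≠ 0 := by
    simpa using nonZeroDivisors.ne_zero hq
  have h2 := D.leibniz (algebraMap (PolyV V) (RatV V) p / algebraMap (PolyV V) (RatV V) q)
    (algebraMap (PolyV V) (RatV V) q)
  rw [div_mul_cancel₀ _ hq0, h1, h1, smul_zero, zero_add, smul_eq_mul] at h2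
  rw [Derivation.zero_apply]
  exact (mul_eq_zero.1 h2.symm).resolve_left hq0

lemma der_ext' (D D' : Derivation ℂ (RatV V) (RatV V)) (h : ∀ ξ, D (XK ξ) = D' (XK ξ)) : D = D' := by
  rw [← sub_eq_zero]
  exact der_ext _ fun ξ => by rw [Derivation.sub_apply, h, sub_self]

lemma exists_der' (v : V) : ∃ D : Derivation ℂ (RatV V) (RatV V),
    ∀ ξ : Module.Dual ℂ V, D (XK ξ) = algebraMap ℂ _ (ξ v) := by
  obtain ⟨D, hD⟩ := exists_der (MvPolynomial.mkDerivation ℂ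
    (fun i => algebraMap ℂ (RatV V) ((Module.finBasis ℂ V).coord i v)))
  refine ⟨D, fun ξ => ?_⟩
  have h : ∀ i, D (XK ((Module.finBasis ℂ V).coord i)) =
      algebraMap ℂ (RatV V) ((Module.finBasis ℂ V).coord i v) := fun i => by
    rw [XK_apply, hD, L_coord, MvPolynomial.mkDerivation_X]
  conv_lhs => rw [dual_eq ξ]
  conv_rhs => rw [dual_eq ξ]
  rw [map_sum, map_sum, LinearMap.sum_apply, map_sum]
  refine Finset.sum_congr rfl fun i _ => ?_
  rw [map_smul, D.map_smul, h, LinearMap.smul_apply, smul_eq_mul, map_mul, Algebra.smul_def]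

/-- directional derivatives -/
def derK : V →ₗ[ℂ] Derivation ℂ (RatV V) (RatV V) where
  toFun v := (exists_der' v).choose
  map_add' u v := der_ext' _ _ fun ξ => by
    rw [(exists_der' _).choose_spec, Derivation.add_apply, (exists_der' _).choose_spec,
      (exists_der' _).choose_spec, map_add, map_add]
  map_smul' c v := der_ext' _ _ fun ξ => by
    rw [(exists_der' _).choose_spec, RingHom.id_apply, Derivation.smul_apply,
      (exists_der' _).choose_spec, map_smul, smul_eq_mul, map_mul, Algebra.smul_def]

end der

section act
variable {G : Type*} [Group G] (π : Representation ℂ G V)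

/-- action on polynomials -/
def actP (w : G) : PolyV V →ₐ[ℂ] PolyV V :=
  MvPolynomial.aeval fun i => L ((Module.finBasis ℂ V).coord i ∘ₗ π w⁻¹)

lemma actP_L (w : G) (ξ : Module.Dual ℂ V) : actP π w (L ξ) = L (ξ ∘ₗ π w⁻¹) := by
  conv_rhs => rw [dual_eq ξ]
  rw [L_apply, map_sum]
  have : (∑ i, ξ (Module.finBasis ℂ V i) • (Module.finBasis ℂ V).coord i) ∘ₗ π w⁻¹ =
      ∑ i, ξ (Module.finBasis ℂ V i) • ((Module.finBasis ℂ V).coord i ∘ₗ π w⁻¹) := by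
    refine LinearMap.ext fun v => ?_
    simp only [LinearMap.comp_apply, LinearMap.sum_apply, LinearMap.smul_apply]
  rw [this, map_sum]
  refine Finset.sum_congr rfl fun i _ => ?_
  rw [map_smul, map_smul]
  simp [actP]

lemma actP_mul (w w' : G) (p : PolyV V) : actP π (w * w') p = actP π w (actP π w' p) := by
  have : actP π (w * w') = (actP π w).comp (actP π w') := by
    apply MvPolynomial.algHom_ext
    intro i
    rw [AlgHom.comp_apply, ← L_coord, actP_L, actP_L, actP_L]
    congr 1
    refine LinearMap.ext fun v => ?_
    simp [map_mul]
  rw [this]; rfl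

lemma actP_one (p : PolyV V) : actP π 1 p = p := by
  have : actP π 1 = AlgHom.id ℂ (PolyV V) := by
    refine MvPolynomial.algHom_ext fun i => ?_
    rw [← L_coord (V := V), actP_L, AlgHom.id_apply]
    congr 1
    refine LinearMap.ext fun v => ?_
    simp
  rw [this]; rfl

lemma actP_inj (w : G) : Function.Injective (actP π w) := by
  intro p q h
  have := congrArg (actP π w⁻¹) h
  rwa [← actP_mul, ← actP_mul, inv_mul_cancel, actP_one, actP_one] at this

lemma hactK (w : G) : Function.Injective ((IsScalarTower.toAlgHom ℂ (PolyV V) (RatV V)).comp (actP π w)) :=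
  am_inj.comp (actP_inj π w)

/-- action on rational functions -/
def actK (w : G) : RatV V →ₐ[ℂ] RatV V := IsFractionRing.liftAlgHom (hactK π w)

lemma actK_am (w : G) (p : PolyV V) : actK π w (algebraMap _ _ p) = algebraMap _ _ (actP π w p) := by
  rw [actK, IsFractionRing.liftAlgHom_apply, IsFractionRing.lift_algebraMap]; rfl

/-- action as a homomorphism -/
def actH : G →* (RatV V →ₐ[ℂ] RatV V) where
  toFun := actK π
  map_one' := by
    apply IsLocalization.algHom_ext (nonZeroDivisors (PolyV V))
    refine AlgHom.ext fun p => ?_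
    change actK π 1 (algebraMap _ _ p) = algebraMap _ _ p
    rw [actK_am, actP_one]
  map_mul' w w' := by
    apply IsLocalization.algHom_ext (nonZeroDivisors (PolyV V))
    refine AlgHom.ext fun p => ?_
    change actK π (w * w') (algebraMap _ _ p) = actK π w (actK π w' (algebraMap _ _ p))
    rw [actK_am, actK_am, actK_am, actP_mul]

end act

/-- evaluation -/
def evK (v : V) : Algebra.adjoin ℂ (Set.range (XK (V := V))) →ₐ[ℂ] ℂ :=
  ((MvPolynomial.aeval fun i => (Module.finBasis ℂ V).coord i v).comp
    (AlgEquiv.ofInjective (IsScalarTower.toAlgHom ℂ (PolyV V) (RatV V)) am_inj).symm.toAlgHom).comp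
    (Subalgebra.inclusion (le_of_eq adj))

lemma evK_X (v : V) (ξ : Module.Dual ℂ V) :
    evK v ⟨XK ξ, Algebra.subset_adjoin ⟨ξ, rfl⟩⟩ = ξ v := by
  have h1 : (AlgEquiv.ofInjective (IsScalarTower.toAlgHom ℂ (PolyV V) (RatV V)) am_inj).symm
      (Subalgebra.inclusion (le_of_eq adj) ⟨XK ξ, Algebra.subset_adjoin ⟨ξ, rfl⟩⟩) = L ξ := by
    rw [AlgEquiv.symm_apply_eq]
    rfl
  change (MvPolynomial.aeval fun i => (Module.finBasis ℂ V).coord i v)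
    ((AlgEquiv.ofInjective (IsScalarTower.toAlgHom ℂ (PolyV V) (RatV V)) am_inj).symm
      (Subalgebra.inclusion (le_of_eq adj) ⟨XK ξ, Algebra.subset_adjoin ⟨ξ, rfl⟩⟩)) = ξ v
  rw [h1, L_apply, map_sum]
  conv_rhs => rw [dual_eq ξ]
  rw [LinearMap.sum_apply]
  refine Finset.sum_congr rfl fun i _ => ?_
  simp

/-- the concrete setup -/
def setup {G : Type*} [Group G] (π : Representation ℂ G V) (R : Set G) (α : G → Module.Dual ℂ V)
    (π_inj : Function.Injective π) (α_ne : ∀ w ∈ R, α w ≠ 0)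
    (α_ker : ∀ w ∈ R, ∀ v, α w v = 0 ↔ π w v = v)
    (mem_R : ∀ w, w ≠ 1 → (∃ ξ : Module.Dual ℂ V, ξ ≠ 0 ∧ ∀ v, ξ v = 0 → π w v = v) → w ∈ R)
    (one_R : (1 : G) ∉ R) : Setup π (RatV V) where
  act := actH π
  X := XK
  der := derK
  X_inj := am_inj.comp L_inj
  act_X w ξ := by
    rw [XK_apply, XK_apply, ← actP_L]
    exact actK_am π w _
  der_X v ξ := (exists_der' v).choose_spec ξ
  der_ext := der_ext
  frac f := by
    obtain ⟨p, q, hq, rfl⟩ := IsFractionRing.div_surjective (A := PolyV V) f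
    exact ⟨_, (mem_adj _).2 ⟨p, rfl⟩, _, (mem_adj _).2 ⟨q, rfl⟩,
      by simpa using nonZeroDivisors.ne_zero hq, rfl⟩
  prime ξ hξ p hp q hq := by
    rintro ⟨r, hr, h⟩
    obtain ⟨p, rfl⟩ := (mem_adj _).1 hp
    obtain ⟨q, rfl⟩ := (mem_adj _).1 hq
    obtain ⟨r, rfl⟩ := (mem_adj _).1 hr
    rw [XK_apply, ← map_mul, ← map_mul] at h
    rcases (L_prime ξ hξ).2.2 p q ⟨r, am_inj h⟩ with ⟨s, rfl⟩ | ⟨s, rfl⟩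
    · exact Or.inl ⟨_, (mem_adj _).2 ⟨s, rfl⟩, by rw [map_mul, XK_apply]⟩
    · exact Or.inr ⟨_, (mem_adj _).2 ⟨s, rfl⟩, by rw [map_mul, XK_apply]⟩
  nonunit ξ r hr h := by
    obtain ⟨r, rfl⟩ := (mem_adj _).1 hr
    rw [XK_apply, ← map_mul, ← map_one (algebraMap (PolyV V) (RatV V))] at h
    have h1 := am_inj h
    by_cases hξ : ξ = 0
    · rw [hξ, map_zero, zero_mul] at h1
      exact zero_ne_one h1
    · exact (L_prime ξ hξ).not_unit (IsUnit.of_mul_eq_one _ h1)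
  ev := evK
  ev_X := evK_X
  R := R
  α := α
  π_inj := π_inj
  α_ne := α_ne
  α_ker := α_ker
  mem_R := mem_R
  one_R := one_R

end Conc

namespace Conc

lemma exists_generic {ι : Type*} (s : Finset ι) {J : Type*} [Countable J] (x : J → ι → ℂ) (e : J → ℂ) :
    ∃ β : ι → ℂ, ∀ j, ∑ c ∈ s, β c * x j c = e j → ∀ c ∈ s, x j c = 0 := by
  classical
  induction s using Finset.induction_on with
  | empty => exact ⟨0, fun j _ c hc => by simp at hc⟩
  | insert c s hc ih =>
    obtain ⟨β, hβ⟩ := ih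
    have hcount : (Set.range fun j => (e j - ∑ c ∈ s, β c * x j c) / x j c).Countable :=
      Set.countable_range _
    obtain ⟨t, ht⟩ : ∃ t : ℂ, t ∉ Set.range fun j => (e j - ∑ c ∈ s, β c * x j c) / x j c := by
      by_contra hcon
      push Not at hcon
      exact not_countable_complex (hcount.mono fun z _ => hcon z)
    refine ⟨Function.update β c t, fun j hj => ?_⟩
    rw [Finset.sum_insert hc, Function.update_self] at hj
    have hsum : ∑ c' ∈ s, Function.update β c t c' * x j c' = ∑ c' ∈ s, β c' * x j c' :=
      Finset.sum_congr rfl fun c' hc' => by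
        rw [Function.update_of_ne]
        rintro rfl
        exact hc hc'
    rw [hsum] at hj
    have h0 : x j c = 0 := by
      by_contra h0
      apply ht
      refine ⟨j, ?_⟩
      change (e j - ∑ c ∈ s, β c * x j c) / x j c = t
      rw [div_eq_iff h0, ← hj]; ring
    rw [h0, mul_zero, zero_add] at hj
    intro c' hc'
    rcases Finset.mem_insert.1 hc' with rfl | h
    · exact h0
    · exact hβ j hj c' h

variable {V : Type*} [AddCommGroup V] [Module ℂ V] (W : Subgroup (V →ₗ[ℂ] V)ˣ)

/-- the natural representation -/
def natRep : Representation ℂ W V where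
  toFun := toLin W
  map_one' := rfl
  map_mul' _ _ := rfl

lemma natRep_apply (w : W) (v : V) : natRep W w v = toLin W w v := rfl

lemma natRep_inj : Function.Injective (natRep W) := fun _ _ h => Subtype.ext (Units.ext h)

lemma mem_fixed (w : W) (v : V) : v ∈ fixedSpace (w : (V →ₗ[ℂ] V)ˣ) ↔ natRep W w v = v := by
  unfold fixedSpace
  rw [LinearMap.mem_ker, LinearMap.sub_apply, sub_eq_zero]
  rfl

lemma fixed_conj (h w : W) : fixedSpace ((h * w * h⁻¹ : W) : (V →ₗ[ℂ] V)ˣ) =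
    (fixedSpace (w : (V →ₗ[ℂ] V)ˣ)).map (toLin W h) := by
  ext v
  rw [mem_fixed]
  constructor
  · intro hv
    refine ⟨natRep W h⁻¹ v, ?_, ?_⟩
    · change _ ∈ fixedSpace (w : (V →ₗ[ℂ] V)ˣ)
      rw [mem_fixed]
      conv_rhs => rw [← hv]
      simp [map_mul]
    · change natRep W h (natRep W h⁻¹ v) = v
      simp
  · rintro ⟨u, hu, rfl⟩
    have hu' := (mem_fixed W w u).1 hu
    change natRep W (h * w * h⁻¹) (natRep W h u) = natRep W h u
    simp [map_mul, hu']

lemma orbit_map (h : W) (H : Submodule ℂ V) : orbitOf W (H.map (toLin W h)) = orbitOf W H := by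
  have hmul : ∀ x y : W, (H.map (toLin W y)).map (toLin W x) = H.map (toLin W (x * y)) := fun x y => by
    rw [← Submodule.map_comp]; rfl
  ext H'
  constructor
  · rintro ⟨w, rfl⟩
    exact ⟨w * h, hmul w h⟩
  · rintro ⟨w, rfl⟩
    exact ⟨w * h⁻¹, by rw [hmul, inv_mul_cancel_right]⟩

lemma mem_orbit_self (H : Submodule ℂ V) : H ∈ orbitOf W H :=
  ⟨1, (Submodule.map_id H).symm⟩

lemma mem_orbit_iff (H H' : Submodule ℂ V) : H' ∈ orbitOf W H ↔ orbitOf W H' = orbitOf W H := by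
  constructor
  · rintro ⟨w, rfl⟩
    exact orbit_map W w H
  · intro h
    rw [← h]; exact mem_orbit_self W H'

lemma orbit_conj (h w : W) : orbitOf W (fixedSpace ((h * w * h⁻¹ : W) : (V →ₗ[ℂ] V)ˣ)) =
    orbitOf W (fixedSpace (w : (V →ₗ[ℂ] V)ˣ)) := by
  rw [fixed_conj, orbit_map]

variable [FiniteDimensional ℂ V]

lemma exists_form (w : W) : ∃ ξ : Module.Dual ℂ V, w ∈ refls W →
    LinearMap.ker ξ = fixedSpace (w : (V →ₗ[ℂ] V)ˣ) := by
  by_cases hw : w ∈ refls W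
  · have h1 : Module.finrank ℂ V = Module.finrank ℂ (fixedSpace (w : (V →ₗ[ℂ] V)ˣ)) + 1 := hw
    have h2 := Submodule.finrank_quotient_add_finrank (fixedSpace (w : (V →ₗ[ℂ] V)ˣ))
    have h3 : Module.finrank ℂ (V ⧸ fixedSpace (w : (V →ₗ[ℂ] V)ˣ)) = Module.finrank ℂ ℂ := by
      rw [Module.finrank_self]; omega
    let e := LinearEquiv.ofFinrankEq _ _ h3
    refine ⟨e.toLinearMap ∘ₗ Submodule.mkQ _, fun _ => ?_⟩
    rw [LinearEquiv.ker_comp, Submodule.ker_mkQ]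
  · exact ⟨0, fun h => (hw h).elim⟩

/-- a linear form cutting out the fixed hyperplane -/
def form (w : W) : Module.Dual ℂ V := (exists_form W w).choose

lemma form_ker (w : W) (hw : w ∈ refls W) (v : V) : form W w v = 0 ↔ natRep W w v = v := by
  rw [← mem_fixed, ← (exists_form W w).choose_spec hw]
  rfl

lemma one_not_refl : (1 : W) ∉ refls W := by
  intro h
  have h1 : Module.finrank ℂ V = Module.finrank ℂ (fixedSpace ((1 : W) : (V →ₗ[ℂ] V)ˣ)) + 1 := h
  have h2 : fixedSpace ((1 : W) : (V →ₗ[ℂ] V)ˣ) = ⊤ := by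
    rw [eq_top_iff]
    intro v _
    rw [mem_fixed]; simp
  rw [h2, finrank_top] at h1
  omega

lemma form_ne (w : W) (hw : w ∈ refls W) : form W w ≠ 0 := by
  intro h
  apply one_not_refl W
  have : w = 1 := natRep_inj W (LinearMap.ext fun v => by
    rw [(form_ker W w hw v).1 (by rw [h]; rfl)]; simp)
  rwa [← this]

lemma mem_refls (w : W) (hw : w ≠ 1)
    (h : ∃ ξ : Module.Dual ℂ V, ξ ≠ 0 ∧ ∀ v, ξ v = 0 → natRep W w v = v) : w ∈ refls W := by
  obtain ⟨ξ, hξ, hv⟩ := h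
  have h1 := Module.Dual.finrank_ker_add_one_of_ne_zero hξ
  have h2 : LinearMap.ker ξ ≤ fixedSpace (w : (V →ₗ[ℂ] V)ˣ) := fun v hv' =>
    (mem_fixed W w v).2 (hv v hv')
  have h3 := Submodule.finrank_mono h2
  have h4 : fixedSpace (w : (V →ₗ[ℂ] V)ˣ) < ⊤ := by
    rw [lt_top_iff_ne_top]
    intro ht
    apply hw
    refine natRep_inj W (LinearMap.ext fun v => ?_)
    rw [(mem_fixed W w v).1 (ht ▸ Submodule.mem_top)]; simp
  have h5 := Submodule.finrank_lt h4.ne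
  change Module.finrank ℂ V = _ + 1
  omega

/-- the setup attached to `W` -/
def SW : Setup (natRep W) (RatV V) :=
  setup (natRep W) (refls W) (form W) (natRep_inj W) (form_ne W) (form_ker W) (mem_refls W)
    (one_not_refl W)

lemma SW_R : (SW W).R = refls W := rfl
lemma SW_α : (SW W).α = form W := rfl

lemma refl_conj (h w : W) : h * w * h⁻¹ ∈ refls W ↔ w ∈ refls W := by
  constructor
  · intro hw
    have := (SW W).R_conj (h := h⁻¹) (w := h * w * h⁻¹) hw
    have e : h⁻¹ * (h * w * h⁻¹) * h⁻¹⁻¹ = w := by group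
    rwa [e] at this
  · exact fun hw => (SW W).R_conj hw

lemma fixed_eq (w w' : W) (hw : w ∈ refls W) (hw' : w' ∈ refls W)
    (h : ∀ v, form W w v = 0 → form W w' v = 0) :
    fixedSpace (w : (V →ₗ[ℂ] V)ˣ) = fixedSpace (w' : (V →ₗ[ℂ] V)ˣ) := by
  apply Submodule.eq_of_le_of_finrank_eq
  · intro v hv
    rw [mem_fixed, ← form_ker W _ hw'] 
    exact h v ((form_ker W _ hw v).2 ((mem_fixed W w v).1 hv))
  · have h1 : Module.finrank ℂ V = Module.finrank ℂ (fixedSpace (w : (V →ₗ[ℂ] V)ˣ)) + 1 := hw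
    have h2 : Module.finrank ℂ V = Module.finrank ℂ (fixedSpace (w' : (V →ₗ[ℂ] V)ˣ)) + 1 := hw'
    omega

open Classical in
/-- parameter from a function on orbits -/
def par (β : Set (Submodule ℂ V) → ℂ) (w : W) : ℂ :=
  if w ∈ refls W then β (orbitOf W (fixedSpace (w : (V →ₗ[ℂ] V)ˣ))) else 0

lemma par_param (β : Set (Submodule ℂ V) → ℂ) : (SW W).Param (par W β) where
  supp w hw := if_neg hw
  conj h w := by
    unfold par
    rw [orbit_conj]
    by_cases hw : w ∈ refls W
    · rw [if_pos hw, if_pos ((refl_conj W h w).2 hw)]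
    · rw [if_neg hw, if_neg fun h' => hw ((refl_conj W h w).1 h')]
  same w hw w' hw' h := by
    unfold par
    rw [if_pos (show w ∈ refls W from hw), if_pos (show w' ∈ refls W from hw'),
      fixed_eq W w w' hw hw' h]

open Classical in
lemma par_sum [Fintype W] (β : Set (Submodule ℂ V) → ℂ) (f : W → ℂ) :
    ∑ w, par W β w * f w =
      ∑ C ∈ (Finset.univ.filter (· ∈ refls W)).image
        (fun w : W => orbitOf W (fixedSpace (w : (V →ₗ[ℂ] V)ˣ))),
        β C * ∑ w ∈ Finset.univ.filter (fun w : W => w ∈ refls W ∧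
          orbitOf W (fixedSpace (w : (V →ₗ[ℂ] V)ˣ)) = C), f w := by
  have h1 : ∑ w, par W β w * f w = ∑ w ∈ Finset.univ.filter (· ∈ refls W), par W β w * f w := by
    rw [Finset.sum_filter]
    refine Finset.sum_congr rfl fun w _ => ?_
    split_ifs with h
    · rfl
    · rw [par, if_neg h, zero_mul]
  rw [h1, ← Finset.sum_fiberwise_of_maps_to (g := fun w : W =>
    orbitOf W (fixedSpace (w : (V →ₗ[ℂ] V)ˣ))) (fun w hw => Finset.mem_image.2 ⟨w, hw, rfl⟩)]
  refine Finset.sum_congr rfl fun C _ => ?_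
  rw [Finset.mul_sum, Finset.filter_filter]
  refine Finset.sum_congr rfl fun w hw => ?_
  rw [Finset.mem_filter] at hw
  rw [par, if_pos hw.2.1, hw.2.2]

end Conc

open Classical in
/-- Local cancellation lemma: for `W` irreducible and `g` regular of order `d`, if
`m` assigns a nonnegative integer to each orbit of hyperplanes and `d` does not
divide `m(C₀)` for some orbit `C₀`, then the sum of `χ(1)·χ(g⁻¹)` over all
irreducible characters `χ` with `c_{χ,C} = m(C)` for every orbit `C` vanishes.
(`c_{χ,C} = m(C)` is expressed by `Σ_{t ∈ C^ref} (χ(1) − χ(t)) = m(C)·χ(1)`.) -/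
theorem local_coxeter_number_cancellation
    (V : Type*) [AddCommGroup V] [Module ℂ V] [FiniteDimensional ℂ V]
    (W : Subgroup (V →ₗ[ℂ] V)ˣ) [Finite W]
    (hgen : Subgroup.closure (refls W) = ⊤)
    (hirr : IsIrredAction W)
    (d : ℕ) (g : W) (hg : IsRegularElt W g d)
    (m : Set (Submodule ℂ V) → ℕ)
    (hm : ∃ H ∈ arrangement W, ¬ d ∣ m (orbitOf W H))
    (S : Finset (W → ℂ)) (hS : ∀ χ : W → ℂ, χ ∈ S ↔ IsIrredChar W χ) :
    ∑ χ ∈ S.filter (fun χ => ∀ H ∈ arrangement W,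
        ∑ᶠ t ∈ Cref W H, (χ 1 - χ t) = (m (orbitOf W H) : ℂ) * χ 1),
      χ 1 * χ g⁻¹ = 0 := by
  classical
  letI : Fintype W := Fintype.ofFinite W
  obtain ⟨hord, ζ, v0, hv0, hζ, hgv, hreg⟩ := hg
  obtain ⟨H0, ⟨t0, ht0, rfl⟩, hm0⟩ := hm
  let orb : W → Set (Submodule ℂ V) := fun w => orbitOf W (fixedSpace (w : (V →ₗ[ℂ] V)ˣ))
  let C0 := orb t0
  let Orb := (Finset.univ.filter (· ∈ refls W)).image orb
  have hC0 : C0 ∈ Orb := Finset.mem_image.2 ⟨t0, Finset.mem_filter.2 ⟨Finset.mem_univ _, ht0⟩, rfl⟩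
  let cs : (W → ℂ) → Set (Submodule ℂ V) → ℂ := fun χ C =>
    ∑ w ∈ Finset.univ.filter (fun w : W => w ∈ refls W ∧ orb w = C), (χ 1 - χ w)
  have hfin : ∀ (χ : W → ℂ) H, ∑ᶠ t ∈ Cref W H, (χ 1 - χ t) = cs χ (orbitOf W H) := fun χ H => by
    rw [finsum_mem_eq_sum_of_inter_support_eq (t := Finset.univ.filter
      (fun w : W => w ∈ refls W ∧ orb w = orbitOf W H))]
    congr 1
    ext w
    simp only [Cref, Conc.mem_orbit_iff, Set.mem_setOf_eq, Finset.coe_filter, Finset.mem_univ,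
      true_and, orb]
  set s := S.filter (fun χ => ∀ H ∈ arrangement W,
        ∑ᶠ t ∈ Cref W H, (χ 1 - χ t) = (m (orbitOf W H) : ℂ) * χ 1) with hsdef
  have hone : ∀ χ ∈ S, χ 1 ≠ 0 := fun χ hχ => by
    obtain ⟨n, h0, h⟩ := Setup.irrChar_one ((hS χ).1 hχ)
    rw [h]; exact_mod_cast h0.ne'
  have hs1 : ∀ χ ∈ s, ∀ C ∈ Orb, cs χ C = m C * χ 1 := fun χ hχ C hC => by
    obtain ⟨w, hw, rfl⟩ := Finset.mem_image.1 hC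
    rw [← (Finset.mem_filter.1 hχ).2 _ ⟨w, (Finset.mem_filter.1 hw).2, rfl⟩, hfin]
  have hs2 : ∀ χ ∈ S, (∀ C ∈ Orb, cs χ C / χ 1 - m C = 0) → χ ∈ s := fun χ hχ h => by
    refine Finset.mem_filter.2 ⟨hχ, ?_⟩
    rintro H ⟨w, hw, rfl⟩
    have h1 := h (orb w) (Finset.mem_image.2 ⟨w, Finset.mem_filter.2 ⟨Finset.mem_univ _, hw⟩, rfl⟩)
    rw [hfin]
    rw [sub_eq_zero, div_eq_iff (hone χ hχ)] at h1
    exact h1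
  let x : (S × ℤ) ⊕ (S × ℤ) ⊕ (ℕ × ℤ) → Set (Submodule ℂ V) → ℂ := fun q C => match q with
    | Sum.inl p => cs p.1.1 C / p.1.1 1 - m C
    | Sum.inr (Sum.inl p) => cs p.1.1 C / p.1.1 1 - m C
    | Sum.inr (Sum.inr p) => if C = C0 then (p.1 : ℂ) else 0
  let e : (S × ℤ) ⊕ (S × ℤ) ⊕ (ℕ × ℤ) → ℂ := fun q => match q with
    | Sum.inl p => p.2
    | Sum.inr (Sum.inl p) => p.2 + (cs p.1.1 C0 / p.1.1 1 - m C0)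
    | Sum.inr (Sum.inr p) => p.2
  obtain ⟨β, hβ⟩ := Conc.exists_generic Orb x e
  have hβ1 : ∀ χ ∈ S, ∀ j : ℤ, ∑ C ∈ Orb, β C * (cs χ C / χ 1 - m C) = j → χ ∈ s :=
    fun χ hχ j h => hs2 χ hχ (hβ (Sum.inl (⟨χ, hχ⟩, j)) h)
  have hβ2 : ∀ χ ∈ S, ∀ j : ℤ, ∑ C ∈ Orb, β C * (cs χ C / χ 1 - m C) =
      j + (cs χ C0 / χ 1 - m C0) → χ ∈ s :=
    fun χ hχ j h => hs2 χ hχ (hβ (Sum.inr (Sum.inl (⟨χ, hχ⟩, j))) h)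
  have hβ3 : ∀ k : ℕ, 0 < k → ∀ l : ℤ, β C0 * k ≠ l := fun k hk l h => by
    have h1 := hβ (Sum.inr (Sum.inr (k, l))) (by
      change ∑ C ∈ Orb, β C * (if C = C0 then (k : ℂ) else 0) = l
      simp only [mul_ite, mul_zero]
      rw [Finset.sum_ite_eq' Orb C0, if_pos hC0, h]) C0 hC0
    change (if C0 = C0 then (k : ℂ) else 0) = 0 at h1
    rw [if_pos rfl] at h1
    exact hk.ne' (by exact_mod_cast h1)
  let β' : Set (Submodule ℂ V) → ℂ := fun C => β C - if C = C0 then 1 else 0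
  let nn : W → ℕ := fun w => if w ∈ refls W ∧ orb w = C0 then 1 else 0
  have hsb : ∀ χ : W → ℂ, ∑ w, Conc.par W β w * (χ 1 - χ w) = ∑ C ∈ Orb, β C * cs χ C := fun χ =>
    Conc.par_sum W β _
  have hsa : ∀ χ : W → ℂ, ∑ w, Conc.par W β' w * (χ 1 - χ w) =
      ∑ C ∈ Orb, β C * cs χ C - cs χ C0 := fun χ => by
    rw [Conc.par_sum W β']
    change ∑ C ∈ Orb, (β C - if C = C0 then 1 else 0) * cs χ C = _
    simp only [sub_mul, ite_mul, one_mul, zero_mul]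
    rw [Finset.sum_sub_distrib, Finset.sum_ite_eq' Orb C0, if_pos hC0]
  let κb : ℂ := ∑ C ∈ Orb, β C * m C
  have hx : ∀ χ ∈ S, ∑ C ∈ Orb, β C * (cs χ C / χ 1 - m C) =
      (∑ C ∈ Orb, β C * cs χ C) / χ 1 - κb := fun χ hχ => by
    rw [Finset.sum_div, ← Finset.sum_sub_distrib]
    exact Finset.sum_congr rfl fun C _ => by ring
  have hκb : ∀ χ ∈ s, ∑ C ∈ Orb, β C * cs χ C = κb * χ 1 := fun χ hχ => by
    rw [Finset.sum_mul]
    exact Finset.sum_congr rfl fun C hC => by rw [hs1 χ hχ C hC]; ring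
  have hsS : s ⊆ S := Finset.filter_subset _ _
  have hd : d ≠ 0 := by rw [← hord]; exact (orderOf_pos g).ne'
  refine (Conc.SW W).combine S hS s hsS (Conc.par_param W β') (Conc.par_param W β) (nn := nn)
    ?_ ?_ ?_ ?_ (κb - m C0) (m C0) ?_ ?_ ?_ ?_ v0 ?_ g ζ (hζ.ne_zero hd) hgv ?_
  · intro h w
    simp only [nn, orb, Conc.orbit_conj]
    refine if_congr ?_ rfl rfl
    rw [Conc.refl_conj]
  · intro w
    simp only [nn]
    split_ifs <;> simp
  · intro w hw
    have hw' : w ∈ refls W := hw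
    rw [Conc.par, Conc.par, if_pos hw', if_pos hw']
    change β (orb w) = (β (orb w) - if orb w = C0 then 1 else 0) + nn w
    simp only [nn, hw', true_and]
    split_ifs <;> simp
  · intro w hw hn k hk _ l hl
    have hw' : w ∈ refls W := hw
    have hC : orb w = C0 := by
      by_contra hC
      exact hn (if_neg fun h => hC h.2)
    rw [Conc.par, if_pos hw'] at hl
    change (β (orb w) - if orb w = C0 then 1 else 0) * (k : ℂ) = l at hl
    rw [hC, if_pos rfl] at hl
    apply hβ3 k hk (l + k)
    push_cast
    rw [← hl]; ring
  · intro χ hχ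
    rw [hsa, hκb χ hχ, hs1 χ hχ C0 hC0]; ring
  · intro χ hχ j h
    refine hβ2 χ hχ j ?_
    have h0 := hone χ hχ
    rw [hsa] at h
    rw [hx χ hχ]
    field_simp
    linear_combination h
  · intro χ hχ j h
    refine hβ1 χ hχ j ?_
    have h0 := hone χ hχ
    rw [hsb] at h
    rw [hx χ hχ]
    field_simp
    linear_combination h
  · intro χ hχ
    rw [hsb, hκb χ hχ]; ring
  · intro w hw h0
    exact hreg _ ⟨w, hw, rfl⟩ ((Conc.mem_fixed W w v0).2 ((Conc.form_ker W w hw v0).1 h0))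
  · intro h
    exact hm0 ((hζ.pow_eq_one_iff_dvd _).1 h)
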